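/- Let α be a rational number with 0 ≤ α ≤ 1/2 whose denominator in lowest terms belongs to the set {1,2,3,4,5,6,8,12}. Then liminf_{N→∞} #{p ≤ N : p prime and L(α,p) ≥ 0} / #{p ≤ N : p prime} ≥ 1/2; that is, the inequality L(α,p) ≥ 0 holds for a set of primes of lower density at least 1/2. -/

import Mathlib

open scoped Classical

/-- `L α p = ∑_{n=1}^{⌊α p⌋} (n/p)`, the sum of the first `⌊α p⌋` values of
the Legendre symbol modulo `p` (defined to be `0` when `p` is not prime). -/
noncomputable def legendreSum (α : ℝ) (p : ℕ) : ℤ :=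
  if h : p.Prime then
    haveI : Fact p.Prime := ⟨h⟩
    ∑ n ∈ Finset.Icc 1 ⌊α * (p : ℝ)⌋₊, legendreSym p (n : ℤ)
  else 0

section
namespace Tauber
open MeasureTheory Filter Topology Set

/-- Fejér kernel -/
noncomputable def fk (u : ℝ) : ℝ := 2 * (1 - Real.cos u) / u ^ 2

lemma fk_nonneg (u : ℝ) : 0 ≤ fk u := by
  unfold fk
  have := Real.cos_le_one u
  apply div_nonneg <;> nlinarith [sq_nonneg u]

lemma fk_le (u : ℝ) : fk u ≤ 5 * (1 + u ^ 2)⁻¹ := by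
  unfold fk
  by_cases hu : u = 0
  · subst hu; norm_num
  have h2 : 0 < u ^ 2 := by positivity
  have h1 := Real.one_sub_sq_div_two_le_cos (x := u)
  have h3 := Real.neg_one_le_cos u
  rw [div_le_iff₀ h2, mul_comm 5, mul_assoc, inv_mul_eq_div, le_div_iff₀ (by positivity)]
  nlinarith

lemma fk_measurable : Measurable fk := by
  unfold fk
  fun_prop

lemma fk_integrable : Integrable fk := by
  refine Integrable.mono' (integrable_inv_one_add_sq.const_mul 5) fk_measurable.aestronglyMeasurable ?_
  filter_upwards with u
  rw [Real.norm_of_nonneg (fk_nonneg u)]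
  exact fk_le u

lemma fk_integral_pos : 0 < ∫ u, fk u := by
  rw [integral_pos_iff_support_of_nonneg fk_nonneg fk_integrable]
  have hsub : Ioo (1:ℝ) 2 ⊆ Function.support fk := by
    intro u hu
    have h1 : Real.cos u < 1 := by
      have := Real.cos_lt_cos_of_nonneg_of_le_pi (x := 0) (y := u) le_rfl
        (by linarith [hu.2, Real.pi_gt_three]) (by linarith [hu.1])
      simpa using this
    have hu0 : 0 < u := by linarith [hu.1]
    have : 0 < fk u := by unfold fk; apply div_pos; linarith; positivity
    exact this.ne'
  refine lt_of_lt_of_le ?_ (measure_mono hsub)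
  simp

/-- Fourier representation -/
lemma fk_fourier {u : ℝ} (hu : u ≠ 0) :
    ((fk u : ℝ) : ℂ) = ∫ ξ in (-1:ℝ)..1, ((1 - |ξ| : ℝ) : ℂ) * Complex.exp (Complex.I * ξ * u) := by
  have hu' : (u : ℂ) ≠ 0 := by exact_mod_cast hu
  have hI : Complex.I * u ≠ 0 := mul_ne_zero Complex.I_ne_zero hu'
  have hcont : Continuous fun ξ : ℝ => ((1 - |ξ| : ℝ) : ℂ) * Complex.exp (Complex.I * ξ * u) := by
    fun_prop
  rw [← intervalIntegral.integral_add_adjacent_intervals (b := 0)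
    (hcont.intervalIntegrable _ _) (hcont.intervalIntegrable _ _)]
  have h1 : ∫ ξ in (0:ℝ)..1, ((1 - |ξ| : ℝ) : ℂ) * Complex.exp (Complex.I * ξ * u) =
      (Complex.exp (Complex.I * u) / (Complex.I * u) ^ 2)
       - (1 / (Complex.I * u) + 1 / (Complex.I * u) ^ 2) := by
    rw [intervalIntegral.integral_eq_sub_of_hasDerivAt
      (f := fun ξ : ℝ => ((1 - ξ : ℝ) : ℂ) * (Complex.exp (Complex.I * ξ * u) / (Complex.I * u)) +
        Complex.exp (Complex.I * ξ * u) / (Complex.I * u) ^ 2)]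
    · simp
    · intro ξ hξ
      rw [uIcc_of_le (by norm_num)] at hξ
      rw [abs_of_nonneg hξ.1]
      have e1 : HasDerivAt (fun ξ : ℝ => Complex.exp (Complex.I * ξ * u))
          (Complex.exp (Complex.I * ξ * u) * (Complex.I * u)) ξ := by
        have : HasDerivAt (fun ξ : ℝ => Complex.I * (ξ:ℂ) * u) (Complex.I * 1 * u) ξ :=
          ((Complex.ofRealCLM.hasDerivAt).const_mul Complex.I).mul_const _
        simpa using this.cexp
      have e2 : HasDerivAt (fun ξ : ℝ => ((1 - ξ : ℝ) : ℂ)) (-1) ξ := by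
        have := ((hasDerivAt_id ξ).const_sub 1).ofReal_comp
        simpa using this
      refine ((e2.mul (e1.div_const (Complex.I * u))).add
        (e1.div_const ((Complex.I * u)^2))).congr_deriv ?_
      field_simp
      ring
    · exact hcont.intervalIntegrable _ _
  have h2 : ∫ ξ in (-1:ℝ)..0, ((1 - |ξ| : ℝ) : ℂ) * Complex.exp (Complex.I * ξ * u) =
      (1 / (Complex.I * u) - 1 / (Complex.I * u) ^ 2) -
        ( - Complex.exp (-(Complex.I * u)) / (Complex.I * u) ^ 2) := by
    rw [intervalIntegral.integral_eq_sub_of_hasDerivAt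
      (f := fun ξ : ℝ => ((1 + ξ : ℝ) : ℂ) * (Complex.exp (Complex.I * ξ * u) / (Complex.I * u)) -
        Complex.exp (Complex.I * ξ * u) / (Complex.I * u) ^ 2)]
    · simp
      ring
    · intro ξ hξ
      rw [uIcc_of_le (by norm_num)] at hξ
      rw [abs_of_nonpos hξ.2]
      have e1 : HasDerivAt (fun ξ : ℝ => Complex.exp (Complex.I * ξ * u))
          (Complex.exp (Complex.I * ξ * u) * (Complex.I * u)) ξ := by
        have : HasDerivAt (fun ξ : ℝ => Complex.I * (ξ:ℂ) * u) (Complex.I * 1 * u) ξ :=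
          ((Complex.ofRealCLM.hasDerivAt).const_mul Complex.I).mul_const _
        simpa using this.cexp
      have e2 : HasDerivAt (fun ξ : ℝ => ((1 + ξ : ℝ) : ℂ)) (1) ξ := by
        have := ((hasDerivAt_id ξ).const_add 1).ofReal_comp
        simpa using this
      refine ((e2.mul (e1.div_const (Complex.I * u))).sub
        (e1.div_const ((Complex.I * u)^2))).congr_deriv ?_
      field_simp
      push_cast
      ring
    · exact hcont.intervalIntegrable _ _
  rw [h1, h2]
  unfold fk
  push_cast
  rw [Complex.cos]
  have hI2 : (Complex.I * u) ^ 2 = - (u:ℂ)^2 := by rw [mul_pow, Complex.I_sq]; ring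
  rw [hI2]
  rw [show Complex.I * (u:ℂ) = u * Complex.I by ring, neg_mul]
  field_simp
  ring

/-- The approximate-identity contradiction lemma. -/
lemma not_freq {F : ℝ → ℝ} {B : ℝ} (hF : Measurable F) (hB : ∀ t, |F t| ≤ B)
    (hconv : ∀ l : ℝ, 0 < l → Tendsto (fun T => ∫ t, F t * fk (l * (T - t))) atTop (𝓝 0))
    {c h : ℝ} (hc : 0 < c) (hh : 0 < h) :
    ¬ ∃ᶠ T in atTop, ∀ t, |t - T| ≤ h → c ≤ F t := by
  intro hfreq
  have hB0 : 0 ≤ B := (abs_nonneg _).trans (hB 0)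
  -- choose l
  have hlim : Tendsto (fun l : ℝ => ∫ u, (c - (B + c) * (if l * h < |u| then 1 else 0)) * fk u)
      atTop (𝓝 (∫ u, c * fk u)) := by
    apply tendsto_integral_filter_of_dominated_convergence (fun u => (2 * c + B) * fk u)
    · filter_upwards with l
      apply Measurable.aestronglyMeasurable
      apply Measurable.mul _ fk_measurable
      apply Measurable.const_sub
      apply Measurable.const_mul
      exact Measurable.ite (measurableSet_lt measurable_const measurable_id.abs) measurable_const measurable_const
    · filter_upwards with l
      filter_upwards with u
      rw [norm_mul, Real.norm_of_nonneg (fk_nonneg u)]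
      apply mul_le_mul_of_nonneg_right _ (fk_nonneg u)
      rw [Real.norm_eq_abs, abs_le]
      split_ifs <;> constructor <;> linarith
    · exact fk_integrable.const_mul _
    · filter_upwards with u
      apply tendsto_const_nhds.congr'
      filter_upwards [eventually_ge_atTop (|u| / h)] with l hl
      have : ¬ (l * h < |u|) := by
        rw [not_lt]; rwa [div_le_iff₀ hh] at hl
      simp [this]
  have hpos : 0 < ∫ u, c * fk u := by
    rw [integral_const_mul]; exact mul_pos hc fk_integral_pos
  obtain ⟨l, hl, hl0⟩ := ((hlim.eventually (lt_mem_nhds hpos)).and (eventually_gt_atTop 0)).exists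
  set η := ∫ u, (c - (B + c) * (if l * h < |u| then 1 else 0)) * fk u with hη
  have hIntg : Integrable (fun u => (c - (B + c) * (if l * h < |u| then 1 else 0)) * fk u) := by
    refine Integrable.mono' (fk_integrable.const_mul (2 * c + B)) ?_ ?_
    · apply Measurable.aestronglyMeasurable
      apply Measurable.mul _ fk_measurable
      apply Measurable.const_sub
      apply Measurable.const_mul
      exact Measurable.ite (measurableSet_lt measurable_const measurable_id.abs) measurable_const measurable_const
    · filter_upwards with u
      rw [norm_mul, Real.norm_of_nonneg (fk_nonneg u)]
      apply mul_le_mul_of_nonneg_right _ (fk_nonneg u)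
      rw [Real.norm_eq_abs, abs_le]
      split_ifs <;> constructor <;> linarith
  have hev := (hconv l hl0).eventually (gt_mem_nhds (show (0:ℝ) < l⁻¹ * η by positivity))
  obtain ⟨T, hT1, hT2⟩ := (hfreq.and_eventually hev).exists
  have hsub : ∫ t, (c - (B + c) * (if l * h < |l * (T - t)| then 1 else 0)) * fk (l * (T - t))
      = l⁻¹ * η := by
    rw [integral_sub_left_eq_self (fun t => (c - (B + c) * (if l * h < |l * t| then 1 else 0)) * fk (l * t)) volume T]
    have := Measure.integral_comp_mul_left (fun u => (c - (B + c) * (if l * h < |u| then 1 else 0)) * fk u) l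
    rw [this, abs_of_pos (by positivity), smul_eq_mul]
  have hfki : Integrable (fun t => fk (l * (T - t))) := by
    have := (fk_integrable.comp_mul_left' hl0.ne').comp_sub_left T
    exact this
  have hle : l⁻¹ * η ≤ ∫ t, F t * fk (l * (T - t)) := by
    rw [← hsub]
    apply integral_mono
    · have := (hIntg.comp_mul_left' hl0.ne').comp_sub_left T
      exact this
    · refine Integrable.mono' (hfki.const_mul B) ?_ ?_
      · apply Measurable.aestronglyMeasurable
        exact hF.mul (fk_measurable.comp (by fun_prop))
      · filter_upwards with t
        rw [norm_mul, Real.norm_of_nonneg (fk_nonneg _)]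
        exact mul_le_mul_of_nonneg_right (hB t) (fk_nonneg _)
    · intro t
      apply mul_le_mul_of_nonneg_right _ (fk_nonneg _)
      have h1 := (abs_le.mp (hB t)).1
      split_ifs with hif
      · linarith
      · rw [abs_mul, abs_of_pos hl0] at hif
        have : |T - t| ≤ h := by
          rw [not_lt] at hif
          exact le_of_mul_le_mul_left hif hl0
        have := hT1 t (by rwa [abs_sub_comm])
        linarith
  linarith

end Tauber
end

section
namespace Tauber
open MeasureTheory Filter Topology Set

section
variable {f : ℝ → ℝ} {B : ℝ} {g : ℂ → ℂ}

lemma exp_fubini (hf : Measurable f) (hB : ∀ t, |f t| ≤ B)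
    (hg : ∀ z : ℂ, 0 < z.re → ∫ t in Ioi (0:ℝ), (f t : ℂ) * Complex.exp (-z * t) = g z)
    {l e : ℝ} (hl : 0 < l) (he : 0 < e) (T : ℝ) :
    ∫ t in Ioi (0:ℝ), ((f t * fk (l * (T - t)) : ℝ) : ℂ) * Complex.exp (-(e * t : ℝ)) =
      ∫ ξ in (-1:ℝ)..1, ((1 - |ξ| : ℝ) : ℂ) * Complex.exp (Complex.I * ξ * (l * T : ℝ)) *
        g (e + Complex.I * (l * ξ : ℝ)) := by
  have h1 : ∀ᵐ t ∂(volume.restrict (Ioi (0:ℝ))),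
      ((f t * fk (l * (T - t)) : ℝ) : ℂ) * Complex.exp (-(e * t : ℝ)) =
      ∫ ξ in (-1:ℝ)..1, ((f t : ℝ) : ℂ) * Complex.exp (-(e * t : ℝ)) * (((1 - |ξ| : ℝ) : ℂ) *
        Complex.exp (Complex.I * ξ * (l * (T - t) : ℝ))) := by
    have : ∀ᵐ t ∂(volume.restrict (Ioi (0:ℝ))), t ≠ T := by
      apply ae_restrict_of_ae
      simp [ae_iff]
    filter_upwards [this] with t ht
    have hne : l * (T - t) ≠ 0 := mul_ne_zero hl.ne' (sub_ne_zero.mpr (Ne.symm ht))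
    rw [intervalIntegral.integral_const_mul, ← fk_fourier hne]
    push_cast
    ring
  rw [integral_congr_ae h1]
  simp_rw [intervalIntegral.integral_of_le (show (-1:ℝ) ≤ 1 by norm_num)]
  rw [integral_integral_swap]
  · apply integral_congr_ae
    filter_upwards with ξ
    have hz : 0 < ((e:ℂ) + Complex.I * (l * ξ : ℝ)).re := by simpa using he
    rw [← hg _ hz, ← integral_const_mul]
    apply integral_congr_ae
    filter_upwards with t
    have : Complex.exp (Complex.I * ξ * (l * (T - t) : ℝ)) =
        Complex.exp (Complex.I * ξ * (l * T : ℝ)) * Complex.exp (- Complex.I * ξ * (l * t : ℝ)) := by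
      rw [← Complex.exp_add]; congr 1; push_cast; ring
    have h3 : Complex.exp (-((e:ℂ) + Complex.I * (l * ξ : ℝ)) * t) =
        Complex.exp (-(e * t : ℝ)) * Complex.exp (- Complex.I * ξ * (l * t : ℝ)) := by
      rw [← Complex.exp_add]; congr 1; push_cast; ring
    rw [this, h3]
    ring
  · have hIntg : Integrable (fun t : ℝ => B * Real.exp (-(e * t))) (volume.restrict (Ioi 0)) := by
      apply Integrable.const_mul
      have := integrableOn_exp_mul_Ioi (a := -e) (by linarith) 0
      simpa [IntegrableOn] using this
    have hprod : Integrable (fun z : ℝ × ℝ => (B * Real.exp (-(e * z.1))) * (1:ℝ))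
        ((volume.restrict (Ioi 0)).prod (volume.restrict (Ioc (-1) 1))) :=
      Integrable.mul_prod (f := fun t : ℝ => B * Real.exp (-(e * t))) (g := fun _ => (1:ℝ)) hIntg
        (integrable_const _)
    refine Integrable.mono' hprod ?_ ?_
    · apply Measurable.aestronglyMeasurable
      simp only [Function.uncurry_def]
      have : Measurable fun x : ℝ × ℝ => f x.1 := hf.comp measurable_fst
      have h4 : Measurable fun x : ℝ × ℝ => ((f x.1 : ℝ) : ℂ) := Complex.measurable_ofReal.comp this
      apply Measurable.mul
      · apply h4.mul
        fun_prop
      · fun_prop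
    · rw [Measure.prod_restrict]
      filter_upwards [ae_restrict_mem (measurableSet_Ioi.prod measurableSet_Ioc)] with z hz
      obtain ⟨-, hz2⟩ := hz
      simp only [Function.uncurry_def]
      rw [norm_mul, norm_mul, norm_mul]
      have e1 : ‖Complex.exp (Complex.I * z.2 * (l * (T - z.1) : ℝ))‖ = 1 := by
        rw [Complex.norm_exp]; simp
      have e2 : ‖Complex.exp (-(e * z.1 : ℝ))‖ = Real.exp (-(e * z.1)) := by
        rw [Complex.norm_exp]; simp
      have e3 : ‖((1 - |z.2| : ℝ) : ℂ)‖ ≤ 1 := by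
        rw [Complex.norm_real, Real.norm_eq_abs, abs_le]
        have := abs_le.mpr ⟨hz2.1.le, hz2.2⟩
        constructor <;> linarith [abs_nonneg z.2]
      rw [e1, e2, mul_one, Complex.norm_real]
      have hB0 : 0 ≤ B := (abs_nonneg _).trans (hB 0)
      have h7 : ‖f z.1‖ ≤ B := hB _
      have h8 : ‖f z.1‖ * Real.exp (-(e * z.1)) ≤ B * Real.exp (-(e * z.1)) := by gcongr
      exact mul_le_mul h8 e3 (norm_nonneg _) (by positivity)

lemma conv_eq (hf : Measurable f) (hB : ∀ t, |f t| ≤ B)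
    (hg : ∀ z : ℂ, 0 < z.re → ∫ t in Ioi (0:ℝ), (f t : ℂ) * Complex.exp (-z * t) = g z)
    (hgc : ContinuousOn g {z | 0 ≤ z.re})
    {l : ℝ} (hl : 0 < l) (T : ℝ) :
    ∫ t in Ioi (0:ℝ), ((f t * fk (l * (T - t)) : ℝ) : ℂ) =
      ∫ ξ in (-1:ℝ)..1, ((1 - |ξ| : ℝ) : ℂ) * Complex.exp (Complex.I * ξ * (l * T : ℝ)) *
        g (Complex.I * (l * ξ : ℝ)) := by
  have hB0 : 0 ≤ B := (abs_nonneg _).trans (hB 0)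
  have hfki : Integrable (fun t => fk (l * (T - t))) :=
    (fk_integrable.comp_mul_left' hl.ne').comp_sub_left T
  have hm : Measurable (fun t => f t * fk (l * (T - t))) := hf.mul (fk_measurable.comp (by fun_prop))
  have lim1 : Tendsto (fun e : ℝ => ∫ t in Ioi (0:ℝ), ((f t * fk (l * (T - t)) : ℝ) : ℂ) *
      Complex.exp (-(e * t : ℝ))) (𝓝[>] 0) (𝓝 (∫ t in Ioi (0:ℝ), ((f t * fk (l * (T - t)) : ℝ) : ℂ))) := by
    apply tendsto_integral_filter_of_dominated_convergence (fun t => B * fk (l * (T - t)))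
    · filter_upwards with e
      apply Measurable.aestronglyMeasurable
      exact (Complex.measurable_ofReal.comp hm).mul (by fun_prop)
    · filter_upwards [self_mem_nhdsWithin] with e (he : 0 < e)
      filter_upwards [ae_restrict_mem measurableSet_Ioi] with t (ht : 0 < t)
      rw [norm_mul, Complex.norm_real, Complex.norm_exp, norm_mul, Real.norm_of_nonneg (fk_nonneg _)]
      have : Real.exp ((-((e * t : ℝ) : ℂ)).re) ≤ 1 := by
        rw [Real.exp_le_one_iff]; simp; positivity
      calc _ ≤ ‖f t‖ * fk (l * (T - t)) * 1 := by
            gcongr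
            exact mul_nonneg (norm_nonneg _) (fk_nonneg _)
        _ ≤ _ := by
            rw [mul_one]
            exact mul_le_mul_of_nonneg_right (hB t) (fk_nonneg _)
    · exact (hfki.const_mul B).restrict
    · filter_upwards with t
      have : Continuous fun e : ℝ => ((f t * fk (l * (T - t)) : ℝ) : ℂ) * Complex.exp (-(e * t : ℝ)) := by
        fun_prop
      have h2 := (this.tendsto 0).mono_left (nhdsWithin_le_nhds (s := Ioi (0:ℝ)))
      simpa using h2
  -- bound on g
  obtain ⟨C, hC⟩ : ∃ C, ∀ e ∈ Icc (0:ℝ) 1, ∀ ξ ∈ Icc (-1:ℝ) 1,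
      ‖g ((e:ℂ) + Complex.I * (l * ξ : ℝ))‖ ≤ C := by
    have hK : IsCompact ((Icc (0:ℝ) 1) ×ˢ (Icc (-1:ℝ) 1)) := isCompact_Icc.prod isCompact_Icc
    have hc : ContinuousOn (fun z : ℝ × ℝ => g ((z.1:ℂ) + Complex.I * (l * z.2 : ℝ)))
        ((Icc (0:ℝ) 1) ×ˢ (Icc (-1:ℝ) 1)) := by
      apply hgc.comp (by fun_prop)
      rintro ⟨a, b⟩ ⟨ha, -⟩
      simpa using ha.1
    obtain ⟨C, hC⟩ := hK.exists_bound_of_continuousOn hc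
    exact ⟨C, fun e he ξ hξ => hC (e, ξ) ⟨he, hξ⟩⟩
  have lim2 : Tendsto (fun e : ℝ => ∫ ξ in (-1:ℝ)..1, ((1 - |ξ| : ℝ) : ℂ) *
      Complex.exp (Complex.I * ξ * (l * T : ℝ)) * g (e + Complex.I * (l * ξ : ℝ))) (𝓝[>] 0)
      (𝓝 (∫ ξ in (-1:ℝ)..1, ((1 - |ξ| : ℝ) : ℂ) *
      Complex.exp (Complex.I * ξ * (l * T : ℝ)) * g (Complex.I * (l * ξ : ℝ)))) := by
    apply intervalIntegral.tendsto_integral_filter_of_dominated_convergence (fun _ => C)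
    · filter_upwards [self_mem_nhdsWithin] with e (he : 0 < e)
      apply Continuous.aestronglyMeasurable
      apply Continuous.mul (by fun_prop)
      apply hgc.comp_continuous (by fun_prop)
      intro ξ
      simpa using he.le
    · filter_upwards [Ioc_mem_nhdsGT (show (0:ℝ) < 1 by norm_num)] with e he
      filter_upwards with ξ hξ
      rw [uIoc_of_le (by norm_num)] at hξ
      have hξ' : ξ ∈ Icc (-1:ℝ) 1 := ⟨hξ.1.le, hξ.2⟩
      have := hC e ⟨he.1.le, he.2⟩ ξ hξ'
      rw [norm_mul, norm_mul]
      have e1 : ‖Complex.exp (Complex.I * ξ * (l * T : ℝ))‖ = 1 := by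
        rw [Complex.norm_exp]; simp
      have e3 : ‖((1 - |ξ| : ℝ) : ℂ)‖ ≤ 1 := by
        rw [Complex.norm_real, Real.norm_eq_abs, abs_le]
        have := abs_le.mpr hξ'
        constructor <;> linarith [abs_nonneg ξ]
      rw [e1, mul_one]
      calc _ ≤ 1 * ‖g (e + Complex.I * (l * ξ : ℝ))‖ := by gcongr
        _ ≤ C := by rw [one_mul]; exact this
    · exact intervalIntegrable_const
    · filter_upwards with ξ hξ
      apply Tendsto.const_mul
      have h0 : Tendsto (fun e : ℝ => (e:ℂ) + Complex.I * (l * ξ : ℝ)) (𝓝[>] 0)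
          (𝓝[{z | 0 ≤ z.re}] (Complex.I * (l * ξ : ℝ))) := by
        apply tendsto_nhdsWithin_iff.mpr
        constructor
        · have : Continuous fun e : ℝ => (e:ℂ) + Complex.I * (l * ξ : ℝ) := by fun_prop
          have h2 := (this.tendsto 0).mono_left (nhdsWithin_le_nhds (s := Ioi (0:ℝ)))
          simpa using h2
        · filter_upwards [self_mem_nhdsWithin] with e (he : 0 < e)
          simpa using he.le
      exact (hgc _ (by simp)).tendsto.comp h0
  refine tendsto_nhds_unique (lim1.congr' ?_) lim2
  filter_upwards [self_mem_nhdsWithin] with e (he : 0 < e)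
  exact exp_fubini hf hB hg hl he T

lemma conv_tendsto (hf : Measurable f) (hB : ∀ t, |f t| ≤ B)
    (hg : ∀ z : ℂ, 0 < z.re → ∫ t in Ioi (0:ℝ), (f t : ℂ) * Complex.exp (-z * t) = g z)
    (hgc : ContinuousOn g {z | 0 ≤ z.re})
    {l : ℝ} (hl : 0 < l) :
    Tendsto (fun T => ∫ t in Ioi (0:ℝ), f t * fk (l * (T - t))) atTop (𝓝 0) := by
  have key := Real.tendsto_integral_exp_smul_cocompact
    (fun ξ : ℝ => (Ioc (-1:ℝ) 1).indicator (fun ξ => ((1 - |ξ| : ℝ) : ℂ) * g (Complex.I * (l * ξ : ℝ))) ξ)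
  have hT : Tendsto (fun T : ℝ => -(l * T) / (2 * Real.pi)) atTop (cocompact ℝ) := by
    have : Tendsto (fun T : ℝ => -(l * T) / (2 * Real.pi)) atTop atBot := by
      apply Tendsto.atBot_div_const (by positivity)
      exact tendsto_neg_atTop_atBot.comp (tendsto_id.const_mul_atTop hl)
    exact this.mono_right atBot_le_cocompact
  have h2 := key.comp hT
  rw [← tendsto_ofReal_iff' (𝕜 := ℂ)] 
  simp only [RCLike.ofReal_zero]
  refine h2.congr fun T => ?_
  have h3 := conv_eq hf hB hg hgc hl T
  have h4 : ((∫ t in Ioi (0:ℝ), f t * fk (l * (T - t)) : ℝ) : ℂ) =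
    ∫ t in Ioi (0:ℝ), ((f t * fk (l * (T - t)) : ℝ) : ℂ) := by
    exact (integral_ofReal (𝕜 := ℂ)).symm
  refine Eq.trans ?_ h4.symm
  rw [h3, intervalIntegral.integral_of_le (by norm_num), ← integral_indicator measurableSet_Ioc]
  simp only [Function.comp]
  apply integral_congr_ae
  filter_upwards with ξ
  by_cases hξ : ξ ∈ Ioc (-1:ℝ) 1
  · simp only [indicator_of_mem hξ]
    rw [Circle.smul_def, Real.fourierChar_apply, smul_eq_mul]
    have : Complex.exp (2 * Real.pi * ((-(ξ * (-(l * T) / (2 * Real.pi))) : ℝ) : ℂ) * Complex.I) =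
        Complex.exp (Complex.I * ξ * (l * T : ℝ)) := by
      congr 1
      push_cast
      have : (Real.pi : ℂ) ≠ 0 := by exact_mod_cast Real.pi_ne_zero
      field_simp
    push_cast at this ⊢
    rw [this]; ring
  · simp [indicator_of_notMem hξ]

/-- Tauberian theorem. -/
theorem tauber (hf : Measurable f) (hB : ∀ t, |f t| ≤ B)
    (hg : ∀ z : ℂ, 0 < z.re → ∫ t in Ioi (0:ℝ), (f t : ℂ) * Complex.exp (-z * t) = g z)
    (hgc : ContinuousOn g {z | 0 ≤ z.re}) {A : ℝ} (hA : 0 ≤ A)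
    (hslow : ∀ t h, 0 < t → 0 ≤ h → (f t + A) * Real.exp (-h) - A ≤ f (t + h)) :
    Tendsto f atTop (𝓝 0) := by
  set F : ℝ → ℝ := (Ioi (0:ℝ)).indicator f with hF
  have hFm : Measurable F := hf.indicator measurableSet_Ioi
  have hB0 : 0 ≤ B := (abs_nonneg _).trans (hB 0)
  have hFB : ∀ t, |F t| ≤ B := by
    intro t
    by_cases ht : t ∈ Ioi (0:ℝ)
    · rw [hF, indicator_of_mem ht]; exact hB t
    · rw [hF, indicator_of_notMem ht]; simpa using hB0
  have hFt : ∀ t, 0 < t → F t = f t := fun t ht => indicator_of_mem (show t ∈ Ioi (0:ℝ) from ht) f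
  have hconv : ∀ l : ℝ, 0 < l → Tendsto (fun T => ∫ t, F t * fk (l * (T - t))) atTop (𝓝 0) := by
    intro l hl
    refine (conv_tendsto hf hB hg hgc hl).congr fun T => ?_
    rw [← integral_indicator measurableSet_Ioi]
    congr 1
    ext t
    by_cases ht : t ∈ Ioi (0:ℝ)
    · simp [hF, indicator_of_mem ht]
    · simp [hF, indicator_of_notMem ht]
  have hconv' : ∀ l : ℝ, 0 < l → Tendsto (fun T => ∫ t, (-F t) * fk (l * (T - t))) atTop (𝓝 0) := by
    intro l hl
    have := (hconv l hl).neg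
    simpa [integral_neg, neg_mul] using this
  rw [Metric.tendsto_atTop']
  by_contra hcon
  push Not at hcon
  obtain ⟨c, hc, hbad⟩ := hcon
  set h := Real.log (1 + c / (2 * (A + c))) with hh
  have hAc : 0 < A + c := by linarith
  have hq : 0 < c / (2 * (A + c)) := by positivity
  have hhpos : 0 < h := Real.log_pos (by linarith)
  have hexp : Real.exp h = 1 + c / (2 * (A + c)) := Real.exp_log (by linarith)
  have hexp2 : (A + c) * (Real.exp h) = A + c + c / 2 := by
    rw [hexp]; field_simp
  have hup := not_freq hFm hFB hconv (c := c / 2) (h := h / 2) (by linarith) (by linarith)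
  have hlo := not_freq (F := fun t => -F t) hFm.neg (by simpa using hFB) hconv'
    (c := c / 2) (h := h / 2) (by linarith) (by linarith)
  rw [not_frequently] at hup hlo
  obtain ⟨T0, hT0⟩ := eventually_atTop.mp (hup.and hlo)
  obtain ⟨T, hT, hTc⟩ := hbad (max (T0 + h) (h + 1))
  have hT1 : T0 + h < T := lt_of_le_of_lt (le_max_left _ _) hT
  have hT2 : h + 1 < T := lt_of_le_of_lt (le_max_right _ _) hT
  rw [dist_zero_right, Real.norm_eq_abs] at hTc
  rcases le_abs.mp hTc with hpos | hneg
  · refine (hT0 (T + h / 2) (by linarith)).1 ?_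
    intro t ht
    rw [abs_le] at ht
    rw [hFt t (by linarith)]
    have hs := hslow T (t - T) (by linarith) (by linarith)
    rw [add_sub_cancel] at hs
    have h1 : Real.exp (-h) ≤ Real.exp (-(t - T)) := Real.exp_le_exp.mpr (by linarith)
    have h2 : A + c / 2 ≤ (f T + A) * Real.exp (-h) := by
      rw [Real.exp_neg, ← div_eq_mul_inv, le_div_iff₀ (Real.exp_pos _)]
      have : (A + c/2) * Real.exp h = A + c + c/2 - c / 2 * Real.exp h := by linarith
      have h4 : 1 ≤ Real.exp h := Real.one_le_exp hhpos.le
      nlinarith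
    have h3 : (f T + A) * Real.exp (-h) ≤ (f T + A) * Real.exp (-(t - T)) :=
      mul_le_mul_of_nonneg_left h1 (by linarith)
    linarith
  · refine (hT0 (T - h / 2) (by linarith)).2 ?_
    intro t ht
    rw [abs_le] at ht
    rw [hFt t (by linarith)]
    have hs := hslow t (T - t) (by linarith) (by linarith)
    rw [add_sub_cancel] at hs
    have h5 : (f t + A) ≤ (f T + A) * Real.exp (T - t) := by
      rw [Real.exp_neg, ← div_eq_mul_inv, sub_le_iff_le_add, div_le_iff₀ (Real.exp_pos _)] at hs
      exact hs
    have h1 : Real.exp (T - t) ≤ Real.exp h := Real.exp_le_exp.mpr (by linarith)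
    have h4 : 1 ≤ Real.exp (T - t) := Real.one_le_exp (by linarith)
    nlinarith
end
end Tauber
end

section
set_option linter.unusedSectionVars false
namespace PNT
open MeasureTheory Filter Topology Set ArithmeticFunction Chebyshev

section
variable {q : ℕ} [NeZero q] (a : ZMod q)

noncomputable def S (x : ℝ) : ℝ := ∑ k ∈ Finset.Icc 1 ⌊x⌋₊, vonMangoldt.residueClass a k

lemma rc_nonneg (n : ℕ) : 0 ≤ vonMangoldt.residueClass a n := by
  unfold vonMangoldt.residueClass
  exact Set.indicator_nonneg (fun _ _ => vonMangoldt_nonneg) n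

lemma rc_le (n : ℕ) : vonMangoldt.residueClass a n ≤ vonMangoldt n := by
  unfold vonMangoldt.residueClass
  exact Set.indicator_le_self' (fun _ _ => vonMangoldt_nonneg) n

lemma S_nonneg (x : ℝ) : 0 ≤ S a x := Finset.sum_nonneg fun _ _ => rc_nonneg a _

lemma S_le {x : ℝ} (hx : 0 ≤ x) : S a x ≤ (Real.log 4 + 4) * x := by
  refine le_trans ?_ (psi_le_const_mul_self hx)
  unfold psi S
  exact Finset.sum_le_sum fun _ _ => rc_le a _

lemma S_mono : Monotone (S a) := by
  intro x y hxy
  apply Finset.sum_le_sum_of_subset_of_nonneg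
  · exact Finset.Icc_subset_Icc_right (Nat.floor_mono hxy)
  · intro i _ _; exact rc_nonneg a i

noncomputable def ff (t : ℝ) : ℝ := S a (Real.exp t) * Real.exp (-t) - (q.totient : ℝ)⁻¹

noncomputable def gg (z : ℂ) : ℂ :=
  (vonMangoldt.LFunctionResidueClassAux a (1 + z) - (q.totient : ℂ)⁻¹) / (1 + z)

lemma laplace (ha : IsUnit a) (z : ℂ) (hz : 0 < z.re) :
    ∫ t in Ioi (0:ℝ), (ff a t : ℂ) * Complex.exp (-z * t) = gg a z := by
  have h1 := LSeries_eq_mul_integral_of_nonneg (vonMangoldt.residueClass a) (r := 1) (s := 1 + z)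
    zero_le_one (by simpa using hz) (by
      refine Asymptotics.IsBigO.of_bound (Real.log 4 + 4) ?_
      filter_upwards with n
      have := S_le a (x := n) (by positivity)
      have h0 := S_nonneg a n
      simp only [S, Nat.floor_natCast] at this h0
      rw [Real.norm_of_nonneg h0]
      simpa using this) (rc_nonneg a)
  have h2 := vonMangoldt.eqOn_LFunctionResidueClassAux ha (show (1 + z) ∈ {s : ℂ | 1 < s.re} by simpa using hz)
  simp only at h2
  have hz0 : z ≠ 0 := by rintro rfl; simp at hz
  have hz1 : 1 + z ≠ 0 := by
    intro h; have := congrArg Complex.re h; simp at this; linarith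
  have h3 : ∫ t in Ioi (0:ℝ), (S a (Real.exp t) : ℂ) * Complex.exp (-(1 + z) * t) =
      ∫ t in Ioi (1:ℝ), (∑ k ∈ Finset.Icc 1 ⌊t⌋₊, ((vonMangoldt.residueClass a k : ℝ) : ℂ)) * (t:ℂ) ^ (-((1 + z) + 1)) := by
    rw [← Real.exp_zero, ← integral_comp_exp_Ioi]
    apply integral_congr_ae
    filter_upwards with t
    rw [Complex.real_smul, Complex.cpow_def_of_ne_zero (by exact_mod_cast (Real.exp_pos t).ne'),
      ← Complex.ofReal_log (Real.exp_pos t).le, Real.log_exp]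
    have : Complex.exp (t * (-(1 + z + 1))) = Complex.exp (-(1 + z) * t) * Complex.exp (-t) := by
      rw [← Complex.exp_add]; congr 1; ring
    rw [this]
    have h5 : ((Real.exp t : ℝ) : ℂ) * Complex.exp (-t) = 1 := by
      rw [Complex.ofReal_exp, ← Complex.exp_add]; simp
    have h6 : (S a (Real.exp t) : ℂ) =  ∑ k ∈ Finset.Icc 1 ⌊Real.exp t⌋₊, ((vonMangoldt.residueClass a k : ℝ) : ℂ) := by
      simp [S]
    rw [h6]
    linear_combination (-(∑ k ∈ Finset.Icc 1 ⌊Real.exp t⌋₊, ((vonMangoldt.residueClass a k : ℝ) : ℂ)) * Complex.exp (-(1 + z) * t)) * h5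
  have hmS : Measurable (fun t => S a (Real.exp t)) := (S_mono a).measurable.comp Real.measurable_exp
  have hint1 : IntegrableOn (fun t : ℝ => (S a (Real.exp t) : ℂ) * Complex.exp (-(1 + z) * t)) (Ioi 0) := by
    have := (integrableOn_exp_mul_Ioi (a := -z.re) (by linarith) 0).const_mul (Real.log 4 + 4)
    refine Integrable.mono' this ?_ ?_
    · apply Measurable.aestronglyMeasurable
      exact (Complex.measurable_ofReal.comp hmS).mul (by fun_prop)
    · filter_upwards with t
      rw [norm_mul, Complex.norm_real, Complex.norm_exp, Real.norm_of_nonneg (S_nonneg a _)]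
      have h7 : Real.exp ((-(1 + z) * (t:ℂ)).re) = Real.exp (-z.re * t) * Real.exp (-t) := by
        rw [← Real.exp_add]; congr 1; simp; ring
      rw [h7]
      have h8 := S_le a (Real.exp_pos t).le
      have h9 : Real.exp t * Real.exp (-t) = 1 := by rw [← Real.exp_add]; simp
      have := mul_le_mul_of_nonneg_right h8 (show 0 ≤ Real.exp (-z.re * t) * Real.exp (-t) by positivity)
      refine this.trans (le_of_eq ?_)
      linear_combination ((Real.log 4 + 4) * Real.exp (-z.re * t)) * h9
  have hint2 : IntegrableOn (fun t : ℝ => ((q.totient : ℂ)⁻¹) * Complex.exp (-z * t)) (Ioi 0) :=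
    (integrableOn_exp_mul_complex_Ioi (by simpa using hz) 0).const_mul _
  have h4 : ∫ t in Ioi (0:ℝ), (ff a t : ℂ) * Complex.exp (-z * t) =
      (∫ t in Ioi (0:ℝ), (S a (Real.exp t) : ℂ) * Complex.exp (-(1 + z) * t)) -
      ∫ t in Ioi (0:ℝ), ((q.totient : ℂ)⁻¹) * Complex.exp (-z * t) := by
    rw [← integral_sub hint1 hint2]
    apply integral_congr_ae
    filter_upwards with t
    have : Complex.exp (-(1 + z) * t) = Complex.exp (-z * t) * Complex.exp (-t) := by
      rw [← Complex.exp_add]; congr 1; ring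
    rw [this]
    unfold ff
    push_cast
    ring
  rw [h4, h3, integral_const_mul, integral_exp_mul_complex_Ioi (by simpa using hz)]
  unfold gg
  rw [h2, h1]
  set I := ∫ t in Ioi (1:ℝ), (∑ k ∈ Finset.Icc 1 ⌊t⌋₊, ((vonMangoldt.residueClass a k : ℝ) : ℂ)) * (t:ℂ) ^ (-((1 + z) + 1))
  have : (q.totient : ℂ) ≠ 0 := by
    have := Nat.totient_pos.mpr (Nat.pos_of_ne_zero (NeZero.ne q))
    exact_mod_cast this.ne'
  simp only [Complex.ofReal_zero, mul_zero, Complex.exp_zero, add_sub_cancel_left]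
  field_simp
  ring

theorem S_tendsto (ha : IsUnit a) : Tendsto (fun x : ℝ => S a x / x) atTop (𝓝 (q.totient : ℝ)⁻¹) := by
  have hmS : Measurable (fun t => S a (Real.exp t)) := (S_mono a).measurable.comp Real.measurable_exp
  have key := Tauber.tauber (f := ff a) (g := gg a) (B := Real.log 4 + 4 + (q.totient : ℝ)⁻¹)
    (A := (q.totient : ℝ)⁻¹) ?_ ?_ (laplace a ha) ?_ (by positivity) ?_
  · have h2 := key.comp Real.tendsto_log_atTop
    have h3 := h2.add_const ((q.totient : ℝ)⁻¹)
    rw [zero_add] at h3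
    refine h3.congr' ?_
    filter_upwards [eventually_gt_atTop 0] with x hx
    simp only [Function.comp, ff, Real.exp_neg, Real.exp_log hx]
    ring
  · unfold ff
    exact (hmS.mul (by fun_prop)).sub_const _
  · intro t
    unfold ff
    have h1 := S_nonneg a (Real.exp t)
    have h8 := S_le a (Real.exp_pos t).le
    have h9 : Real.exp t * Real.exp (-t) = 1 := by rw [← Real.exp_add]; simp
    have h10 := mul_le_mul_of_nonneg_right h8 (Real.exp_pos (-t)).le
    rw [mul_assoc, h9, mul_one] at h10
    have h11 := mul_nonneg h1 (Real.exp_pos (-t)).le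
    have : (0:ℝ) ≤ (q.totient : ℝ)⁻¹ := by positivity
    have h4 : 0 ≤ Real.log 4 := Real.log_nonneg (by norm_num)
    rw [abs_le]; constructor <;> linarith
  · unfold gg
    apply ContinuousOn.div
    · apply ContinuousOn.sub _ continuousOn_const
      apply (vonMangoldt.continuousOn_LFunctionResidueClassAux a).comp (by fun_prop)
      intro z hz
      simpa using hz
    · fun_prop
    · intro z hz h
      have := congrArg Complex.re h; simp at this hz; linarith
  · intro t h ht hh
    unfold ff
    have := S_mono a (Real.exp_le_exp.mpr (show t ≤ t + h by linarith))
    rw [neg_add, Real.exp_add (-t)]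
    have h2 := mul_le_mul_of_nonneg_right this (show 0 ≤ Real.exp (-t) * Real.exp (-h) by positivity)
    linarith

/-- primes up to N in a class -/
noncomputable def cls (N : ℕ) : Finset ℕ :=
  (Finset.range (N + 1)).filter (fun p => p.Prime ∧ (p : ZMod q) = a)

noncomputable def thc (N : ℕ) : ℝ := ∑ p ∈ cls a N, Real.log p

lemma S_eq_thc_add (N : ℕ) : |S a N - thc a N| ≤ psi N - theta N := by
  have h1 : thc a N = ∑ k ∈ Finset.Ioc 0 N with k.Prime, vonMangoldt.residueClass a k := by
    unfold thc cls
    rw [Finset.sum_filter, Finset.sum_filter, Finset.range_eq_Ico,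
      Finset.sum_eq_sum_Ico_succ_bot (by omega)]
    simp only [Nat.not_prime_zero, false_and, if_false, zero_add]
    have : Finset.Ico 1 (N + 1) = Finset.Ioc 0 N := by ext; simp; omega
    rw [this]
    apply Finset.sum_congr rfl
    intro k hk
    unfold vonMangoldt.residueClass
    by_cases hp : k.Prime
    · by_cases h : (k : ZMod q) = a
      · simp [hp, h, vonMangoldt_apply_prime]
      · simp [h]
    · simp [hp]
  have h2 : S a N - thc a N = ∑ k ∈ Finset.Ioc 0 N with ¬ k.Prime, vonMangoldt.residueClass a k := by
    rw [h1]
    unfold S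
    rw [Nat.floor_natCast, sub_eq_iff_eq_add, add_comm]
    exact (Finset.sum_filter_add_sum_filter_not _ _ _).symm
  rw [h2, psi_sub_theta_eq_sum_not_prime, Nat.floor_natCast,
    abs_of_nonneg (Finset.sum_nonneg fun _ _ => rc_nonneg a _)]
  exact Finset.sum_le_sum fun _ _ => rc_le a _

lemma thc_tendsto (ha : IsUnit a) : Tendsto (fun N : ℕ => thc a N / N) atTop (𝓝 (q.totient : ℝ)⁻¹) := by
  have h1 := (S_tendsto a ha).comp tendsto_natCast_atTop_atTop
  obtain ⟨C, hC⟩ := psi_sub_theta_le_mul_sqrt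
  have h2 : Tendsto (fun N : ℕ => (S a N - thc a N) / N) atTop (𝓝 0) := by
    have h3 : Tendsto (fun N : ℕ => C * (√(N:ℝ))⁻¹) atTop (𝓝 0) := by
      have := ((tendsto_inv_atTop_zero.comp Real.tendsto_sqrt_atTop).comp tendsto_natCast_atTop_atTop).const_mul C
      simpa [Function.comp_def] using this
    refine squeeze_zero_norm' ?_ h3
    filter_upwards [eventually_gt_atTop 0] with N hN
    have hN' : (0:ℝ) < N := by exact_mod_cast hN
    rw [norm_div, Real.norm_natCast, Real.norm_eq_abs, div_le_iff₀ hN']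
    refine (S_eq_thc_add a N).trans ((hC N).trans (le_of_eq ?_))
    rw [mul_assoc]
    congr 1
    rw [eq_comm, inv_mul_eq_iff_eq_mul₀ (Real.sqrt_pos.mpr hN').ne', Real.mul_self_sqrt hN'.le]
  have := h1.sub h2
  rw [sub_zero] at this
  refine this.congr fun N => ?_
  simp only [Function.comp]
  ring

theorem cls_tendsto (ha : IsUnit a) :
    Tendsto (fun N : ℕ => ((cls a N).card : ℝ) * Real.log N / N) atTop (𝓝 (q.totient : ℝ)⁻¹) := by
  have h1 := thc_tendsto a ha
  have hO := integral_theta_div_log_sq_isLittleO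
  have h2 : Tendsto (fun N : ℕ => (((cls a N).card : ℝ) - thc a N / Real.log N) * Real.log N / N) atTop (𝓝 0) := by
    have h3 : Tendsto (fun x : ℝ => (∫ t in (2:ℝ)..x, theta t / (t * Real.log t ^ 2)) / (x / Real.log x)) atTop (𝓝 0) :=
      hO.tendsto_div_nhds_zero
    have h3 := h3.comp (tendsto_natCast_atTop_atTop (R := ℝ))
    refine squeeze_zero_norm' ?_ h3
    filter_upwards [eventually_ge_atTop 2] with N hN
    have hN' : (2:ℝ) ≤ N := by exact_mod_cast hN
    have hlog : 0 < Real.log N := Real.log_pos (by linarith)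
    have h4 := primeCounting_eq_theta_div_log_add_integral hN'
    simp only [Function.comp]
    rw [Nat.floor_natCast] at h4
    set I := ∫ t in (2:ℝ)..N, theta t / (t * Real.log t ^ 2)
    have hterm : ∀ p ∈ (Finset.range (N + 1)).filter Nat.Prime, 0 ≤ 1 - Real.log p / Real.log N := by
      intro p hp
      simp only [Finset.mem_filter, Finset.mem_range] at hp
      rw [sub_nonneg, div_le_one hlog]
      apply Real.log_le_log
      · exact_mod_cast hp.2.pos
      · exact_mod_cast (show p ≤ N by omega)
    have hsub : cls a N ⊆ (Finset.range (N + 1)).filter Nat.Prime := by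
      intro p hp
      simp only [cls, Finset.mem_filter] at hp ⊢
      exact ⟨hp.1, hp.2.1⟩
    have e1 : ((cls a N).card : ℝ) - thc a N / Real.log N = ∑ p ∈ cls a N, (1 - Real.log p / Real.log N) := by
      rw [Finset.sum_sub_distrib, ← Finset.sum_div]; simp [thc]
    have e2 : I = ∑ p ∈ (Finset.range (N + 1)).filter Nat.Prime, (1 - Real.log p / Real.log N) := by
      rw [Finset.sum_sub_distrib, ← Finset.sum_div]
      have e3 : theta N = ∑ p ∈ (Finset.range (N + 1)).filter Nat.Prime, Real.log p := by
        rw [theta_eq_sum_Icc, Nat.floor_natCast]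
        congr 2
        ext; simp
      have e4 : (N.primeCounting : ℝ) = ((Finset.range (N + 1)).filter Nat.Prime).card := by
        rw [Nat.primeCounting, Nat.primeCounting', Nat.count_eq_card_filter_range]
      rw [← e3]
      simp only [Finset.sum_const, nsmul_eq_mul, mul_one]
      rw [← e4, h4]; ring
    have n1 : 0 ≤ ((cls a N).card : ℝ) - thc a N / Real.log N := by
      rw [e1]; exact Finset.sum_nonneg fun p hp => hterm p (hsub hp)
    have n2 : ((cls a N).card : ℝ) - thc a N / Real.log N ≤ I := by
      rw [e1, e2]
      exact Finset.sum_le_sum_of_subset_of_nonneg hsub fun p hp _ => hterm p hp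
    rw [Real.norm_of_nonneg (by positivity)]
    rw [div_div_eq_mul_div]
    gcongr
  have := h1.add h2
  rw [add_zero] at this
  refine this.congr' ?_
  filter_upwards [eventually_ge_atTop 2] with N hN
  have hN' : (2:ℝ) ≤ N := by exact_mod_cast hN
  have hlog : 0 < Real.log N := Real.log_pos (by linarith)
  field_simp
  ring

noncomputable def primesTo (N : ℕ) : Finset ℕ := (Finset.range (N + 1)).filter Nat.Prime

theorem pi_tendsto :
    Tendsto (fun N : ℕ => ((primesTo N).card : ℝ) * Real.log N / N) atTop (𝓝 1) := by
  have := cls_tendsto (q := 1) 0 (by rw [Subsingleton.elim (0 : ZMod 1) 1]; exact isUnit_one)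
  simp only [Nat.totient_one, Nat.cast_one, inv_one] at this
  refine this.congr fun N => ?_
  have : cls (q := 1) 0 N = primesTo N := by
    ext p; simp [cls, primesTo, Subsingleton.elim (p : ZMod 1) 0]
  rw [this]

theorem cls_ratio (ha : IsUnit a) :
    Tendsto (fun N : ℕ => ((cls a N).card : ℝ) / (primesTo N).card) atTop (𝓝 (q.totient : ℝ)⁻¹) := by
  have := (cls_tendsto a ha).div pi_tendsto one_ne_zero
  rw [div_one] at this
  refine this.congr' ?_
  filter_upwards [eventually_ge_atTop 2] with N hN
  have hN' : (2:ℝ) ≤ N := by exact_mod_cast hN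
  have hlog : 0 < Real.log N := Real.log_pos (by linarith)
  simp only [Pi.div_apply]
  have hN0 : (N:ℝ) ≠ 0 := by positivity
  rw [div_div_div_cancel_right₀ hN0, mul_div_mul_right _ _ hlog.ne']

end
end PNT
end

section
namespace PV
open Finset

lemma zmod_sum_range {M : Type*} [AddCommMonoid M] {q : ℕ} [NeZero q] (h : ZMod q → M) :
    ∑ a : ZMod q, h a = ∑ k ∈ range q, h (k : ZMod q) := by
  refine Finset.sum_nbij' (fun a => a.val) (fun k => (k : ZMod q)) ?_ ?_ ?_ ?_ ?_
  · intro a _; simpa using ZMod.val_lt a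
  · intro k _; simp
  · intro a _; simp
  · intro k hk; simp at hk; simp [ZMod.val_natCast, Nat.mod_eq_of_lt hk]
  · intro a _; simp

section
variable {q : ℕ} [NeZero q]

noncomputable def fhat (f : ZMod q → ℂ) (a : ZMod q) : ℂ := ∑ x, f x * ZMod.stdAddChar (x * a)

lemma inversion (f : ZMod q → ℂ) (y : ZMod q) :
    (q : ℂ) * f y = ∑ a, fhat f a * ZMod.stdAddChar (-(y * a)) := by
  unfold fhat
  simp_rw [Finset.sum_mul]
  rw [Finset.sum_comm]
  have : ∀ x : ZMod q, ∑ a : ZMod q, f x * ZMod.stdAddChar (x * a) * ZMod.stdAddChar (-(y * a)) =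
      if x = y then (q:ℂ) * f y else 0 := by
    intro x
    have h1 := AddChar.sum_mulShift (x - y) (ZMod.isPrimitive_stdAddChar q)
    have h2 : ∀ a : ZMod q, f x * ZMod.stdAddChar (x * a) * ZMod.stdAddChar (-(y * a)) =
        f x * ZMod.stdAddChar (a * (x - y)) := by
      intro a
      rw [mul_assoc, ← AddChar.map_add_eq_mul]
      congr 2; ring
    simp_rw [h2, ← Finset.mul_sum, h1, sub_eq_zero, ZMod.card]
    split_ifs with h
    · rw [h]; ring
    · simp
  simp_rw [this]
  simp

lemma norm_stdAddChar (a : ZMod q) : ‖(ZMod.stdAddChar a : ℂ)‖ = 1 := by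
  rw [ZMod.stdAddChar_apply]; exact Circle.norm_coe _

lemma norm_stdAddChar_sub_one (k : ℕ) (hk : 0 < k) (hkq : k < q) :
    4 * (min k (q - k) : ℝ) / q ≤ ‖(ZMod.stdAddChar (-(k : ZMod q)) : ℂ) - 1‖ := by
  have hq : (0:ℝ) < q := by exact_mod_cast (by omega : 0 < q)
  have hq' : (q:ℂ) ≠ 0 := by exact_mod_cast hq.ne'
  have h1 : (ZMod.stdAddChar (-(k : ZMod q)) : ℂ) = Complex.exp (Complex.I * ((-(2 * Real.pi * k / q) : ℝ) : ℂ)) := by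
    have := ZMod.stdAddChar_coe (N := q) (-(k:ℤ))
    push_cast at this
    rw [this]
    congr 1
    push_cast
    ring
  rw [h1, Complex.norm_exp_I_mul_ofReal_sub_one]
  have h2 : -(2 * Real.pi * k / q) / 2 = -(Real.pi * k / q) := by ring
  rw [h2, Real.sin_neg, norm_mul, norm_neg, Real.norm_ofNat, Real.norm_eq_abs]
  have hkk : (0:ℝ) < k := by exact_mod_cast hk
  have hkq' : (k:ℝ) < q := by exact_mod_cast hkq
  have key : 2 * (min k (q - k) : ℝ) / q ≤ Real.sin (Real.pi * k / q) := by
    rcases le_total (2 * (k:ℝ)) q with h | h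
    · have := Real.mul_le_sin (x := Real.pi * k / q) (by positivity) (by
        rw [div_le_div_iff₀ hq two_pos]; nlinarith [Real.pi_pos])
      refine le_trans ?_ this
      have e : 2 / Real.pi * (Real.pi * k / q) = 2 * k / q := by field_simp
      rw [e]
      gcongr; exact min_le_left _ _
    · have := Real.mul_le_sin (x := Real.pi * (q - k) / q) (by
        apply div_nonneg _ hq.le
        apply mul_nonneg Real.pi_pos.le; linarith) (by
        rw [div_le_div_iff₀ hq two_pos]; nlinarith [Real.pi_pos])
      have e2 : Real.sin (Real.pi * (q - k) / q) = Real.sin (Real.pi * k / q) := by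
        rw [← Real.sin_pi_sub]; congr 1; field_simp; ring
      rw [e2] at this
      refine le_trans ?_ this
      have e : 2 / Real.pi * (Real.pi * (q - k) / q) = 2 * (q - k) / q := by field_simp
      rw [e]
      gcongr; exact min_le_right _ _
  have := le_abs_self (Real.sin (Real.pi * k / q))
  calc 4 * (min k (q - k) : ℝ) / q = 2 * (2 * (min k (q - k) : ℝ) / q) := by ring
    _ ≤ 2 * |Real.sin (Real.pi * k / q)| := by linarith

lemma geom_bound (k : ℕ) (hk : 0 < k) (hkq : k < q) (z : ZMod q) (X : ℕ) :
    ‖∑ j ∈ range X, (ZMod.stdAddChar (-(((j:ZMod q) + z) * (k : ZMod q))) : ℂ)‖ ≤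
      q / 2 * (1 / (k:ℝ) + 1 / ((q - k : ℕ) : ℝ)) := by
  have hq : (0:ℝ) < q := by exact_mod_cast (by omega : 0 < q)
  have hkk : (0:ℝ) < k := by exact_mod_cast hk
  have hkq' : (k:ℝ) < q := by exact_mod_cast hkq
  have hm : 0 < (min k (q - k) : ℝ) := lt_min hkk (by linarith)
  have hlow := norm_stdAddChar_sub_one k hk hkq
  have hpos : 0 < 4 * (min k (q - k) : ℝ) / q := by positivity
  have hne : (ZMod.stdAddChar (-(k : ZMod q)) : ℂ) ≠ 1 := by
    intro h; rw [h] at hlow; simp at hlow; linarith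
  have e : ∀ j ∈ range X, (ZMod.stdAddChar (-(((j:ZMod q) + z) * (k : ZMod q))) : ℂ) =
      ZMod.stdAddChar (-(z * (k : ZMod q))) * (ZMod.stdAddChar (-(k : ZMod q)) : ℂ) ^ j := by
    intro j _
    rw [← AddChar.map_nsmul_eq_pow, ← AddChar.map_add_eq_mul]
    congr 1; rw [nsmul_eq_mul]; ring
  rw [Finset.sum_congr rfl e, ← Finset.mul_sum, norm_mul, norm_stdAddChar, one_mul, geom_sum_eq hne,
    norm_div]
  have hnum : ‖(ZMod.stdAddChar (-(k : ZMod q)) : ℂ) ^ X - 1‖ ≤ 2 := by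
    refine (norm_sub_le _ _).trans ?_
    rw [norm_pow, norm_stdAddChar]; norm_num
  calc _ ≤ 2 / (4 * (min k (q - k) : ℝ) / q) := by
        apply div_le_div₀ (by norm_num) hnum hpos hlow
    _ = q / 2 * (1 / (min k (q - k) : ℝ)) := by field_simp; norm_num
    _ ≤ _ := by
        gcongr
        rw [Nat.cast_sub hkq.le]
        have h1 : 0 < 1 / (k:ℝ) := by positivity
        have h2 : 0 < 1 / ((q:ℝ) - k) := by
          apply one_div_pos.mpr; linarith
        rcases min_cases (k:ℝ) (q - k) with ⟨h, -⟩ | ⟨h, -⟩ <;> rw [h] <;> linarith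

theorem polya (f : ZMod q → ℂ) (hf : ∀ a, ‖fhat f a‖ ≤ √q) (h0 : fhat f 0 = 0) (z : ZMod q) (X : ℕ) :
    ‖∑ j ∈ range X, f (j + z)‖ ≤ √q * (1 + Real.log q) := by
  have hq0 : 0 < q := Nat.pos_of_ne_zero (NeZero.ne q)
  have hq : (0:ℝ) < q := by exact_mod_cast hq0
  have h1 : (q:ℂ) * ∑ j ∈ range X, f (j + z) =
      ∑ k ∈ range q, fhat f k * ∑ j ∈ range X, (ZMod.stdAddChar (-(((j:ZMod q) + z) * (k : ZMod q))) : ℂ) := by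
    rw [Finset.mul_sum]
    simp_rw [inversion, Finset.mul_sum, zmod_sum_range]
    rw [Finset.sum_comm]
  have h2 : (q:ℝ) * ‖∑ j ∈ range X, f (j + z)‖ ≤ q * (√q * (1 + Real.log q)) := by
    have := congrArg norm h1
    rw [norm_mul, Complex.norm_natCast] at this
    rw [this]
    have hr : range q = insert 0 (Ico 1 q) := by ext; simp; omega
    rw [hr, Finset.sum_insert (by simp), Nat.cast_zero, h0, zero_mul, zero_add]
    have hH : ∑ k ∈ Ico 1 q, 1 / (k:ℝ) ≤ 1 + Real.log q := by
      have := harmonic_le_one_add_log q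
      refine le_trans ?_ this
      rw [harmonic_eq_sum_Icc]
      push_cast
      simp_rw [one_div]
      apply Finset.sum_le_sum_of_subset_of_nonneg
      · intro k; simp; omega
      · intros; positivity
    have hH2 : ∑ k ∈ Ico 1 q, 1 / ((q - k : ℕ):ℝ) = ∑ k ∈ Ico 1 q, 1 / (k:ℝ) := by
      refine Finset.sum_nbij' (fun k => q - k) (fun k => q - k) ?_ ?_ ?_ ?_ ?_ <;> intro k hk <;> simp at hk ⊢ <;> omega
    calc _ ≤ ∑ k ∈ Ico 1 q, √q * (q / 2 * (1 / (k:ℝ) + 1 / ((q - k : ℕ) : ℝ))) := by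
          refine (norm_sum_le _ _).trans (Finset.sum_le_sum fun k hk => ?_)
          simp at hk
          rw [norm_mul]
          exact mul_le_mul (hf _) (geom_bound k (by omega) (by omega) z X) (norm_nonneg _) (Real.sqrt_nonneg _)
      _ = √q * (q / 2 * (2 * ∑ k ∈ Ico 1 q, 1 / (k:ℝ))) := by
          rw [← Finset.mul_sum, ← Finset.mul_sum, Finset.sum_add_distrib, hH2, two_mul]
      _ ≤ √q * (q / 2 * (2 * (1 + Real.log q))) := by gcongr
      _ = _ := by ring
  exact le_of_mul_le_mul_left h2 hq

end
end PV
end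

section
namespace PV
open Finset

lemma exists_nonres (p : ℕ) (hp : p.Prime) (hp2 : p ≠ 2) (M : ℕ) (hM : Nat.Coprime p M) :
    ∃ u : ℕ, (u : ZMod M) = 1 ∧ jacobiSym u p = -1 := by
  have : Fact p.Prime := ⟨hp⟩
  obtain ⟨a, ha⟩ := quadraticChar_exists_neg_one (F := ZMod p) (by rwa [ZMod.ringChar_zmod_n])
  obtain ⟨k, hk1, hk2⟩ := Nat.chineseRemainder hM a.val 1
  refine ⟨k, ?_, ?_⟩
  · have := (ZMod.natCast_eq_natCast_iff _ _ _).mpr hk2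
    simpa using this
  · rw [← jacobiSym.legendreSym.to_jacobiSym]
    have h1 := (ZMod.natCast_eq_natCast_iff _ _ _).mpr hk1
    simp only [ZMod.natCast_val, ZMod.cast_id', id_eq] at h1
    rw [legendreSym]
    push_cast
    rw [h1, ha]

section
variable {s : ℕ} [NeZero s]

noncomputable def jf (s : ℕ) [NeZero s] (x : ZMod s) : ℂ := ((jacobiSym x.val s : ℤ) : ℂ)

lemma jf_int (m : ℤ) : jf s (m : ZMod s) = ((jacobiSym m s : ℤ) : ℂ) := by
  unfold jf
  rw [ZMod.val_intCast, ← jacobiSym.mod_left]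

lemma jf_nat (m : ℕ) : jf s (m : ZMod s) = ((jacobiSym m s : ℤ) : ℂ) := by
  have := jf_int (s := s) m
  simpa using this

lemma jf_mul (x y : ZMod s) : jf s (x * y) = jf s x * jf s y := by
  have hx : x = ((x.val : ℕ) : ZMod s) := by simp
  have hy : y = ((y.val : ℕ) : ZMod s) := by simp
  have h : jf s (((x.val * y.val : ℕ)) : ZMod s) = jf s ((x.val : ℕ) : ZMod s) * jf s ((y.val : ℕ) : ZMod s) := by
    rw [jf_nat, jf_nat, jf_nat]
    push_cast
    rw [jacobiSym.mul_left]
    push_cast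
    rfl
  rw [Nat.cast_mul, ← hx, ← hy] at h
  exact h

lemma jacobi_abs_le (a : ℤ) (b : ℕ) : |((jacobiSym a b : ℤ) : ℝ)| ≤ 1 := by
  rcases jacobiSym.trichotomy a b with h | h | h <;> rw [h] <;> simp

lemma jf_norm_le (x : ZMod s) : ‖jf s x‖ ≤ 1 := by
  unfold jf
  rcases jacobiSym.trichotomy x.val s with h | h | h <;> rw [h] <;> simp

lemma jf_nonunit (x : ZMod s) (hx : ¬ IsUnit x) : jf s x = 0 := by
  have hx' : x = ((x.val : ℕ) : ZMod s) := by simp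
  rw [hx', ZMod.isUnit_iff_coprime] at hx
  unfold jf
  rw [jacobiSym.eq_zero_iff_not_coprime.mpr]
  · simp
  · rw [Int.gcd_natCast_natCast]; exact hx

lemma parseval (f : ZMod s → ℂ) : ∑ a, ‖fhat f a‖ ^ 2 = s * ∑ x, ‖f x‖ ^ 2 := by
  have h : ((∑ a, ‖fhat f a‖ ^ 2 : ℝ) : ℂ) = ((s * ∑ x, ‖f x‖ ^ 2 : ℝ) : ℂ) := by
    push_cast
    simp_rw [← Complex.mul_conj']
    have e : ∀ a, (starRingEnd ℂ) (fhat f a) = ∑ y, (starRingEnd ℂ) (f y) * ZMod.stdAddChar (-(y * a)) := by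
      intro a
      unfold fhat
      rw [map_sum]
      refine Finset.sum_congr rfl fun y _ => ?_
      rw [map_mul, AddChar.map_neg_eq_conj]
    simp_rw [e, Finset.mul_sum]
    rw [Finset.sum_comm]
    refine Finset.sum_congr rfl fun y _ => ?_
    calc _ = (starRingEnd ℂ) (f y) * ∑ a, fhat f a * ZMod.stdAddChar (-(y * a)) := by
          rw [Finset.mul_sum]; exact Finset.sum_congr rfl fun a _ => by ring
      _ = _ := by rw [← inversion]; ring
  exact_mod_cast h

lemma fhat_unit (u : ZMod s) (hu : IsUnit u) (a : ZMod s) : jf s u * fhat (jf s) (u * a) = fhat (jf s) a := by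
  unfold fhat
  rw [Finset.mul_sum]
  obtain ⟨v, rfl⟩ := hu
  refine Fintype.sum_equiv (Units.mulLeft v) _ _ fun x => ?_
  rw [Units.mulLeft_apply, jf_mul]
  rw [← mul_assoc]
  congr 2; ring

lemma fhat_nonunit (hs : Squarefree s) (hodd : Odd s) (a : ZMod s) (ha : ¬ IsUnit a) :
    fhat (jf s) a = 0 := by
  have ha' : a = ((a.val : ℕ) : ZMod s) := by simp
  have ha2 := ha
  rw [ha', ZMod.isUnit_iff_coprime] at ha2
  obtain ⟨p, hp, hpa, hps⟩ := Nat.Prime.not_coprime_iff_dvd.mp ha2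
  obtain ⟨M, hM⟩ := hps
  have hcop : Nat.Coprime p M := by
    rw [hM, Nat.squarefree_mul_iff] at hs
    exact hs.1
  have hp2 : p ≠ 2 := by
    rintro rfl
    rw [hM] at hodd
    exact (Nat.not_odd_iff_even.mpr (even_two_mul M)) hodd
  obtain ⟨u, hu1, hu2⟩ := exists_nonres p hp hp2 M hcop
  have hM0 : M ≠ 0 := by rintro rfl; exact (NeZero.ne s) (by simpa using hM)
  have hju : jacobiSym u s = -1 := by
    rw [hM, jacobiSym.mul_right' _ hp.ne_zero hM0, hu2]
    have : jacobiSym u M = jacobiSym 1 M := by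
      apply jacobiSym.mod_left'
      have : ((u:ℤ) : ZMod M) = ((1:ℤ) : ZMod M) := by simpa using hu1
      exact (ZMod.intCast_eq_intCast_iff _ _ _).mp this
    rw [this, jacobiSym.one_left]; rfl
  have hunit : IsUnit (u : ZMod s) := by
    by_contra h
    have := jf_nonunit _ h
    rw [jf_nat, hju] at this
    simp at this
  have hua : (u : ZMod s) * a = a := by
    have h0 : ((u:ℤ) - 1 : ℤ) * (a.val : ℤ) = (((u:ℤ) - 1) * a.val : ℤ) := rfl
    have hd : (s : ℤ) ∣ ((u:ℤ) - 1) * a.val := by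
      have h1 : (M : ℤ) ∣ (u:ℤ) - 1 := by
        rw [← ZMod.intCast_zmod_eq_zero_iff_dvd]; push_cast; rw [hu1]; ring
      have h2 : (p : ℤ) ∣ (a.val : ℤ) := by exact_mod_cast hpa
      have := mul_dvd_mul h1 h2
      have hs' : (s:ℤ) = M * p := by rw [hM]; push_cast; ring
      rw [hs']; exact this
    rw [← ZMod.intCast_zmod_eq_zero_iff_dvd] at hd
    push_cast at hd
    rw [ZMod.natCast_val, ZMod.cast_id', id] at hd
    linear_combination hd
  have := fhat_unit (u : ZMod s) hunit a
  rw [hua, jf_nat, hju] at this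
  push_cast at this
  have h3 : (2:ℂ) * fhat (jf s) a = 0 := by linear_combination -this
  simpa using h3

lemma fhat_le (hs : Squarefree s) (hodd : Odd s) (a : ZMod s) : ‖fhat (jf s) a‖ ≤ √s := by
  by_cases ha : IsUnit a
  · have hle : ∀ u : ZMod s, IsUnit u → ‖fhat (jf s) a‖ ≤ ‖fhat (jf s) u‖ := by
      intro u hu
      obtain ⟨v, rfl⟩ := ha
      have := fhat_unit (u * ((v⁻¹ : (ZMod s)ˣ) : ZMod s)) (hu.mul (Units.isUnit _)) v
      rw [mul_assoc, Units.inv_mul, mul_one] at this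
      rw [← this, norm_mul]
      exact mul_le_of_le_one_left (norm_nonneg _) (jf_norm_le _)
    classical
    set U : Finset (ZMod s) := univ.filter IsUnit with hU
    have h1 : (U.card : ℝ) * ‖fhat (jf s) a‖ ^ 2 ≤ U.card * s := by
      calc (U.card : ℝ) * ‖fhat (jf s) a‖ ^ 2 = ∑ u ∈ U, ‖fhat (jf s) a‖ ^ 2 := by simp
        _ ≤ ∑ u ∈ U, ‖fhat (jf s) u‖ ^ 2 := by
            refine Finset.sum_le_sum fun u hu => ?_
            have := hle u (by simpa [hU] using hu)
            gcongr
        _ ≤ ∑ u, ‖fhat (jf s) u‖ ^ 2 :=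
            Finset.sum_le_sum_of_subset_of_nonneg (Finset.filter_subset _ _) fun _ _ _ => by positivity
        _ = s * ∑ x, ‖jf s x‖ ^ 2 := parseval _
        _ = s * ∑ x ∈ U, ‖jf s x‖ ^ 2 := by
            congr 1
            rw [hU, Finset.sum_filter]
            refine Finset.sum_congr rfl fun x _ => ?_
            split_ifs with h
            · rfl
            · rw [jf_nonunit x h]; simp
        _ ≤ s * ∑ x ∈ U, 1 := by
            gcongr with x hx
            exact pow_le_one₀ (norm_nonneg _) (jf_norm_le x)
        _ = U.card * s := by simp [mul_comm]
    have hc : 0 < (U.card : ℝ) := by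
      have : 0 < U.card := Finset.card_pos.mpr ⟨1, by simp [hU]⟩
      exact_mod_cast this
    exact Real.le_sqrt_of_sq_le (le_of_mul_le_mul_left h1 hc)
  · rw [fhat_nonunit hs hodd a ha]; simp

theorem polya_jacobi (hs : Squarefree s) (hodd : Odd s) (h1 : 1 < s) (z : ZMod s) (X : ℕ) :
    ‖∑ j ∈ range X, jf s (j + z)‖ ≤ √s * (1 + Real.log s) := by
  refine polya _ (fhat_le hs hodd) (fhat_nonunit hs hodd 0 ?_) z X
  have : Fact (1 < s) := ⟨h1⟩
  exact not_isUnit_zero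

theorem polya_jacobi_sum (hs : Squarefree s) (hodd : Odd s) (h1 : 1 < s) (X : ℕ) :
    |∑ j ∈ range X, (jacobiSym j s : ℝ)| ≤ √s * (1 + Real.log s) := by
  have := polya_jacobi hs hodd h1 0 X
  simp_rw [add_zero, jf_nat] at this
  have e : ∑ j ∈ range X, ((jacobiSym j s : ℤ) : ℂ) = ((∑ j ∈ range X, (jacobiSym j s : ℝ) : ℝ) : ℂ) := by
    push_cast; rfl
  rw [e, Complex.norm_real] at this
  exact this
end

/-- Polya-Vinogradov for the Jacobi symbol with odd nonsquare denominator -/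
theorem polya_nonsq (b : ℕ) (hodd : Odd b) (hb : ¬ IsSquare b) (X : ℕ) :
    |∑ j ∈ range X, (jacobiSym j b : ℝ)| ≤ √b * (1 + Real.log b) := by
  have hb0 : b ≠ 0 := by rintro rfl; exact hb ⟨0, rfl⟩
  obtain ⟨s, t, hst, hsq⟩ := Nat.sq_mul_squarefree b
  -- b = t^2 * s
  have hs0 : s ≠ 0 := by rintro rfl; simp at hst; exact hb0 hst.symm
  have ht0 : t ≠ 0 := by rintro rfl; simp at hst; exact hb0 hst.symm
  have hs1 : 1 < s := by
    rcases Nat.lt_or_ge 1 s with h | h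
    · exact h
    · exfalso; apply hb
      have : s = 1 := by omega
      refine ⟨t, ?_⟩
      rw [← hst, this]; ring
  have : NeZero s := ⟨hs0⟩
  have : NeZero t := ⟨ht0⟩
  have hsodd : Odd s := (Nat.odd_mul.mp (hst ▸ hodd)).2
  have hJ : ∀ j : ℕ, (jacobiSym j b : ℝ) = ∑ d ∈ t.divisors, if d ∣ j then (ArithmeticFunction.moebius d : ℝ) * jacobiSym j s else 0 := by
    intro j
    rw [← hst, jacobiSym.mul_right' _ (by positivity) hs0, jacobiSym.pow_right]
    have h1 : ∑ d ∈ t.divisors, (if d ∣ j then (ArithmeticFunction.moebius d : ℝ) * jacobiSym j s else 0) =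
       (∑ d ∈ (Nat.gcd t j).divisors, (ArithmeticFunction.moebius d : ℝ)) * jacobiSym j s := by
      rw [Finset.sum_mul, ← Finset.sum_filter]
      apply Finset.sum_congr _ fun _ _ => rfl
      ext d
      simp [Nat.dvd_gcd_iff, ht0]
    rw [h1]
    have h2 : (∑ d ∈ (Nat.gcd t j).divisors, (ArithmeticFunction.moebius d : ℝ)) = if Nat.gcd t j = 1 then 1 else 0 := by
      have h3 := congrArg (fun F : ArithmeticFunction ℤ => F (Nat.gcd t j)) ArithmeticFunction.coe_zeta_mul_moebius
      simp only [ArithmeticFunction.coe_zeta_mul_apply, ArithmeticFunction.one_apply] at h3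
      exact_mod_cast h3
    rw [h2]
    split_ifs with h
    · rw [jacobiSym.sq_one (by rw [Int.gcd_natCast_natCast, Nat.gcd_comm]; exact h)]; push_cast; ring
    · rw [jacobiSym.eq_zero_iff_not_coprime.mpr (by rw [Int.gcd_natCast_natCast, Nat.gcd_comm]; exact h)]; simp
  simp_rw [hJ]
  rw [Finset.sum_comm]
  have hlog : 0 ≤ Real.log s := Real.log_natCast_nonneg s
  have hterm : ∀ d ∈ t.divisors, |∑ j ∈ range X, if d ∣ j then (ArithmeticFunction.moebius d : ℝ) * jacobiSym j s else 0|
      ≤ √s * (1 + Real.log s) := by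
    intro d hd
    have hd0 : 0 < d := Nat.pos_of_mem_divisors hd
    have e : ∑ j ∈ range X, (if d ∣ j then (ArithmeticFunction.moebius d : ℝ) * jacobiSym j s else 0) =
        (ArithmeticFunction.moebius d : ℝ) * jacobiSym d s * ∑ i ∈ range ((X + d - 1) / d), (jacobiSym i s : ℝ) := by
      rw [← Finset.sum_filter, Finset.mul_sum]
      symm
      refine Finset.sum_bij (fun i _ => d * i) ?_ ?_ ?_ ?_
      · intro i hi
        simp only [mem_range, mem_filter, dvd_mul_right, and_true] at hi ⊢
        have := (Nat.lt_div_iff_mul_lt hd0).mp hi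
        rw [mul_comm] at this
        omega
      · intro i _ j _ h
        exact Nat.eq_of_mul_eq_mul_left hd0 h
      · intro j hj
        simp only [mem_range, mem_filter] at hj
        obtain ⟨hj1, i, rfl⟩ := hj
        refine ⟨i, ?_, rfl⟩
        rw [mem_range, Nat.lt_div_iff_mul_lt hd0, mul_comm]
        omega
      · intro i _
        push_cast
        rw [jacobiSym.mul_left]
        push_cast; ring
    rw [e, abs_mul, abs_mul]
    have h1 : |(ArithmeticFunction.moebius d : ℝ)| ≤ 1 := by exact_mod_cast ArithmeticFunction.abs_moebius_le_one
    have h2 := jacobi_abs_le d s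
    have h3 := polya_jacobi_sum hsq hsodd hs1 ((X + d - 1) / d)
    have h4 : |(ArithmeticFunction.moebius d : ℝ)| * |(jacobiSym d s : ℝ)| ≤ 1 := mul_le_one₀ h1 (abs_nonneg _) h2
    calc _ ≤ 1 * (√s * (1 + Real.log s)) := mul_le_mul h4 h3 (abs_nonneg _) zero_le_one
      _ = _ := one_mul _
  calc _ ≤ ∑ d ∈ t.divisors, √s * (1 + Real.log s) :=
        (Finset.abs_sum_le_sum_abs _ _).trans (Finset.sum_le_sum hterm)
    _ = (t.divisors.card : ℝ) * (√s * (1 + Real.log s)) := by simp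
    _ ≤ t * (√s * (1 + Real.log b)) := by
        have hsb : (s:ℝ) ≤ b := by
          rw [← hst]; exact_mod_cast Nat.le_mul_of_pos_left s (by positivity)
        have : (0:ℝ) < s := by positivity
        gcongr
        exact Nat.card_divisors_le_self t
    _ = √b * (1 + Real.log b) := by
        have : (b:ℝ) = (t:ℝ)^2 * s := by rw [← hst]; push_cast; ring
        rw [this, Real.sqrt_mul (by positivity), Real.sqrt_sq (by positivity)]
        ring

end PV
end

section
namespace Sel
open Finset ArithmeticFunction

/-- sieve weights -/
noncomputable def gs (k : ℕ) : ℝ := if Squarefree k then 1 / (k.totient : ℝ) else 0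
noncomputable def V (R : ℕ) : ℝ := ∑ k ∈ Icc 1 R, gs k
noncomputable def lam (R d : ℕ) : ℝ :=
  (moebius d : ℝ) * d * (∑ k ∈ Icc 1 R, if d ∣ k then gs k else 0) / V R

lemma gs_nonneg (k : ℕ) : 0 ≤ gs k := by unfold gs; split_ifs <;> positivity

lemma V_ge (R : ℕ) : Real.log R / 2 ≤ V R := by
  have h1 : Real.log R ≤ ∑ n ∈ Icc 1 R, 1 / (n:ℝ) := by
    have := log_add_one_le_harmonic R
    rw [harmonic_eq_sum_Icc] at this
    push_cast at this
    simp_rw [one_div]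
    rcases Nat.eq_zero_or_pos R with rfl | h
    · simp
    · refine le_trans (Real.log_le_log (by exact_mod_cast h) (by linarith)) this
  have h2 : ∑ n ∈ Icc 1 R, 1 / (n:ℝ) ≤ ∑ s ∈ Icc 1 R, ∑ a ∈ Icc 1 R, gs s * (1 / (a:ℝ)^2) := by
    rw [← Finset.sum_product']
    choose! f g hfg hsq using Nat.sq_mul_squarefree
    have hinj : ∀ n ∈ Icc 1 R, ((f n, g n) ∈ Icc 1 R ×ˢ Icc 1 R) := by
      intro n hn
      simp only [mem_Icc, mem_product] at hn ⊢
      have h := hfg n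
      have hg0 : 0 < g n := by
        rcases Nat.eq_zero_or_pos (g n) with h0 | h0
        · rw [h0] at h; simp at h; omega
        · exact h0
      have hf0 : 0 < f n := by
        rcases Nat.eq_zero_or_pos (f n) with h0 | h0
        · rw [h0] at h; simp at h; omega
        · exact h0
      have h1 : f n ≤ n := by nlinarith [Nat.pow_pos (n := 2) hg0]
      have h2 : g n ≤ n := by nlinarith
      omega
    have hi : Set.InjOn (fun n => (f n, g n)) (Icc 1 R : Finset ℕ) := by
      intro a _ b _ hab
      simp only [Prod.mk.injEq] at hab
      rw [← hfg a, ← hfg b, hab.1, hab.2]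
    calc ∑ n ∈ Icc 1 R, 1 / (n:ℝ) ≤ ∑ n ∈ Icc 1 R, gs (f n) * (1 / (g n:ℝ)^2) := by
          refine Finset.sum_le_sum fun n hn => ?_
          have hm := hinj n hn
          simp only [mem_Icc, mem_product] at hm
          have e : (n:ℝ) = (g n:ℝ)^2 * f n := by exact_mod_cast (hfg n).symm
          unfold gs
          rw [if_pos (hsq n)]
          have h3 : (0:ℝ) < (f n).totient := by exact_mod_cast Nat.totient_pos.mpr (by omega)
          have h4 : ((f n).totient : ℝ) ≤ f n := by exact_mod_cast Nat.totient_le _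
          have h5 : (0:ℝ) < g n := by exact_mod_cast (by omega : 0 < g n)
          rw [div_mul_div_comm, one_mul]
          apply div_le_div₀ zero_le_one le_rfl (by positivity)
          rw [e, mul_comm]; gcongr
      _ = ∑ x ∈ (Icc 1 R).image (fun n => (f n, g n)), gs x.1 * (1 / (x.2:ℝ)^2) := by
          rw [Finset.sum_image hi]
      _ ≤ _ := by
          apply Finset.sum_le_sum_of_subset_of_nonneg
          · intro x hx
            obtain ⟨n, hn, rfl⟩ := Finset.mem_image.mp hx
            exact hinj n hn
          · intro x _ _
            exact mul_nonneg (gs_nonneg _) (by positivity)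
  have h3 : ∑ a ∈ Icc 1 R, 1 / (a:ℝ)^2 ≤ 2 := by
    have : ∀ n : ℕ, ∑ a ∈ Icc 1 n, 1 / (a:ℝ)^2 ≤ 2 - 1 / (n : ℝ) := by
      intro n
      induction n with
      | zero => simp
      | succ n ih =>
        rcases Nat.eq_zero_or_pos n with rfl | hn
        · norm_num
        rw [Finset.sum_Icc_succ_top (by omega)]
        push_cast
        have hn' : (0:ℝ) < n := by exact_mod_cast hn
        have h1 : (1:ℝ) / (n:ℝ) - 1/(n+1:ℝ) = 1/(n*(n+1):ℝ) := by field_simp; ring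
        have h2 : (1:ℝ) / (n+1:ℝ)^2 ≤ 1/(n*(n+1):ℝ) := by
          apply one_div_le_one_div_of_le (by positivity); nlinarith
        linarith
    have h := this R
    have : (0:ℝ) ≤ 1 / (R:ℝ) := by positivity
    linarith
  have h4 : ∑ s ∈ Icc 1 R, ∑ a ∈ Icc 1 R, gs s * (1 / (a:ℝ)^2) = V R * ∑ a ∈ Icc 1 R, 1 / (a:ℝ)^2 := by
    rw [V, Finset.sum_mul_sum]
  have hV : 0 ≤ V R := Finset.sum_nonneg fun _ _ => gs_nonneg _
  rw [h4] at h2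
  nlinarith

lemma V_pos {R : ℕ} (hR : 1 ≤ R) : 0 < V R := by
  have : gs 1 ≤ V R := Finset.single_le_sum (f := gs) (fun i _ => gs_nonneg i) (by simpa using hR)
  have h1 : gs 1 = 1 := by simp [gs]
  linarith

lemma lam_one {R : ℕ} (hR : 1 ≤ R) : lam R 1 = 1 := by
  unfold lam
  have := V_pos hR
  simp
  rw [← V, div_self this.ne']

lemma lam_zero {R d : ℕ} (h : R < d) : lam R d = 0 := by
  unfold lam
  rw [Finset.sum_eq_zero]
  · simp
  · intro k hk
    simp at hk
    rw [if_neg]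
    intro hd
    have := Nat.le_of_dvd (by omega) hd
    omega

lemma lam_le {R : ℕ} (hR : 1 ≤ R) (d : ℕ) : |lam R d| ≤ d := by
  have hV := V_pos hR
  unfold lam
  have h0 : 0 ≤ (∑ k ∈ Icc 1 R, if d ∣ k then gs k else 0) :=
    Finset.sum_nonneg fun k _ => by split_ifs; exacts [gs_nonneg k, le_rfl]
  have h1 : (∑ k ∈ Icc 1 R, if d ∣ k then gs k else 0) ≤ V R :=
    Finset.sum_le_sum fun k _ => by split_ifs; exacts [le_rfl, gs_nonneg k]
  rw [abs_div, abs_mul, abs_mul, abs_of_pos hV, abs_of_nonneg h0, div_le_iff₀ hV, Nat.abs_cast]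
  have h2 : |(moebius d : ℝ)| ≤ 1 := by exact_mod_cast abs_moebius_le_one
  calc _ ≤ 1 * (d:ℝ) * V R := by gcongr
    _ = _ := by ring

lemma sum_moebius_mid (k m : ℕ) (hm : Squarefree m) (R : ℕ) (hmR : m ∈ Icc 1 R) :
    ∑ d ∈ Icc 1 R, (if k ∣ d ∧ d ∣ m then (moebius d : ℝ) else 0) = if k = m then (moebius m : ℝ) else 0 := by
  have hm0 : m ≠ 0 := by simp at hmR; omega
  by_cases hk : k ∣ m
  · obtain ⟨e, rfl⟩ := hk
    have hk0 : k ≠ 0 := by rintro rfl; simp at hm0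
    have he0 : e ≠ 0 := by rintro rfl; simp at hm0
    have e1 : ∑ d ∈ Icc 1 R, (if k ∣ d ∧ d ∣ k * e then (moebius d : ℝ) else 0) = ∑ c ∈ e.divisors, (moebius (k * c) : ℝ) := by
      rw [← Finset.sum_filter]
      symm
      refine Finset.sum_bij (fun c _ => k * c) ?_ ?_ ?_ ?_
      · intro c hc
        simp only [Nat.mem_divisors, mem_filter, mem_Icc] at hc hmR ⊢
        have hc0 : c ≠ 0 := by rintro rfl; simp at hc
        have : k * c ∣ k * e := mul_dvd_mul_left _ hc.1
        have h2 := Nat.le_of_dvd (by omega) this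
        exact ⟨⟨Nat.pos_of_ne_zero (by positivity), by omega⟩, dvd_mul_right _ _, this⟩
      · intro a _ b _ h
        exact Nat.eq_of_mul_eq_mul_left (Nat.pos_of_ne_zero hk0) h
      · intro d hd
        simp only [mem_filter] at hd
        obtain ⟨-, ⟨c, rfl⟩, h2⟩ := hd
        refine ⟨c, ?_, rfl⟩
        rw [Nat.mem_divisors]
        exact ⟨Nat.dvd_of_mul_dvd_mul_left (Nat.pos_of_ne_zero hk0) h2, he0⟩
      · intros; rfl
    have hcop : Nat.Coprime k e := (Nat.squarefree_mul_iff.mp hm).1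
    have e2 : ∀ c ∈ e.divisors, (moebius (k * c) : ℝ) = moebius k * moebius c := by
      intro c hc
      have : Nat.Coprime k c := hcop.coprime_dvd_right (Nat.dvd_of_mem_divisors hc)
      rw [isMultiplicative_moebius.map_mul_of_coprime this]; push_cast; rfl
    rw [e1, Finset.sum_congr rfl e2, ← Finset.mul_sum]
    have h2 : (∑ d ∈ e.divisors, (moebius d : ℝ)) = if e = 1 then 1 else 0 := by
      have h3 := congrArg (fun F : ArithmeticFunction ℤ => F e) coe_zeta_mul_moebius
      simp only [coe_zeta_mul_apply, one_apply] at h3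
      exact_mod_cast h3
    rw [h2]
    by_cases h : e = 1
    · subst h; simp
    · rw [if_neg h, if_neg]
      · simp
      · intro h'
        apply h
        have : k * 1 = k * e := by rw [mul_one]; exact h'
        exact (Nat.eq_of_mul_eq_mul_left (Nat.pos_of_ne_zero hk0) this).symm
  · rw [if_neg (by rintro rfl; exact hk dvd_rfl)]
    apply Finset.sum_eq_zero
    intro d _
    rw [if_neg]
    rintro ⟨h1, h2⟩
    exact hk (h1.trans h2)

lemma y_eq {R : ℕ} (k : ℕ) (hk : k ∈ Icc 1 R) :
    ∑ d ∈ Icc 1 R, (if k ∣ d then lam R d / d else 0) = moebius k * gs k / V R := by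
  have e1 : ∀ d ∈ Icc 1 R, (if k ∣ d then lam R d / d else 0) =
      ∑ m ∈ Icc 1 R, gs m * (if k ∣ d ∧ d ∣ m then (moebius d : ℝ) else 0) / V R := by
    intro d hd
    have hd0 : (d:ℝ) ≠ 0 := by simp at hd; exact_mod_cast (by omega : d ≠ 0)
    split_ifs with h
    · unfold lam
      rw [← Finset.sum_div]
      rw [div_right_comm]
      congr 1
      rw [mul_assoc, mul_div_assoc, mul_div_cancel_left₀ _ hd0, Finset.mul_sum]
      refine Finset.sum_congr rfl fun m _ => ?_
      by_cases h2 : d ∣ m <;> simp [h, h2, mul_comm]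
    · simp [h]
  rw [Finset.sum_congr rfl e1, Finset.sum_comm]
  have e2 : ∀ m ∈ Icc 1 R, ∑ d ∈ Icc 1 R, gs m * (if k ∣ d ∧ d ∣ m then (moebius d : ℝ) else 0) / V R =
      if k = m then gs k * moebius k / V R else 0 := by
    intro m hm
    rw [← Finset.sum_div, ← Finset.mul_sum]
    by_cases hs : Squarefree m
    · rw [sum_moebius_mid k m hs R hm]
      split_ifs with h
      · rw [h]
      · simp
    · have : gs m = 0 := by simp [gs, hs]
      rw [this]
      split_ifs with h
      · rw [h, this]; simp
      · simp
  rw [Finset.sum_congr rfl e2, Finset.sum_ite_eq, if_pos hk, mul_comm (gs k)]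

theorem quad {R : ℕ} (hR : 1 ≤ R) :
    ∑ d ∈ Icc 1 R, ∑ d' ∈ Icc 1 R, lam R d * lam R d' / (Nat.lcm d d' : ℝ) = 1 / V R := by
  have hV := V_pos hR
  have e1 : ∀ d ∈ Icc 1 R, ∀ d' ∈ Icc 1 R, lam R d * lam R d' / (Nat.lcm d d' : ℝ) =
      ∑ k ∈ Icc 1 R, (k.totient : ℝ) * ((if k ∣ d then lam R d / d else 0) * (if k ∣ d' then lam R d' / d' else 0)) := by
    intro d hd d' hd'
    simp only [mem_Icc] at hd hd'
    have hd0 : (d:ℝ) ≠ 0 := by exact_mod_cast (by omega : d ≠ 0)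
    have hd0' : (d':ℝ) ≠ 0 := by exact_mod_cast (by omega : d' ≠ 0)
    have h1 : ∑ k ∈ Icc 1 R, (k.totient : ℝ) * ((if k ∣ d then lam R d / d else 0) * (if k ∣ d' then lam R d' / d' else 0)) =
        (∑ k ∈ (Nat.gcd d d').divisors, (k.totient : ℝ)) * (lam R d / d * (lam R d' / d')) := by
      rw [Finset.sum_mul]
      have : (Nat.gcd d d').divisors = (Icc 1 R).filter (fun k => k ∣ d ∧ k ∣ d') := by
        ext k
        simp only [Nat.mem_divisors, mem_filter, mem_Icc, Nat.dvd_gcd_iff]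
        constructor
        · rintro ⟨⟨h1, h2⟩, h3⟩
          exact ⟨⟨Nat.pos_of_dvd_of_pos h1 (by omega), (Nat.le_of_dvd (by omega) h1).trans hd.2⟩, h1, h2⟩
        · rintro ⟨_, h1, h2⟩
          exact ⟨⟨h1, h2⟩, Nat.gcd_ne_zero_left (by omega)⟩
      rw [this, Finset.sum_filter]
      refine Finset.sum_congr rfl fun k _ => ?_
      by_cases h1 : k ∣ d <;> by_cases h2 : k ∣ d' <;> simp [h1, h2]
    rw [h1]
    have h2 : ∑ k ∈ (Nat.gcd d d').divisors, (k.totient : ℝ) = Nat.gcd d d' := by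
      exact_mod_cast Nat.sum_totient _
    have h3 : (Nat.gcd d d' : ℝ) * Nat.lcm d d' = d * d' := by exact_mod_cast Nat.gcd_mul_lcm d d'
    have h4 : (Nat.lcm d d' : ℝ) ≠ 0 := by exact_mod_cast Nat.lcm_ne_zero (by omega) (by omega)
    rw [h2]
    field_simp
    linear_combination (-(lam R d * lam R d')) * h3
  have e2 : ∑ d ∈ Icc 1 R, ∑ d' ∈ Icc 1 R, lam R d * lam R d' / (Nat.lcm d d' : ℝ) =
      ∑ k ∈ Icc 1 R, (k.totient : ℝ) * (∑ d ∈ Icc 1 R, (if k ∣ d then lam R d / d else 0)) ^ 2 := by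
    rw [Finset.sum_congr rfl fun d hd => Finset.sum_congr rfl fun d' hd' => e1 d hd d' hd']
    simp_rw [sq, Finset.sum_mul_sum, Finset.mul_sum]
    rw [Finset.sum_congr rfl fun d _ => Finset.sum_comm]
    rw [Finset.sum_comm]
  rw [e2]
  have e3 : ∀ k ∈ Icc 1 R, (k.totient : ℝ) * (∑ d ∈ Icc 1 R, (if k ∣ d then lam R d / d else 0)) ^ 2 =
      gs k / V R ^ 2 := by
    intro k hk
    rw [y_eq k hk]
    have hk0 : (k.totient : ℝ) ≠ 0 := by
      simp at hk
      exact_mod_cast (Nat.totient_pos.mpr (by omega)).ne'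
    by_cases hs : Squarefree k
    · have h1 : ((moebius k : ℝ)) ^ 2 = 1 := by exact_mod_cast moebius_sq_eq_one_of_squarefree hs
      simp only [gs, hs, if_true]
      rw [div_pow, mul_pow, h1]
      field_simp
    · simp [gs, hs]
  rw [Finset.sum_congr rfl e3, ← Finset.sum_div, ← V]
  field_simp

end Sel
end

section
namespace GS
open Complex Filter Topology Finset
open scoped Real

lemma sqrt_lim {l : Filter ℝ} (u : ℝ → ℂ) (c : ℝ) (hc : 0 < c) (hu : ∀ᶠ x in l, 0 ≤ (u x).re)
    (h : Tendsto (fun x => u x ^ 2) l (𝓝 ((c : ℂ) ^ 2))) : Tendsto u l (𝓝 (c : ℂ)) := by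
  rw [tendsto_iff_norm_sub_tendsto_zero] at h ⊢
  have h2 : Tendsto (fun x => ‖u x ^ 2 - (c:ℂ) ^ 2‖ / c) l (𝓝 0) := by
    simpa using h.div_const c
  refine squeeze_zero' (Eventually.of_forall fun _ => norm_nonneg _) ?_ h2
  filter_upwards [hu] with x hx
  rw [le_div_iff₀ hc]
  have : u x ^ 2 - (c:ℂ) ^ 2 = (u x - c) * (u x + c) := by ring
  rw [this, norm_mul]
  gcongr
  calc c ≤ (u x + c).re := by simp [hx]
    _ ≤ _ := Complex.re_le_norm _

lemma summable_gauss : Summable (fun n : ℤ => Real.exp (-π * (n:ℝ)^2)) := by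
  simpa using summable_pow_mul_jacobiTheta₂_term_bound 0 one_pos 0

lemma sum_lim {l : Filter ℝ} [l.IsCountablyGenerated] (a : ℝ → ℂ) (ha : Tendsto (fun x => (a x).re) l atTop) (t : ℝ) :
    Tendsto (fun x => ∑' n : ℤ, cexp (-π * a x * n ^ 2 + 2 * π * (t * I) * n)) l (𝓝 1) := by
  have key : Tendsto (fun x => ∑' n : ℤ, cexp (-π * a x * n ^ 2 + 2 * π * (t * I) * n)) l
      (𝓝 (∑' n : ℤ, if n = 0 then (1:ℂ) else 0)) := by
    refine tendsto_tsum_of_dominated_convergence summable_gauss ?_ ?_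
    · intro n
      by_cases hn : n = 0
      · subst hn; simp; exact tendsto_const_nhds
      · simp only [hn, if_false]
        rw [tendsto_zero_iff_norm_tendsto_zero]
        simp only [Complex.norm_exp]
        refine Real.tendsto_exp_atBot.comp ?_
        have hn2 : (0:ℝ) < π * (n:ℝ)^2 := by positivity
        have : (fun x => (-π * a x * n ^ 2 + 2 * π * (t * I) * n : ℂ).re) = fun x => -((π * (n:ℝ)^2) * (a x).re) := by
          ext x
          have : (-π * a x * n ^ 2 + 2 * π * (t * I) * n : ℂ) = ((-(π * (n:ℝ)^2) : ℝ) : ℂ) * a x + ((2 * π * t * n : ℝ) : ℂ) * I := by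
            push_cast; ring
          rw [this]; simp only [add_re, re_ofReal_mul, I_re]; ring
        rw [this]
        exact tendsto_neg_atTop_atBot.comp (ha.const_mul_atTop hn2)
    · filter_upwards [ha.eventually_ge_atTop 1] with x hx n
      rw [Complex.norm_exp]
      have : (-π * a x * n ^ 2 + 2 * π * (t * I) * n : ℂ) = ((-(π * (n:ℝ)^2) : ℝ) : ℂ) * a x + ((2 * π * t * n : ℝ) : ℂ) * I := by
        push_cast; ring
      rw [this]; simp only [add_re, re_ofReal_mul, I_re]
      apply Real.exp_le_exp.mpr
      have hn2 : (0:ℝ) ≤ π * (n:ℝ)^2 := by positivity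
      nlinarith
  simpa using key

lemma theta_lim (m : ℕ) (hm : 0 < m) (r : ℤ) (a : ℝ → ℂ) (c : ℝ) (hc : 0 < c)
    (hinf : Tendsto (fun x => (a x).re) (𝓝[>] 0) atTop)
    (hlim : Tendsto (fun x : ℝ => (x:ℂ) * a x) (𝓝[>] 0) (𝓝 ((c:ℂ)^2))) :
    Tendsto (fun x : ℝ => ((√x : ℝ) : ℂ) * ∑' n : ℤ, cexp (-π / a x * (m * n + r) ^ 2)) (𝓝[>] 0)
      (𝓝 ((c / m : ℝ) : ℂ)) := by
  have hmR : (0:ℝ) < m := by exact_mod_cast hm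
  have hmC : (m:ℂ) ≠ 0 := by exact_mod_cast hm.ne'
  set A : ℝ → ℂ := fun x => a x / (m:ℂ)^2 with hA
  have hAre : ∀ x, (A x).re = (a x).re / (m:ℝ)^2 := by
    intro x
    simp only [hA]
    rw [show (m:ℂ)^2 = (((m:ℝ)^2 : ℝ) : ℂ) by push_cast; rfl, Complex.div_ofReal_re]
  have hAinf : Tendsto (fun x => (A x).re) (𝓝[>] 0) atTop := by
    simp only [hAre]; exact hinf.atTop_div_const (by positivity)
  have hApos : ∀ᶠ x in 𝓝[>] (0:ℝ), 0 < (A x).re := hAinf.eventually_gt_atTop 0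
  have hu : Tendsto (fun x : ℝ => ((√x : ℝ) : ℂ) * (A x) ^ (1/2 : ℂ)) (𝓝[>] 0) (𝓝 ((c/m : ℝ):ℂ)) := by
    apply sqrt_lim _ _ (by positivity)
    · filter_upwards with x
      rw [re_ofReal_mul]
      refine mul_nonneg (Real.sqrt_nonneg _) ?_
      rw [one_div, Complex.cpow_inv_two_re]; positivity
    · have h3 : Tendsto (fun x : ℝ => (x:ℂ) * a x / (m:ℂ)^2) (𝓝[>] 0) (𝓝 (((c/m : ℝ):ℂ)^2)) := by
        have := hlim.div_const ((m:ℂ)^2)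
        convert this using 2
        push_cast; rw [div_pow]
      refine h3.congr' ?_
      filter_upwards [self_mem_nhdsWithin] with x hx
      have hx : (0:ℝ) < x := hx
      rw [mul_pow, ← ofReal_pow, Real.sq_sqrt hx.le, one_div, Complex.cpow_ofNat_inv_pow, mul_div_assoc]
  have hs := sum_lim A hAinf (-(r:ℝ)/m)
  have := hu.mul hs
  rw [mul_one] at this
  refine this.congr' ?_
  filter_upwards [hApos] with x hx
  rw [mul_assoc]
  congr 1
  have hA0 : A x ≠ 0 := by
    intro h; rw [h] at hx; simp at hx
  have ha0 : a x ≠ 0 := by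
    intro h; apply hA0; simp [hA, h]
  rw [Complex.tsum_exp_neg_quadratic hx, ← mul_assoc, mul_one_div, div_self, one_mul]
  · apply tsum_congr; intro n
    congr 1
    have : (n:ℂ) + I * (((-(r:ℝ)/m : ℝ) : ℂ) * I) = (m * n + r) / m := by
      push_cast
      field_simp
      linear_combination (-(r:ℂ)) * I_sq
    rw [this]
    simp only [hA]
    field_simp
  · rw [Ne, Complex.cpow_eq_zero_iff]; simp [hA0]

end GS
end

section
namespace GS
open Complex Filter Topology Finset
open scoped Real

lemma summable_quad (a : ℂ) (ha : 0 < a.re) : Summable (fun n : ℤ => cexp (-π * a * n ^ 2)) := by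
  apply Summable.of_norm
  have := summable_pow_mul_jacobiTheta₂_term_bound 0 ha 0
  refine this.congr fun n => ?_
  rw [Complex.norm_exp]
  have h : (-π * a * n ^ 2 : ℂ) = ((-(π * (n:ℝ)^2) : ℝ) : ℂ) * a := by push_cast; ring
  rw [h, re_ofReal_mul]
  simp; ring

lemma tsum_split (m : ℕ) [NeZero m] (f : ℤ → ℂ) (hf : Summable f) :
    ∑' n, f n = ∑ r : Fin m, ∑' k : ℤ, f (m * k + (r : ℕ)) := by
  rw [← (Int.divModEquiv m).symm.tsum_eq f]
  have hs : Summable (fun z => f ((Int.divModEquiv m).symm z)) :=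
    (Int.divModEquiv m).symm.summable_iff.mpr hf
  have e := (Equiv.prodComm (Fin m) ℤ).tsum_eq (fun z => f ((Int.divModEquiv m).symm z))
  rw [← e]
  have hs2 := (Equiv.prodComm (Fin m) ℤ).summable_iff.mpr hs
  refine (hs2.tsum_prod).trans ?_
  rw [tsum_fintype]
  refine Finset.sum_congr rfl fun r _ => tsum_congr fun k => ?_
  simp [Int.divModEquiv, mul_comm]

lemma split_lim (m : ℕ) [NeZero m] (f : ℝ → ℤ → ℂ) (φ : Fin m → ℂ) (a : ℝ → ℂ) (c : ℝ) (hc : 0 < c)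
    (hinf : Tendsto (fun x => (a x).re) (𝓝[>] 0) atTop)
    (hlim : Tendsto (fun x : ℝ => (x:ℂ) * a x) (𝓝[>] 0) (𝓝 ((c:ℂ)^2)))
    (hs : ∀ x, 0 < x → Summable (f x))
    (hf : ∀ x, 0 < x → ∀ r : Fin m, ∀ k : ℤ, f x (m * k + (r:ℕ)) = φ r * cexp (-π / a x * (m * k + ((r:ℕ):ℤ)) ^ 2)) :
    Tendsto (fun x : ℝ => ((√x : ℝ) : ℂ) * ∑' n : ℤ, f x n) (𝓝[>] 0)
      (𝓝 ((∑ r, φ r) * ((c / m : ℝ) : ℂ))) := by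
  have h1 : Tendsto (fun x : ℝ => ∑ r : Fin m, φ r * (((√x : ℝ) : ℂ) * ∑' n : ℤ, cexp (-π / a x * (m * n + ((r:ℕ):ℤ)) ^ 2)))
      (𝓝[>] 0) (𝓝 (∑ r, φ r * ((c / m : ℝ) : ℂ))) :=
    tendsto_finsetSum _ fun r _ => (theta_lim m (Nat.pos_of_ne_zero (NeZero.ne m)) _ a c hc hinf hlim).const_mul _
  rw [Finset.sum_mul]
  refine h1.congr' ?_
  filter_upwards [self_mem_nhdsWithin] with x hx
  rw [tsum_split m _ (hs x hx), Finset.mul_sum]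
  refine Finset.sum_congr rfl fun r _ => ?_
  rw [tsum_congr (hf x hx r), tsum_mul_left]
  ring

lemma root_val (p : ℕ) (hp : 0 < p) : 1 / ((-2 * I / p : ℂ)) ^ (1/2:ℂ) = (√p / 2 : ℝ) * (1 + I) := by
  have hpR : (0:ℝ) < p := by exact_mod_cast hp
  have hpC : (p:ℂ) ≠ 0 := by exact_mod_cast hp.ne'
  set u := ((-2 * I / p : ℂ)) ^ (1/2:ℂ) with hu
  have h0 : (-2 * I / p : ℂ) ≠ 0 := by simp [hp.ne']
  have hu0 : u ≠ 0 := by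
    rw [hu, Ne, Complex.cpow_eq_zero_iff]; simp [hp.ne']
  have hu2 : u ^ 2 = -2 * I / p := by
    rw [hu, one_div, Complex.cpow_ofNat_inv_pow]
  have hre : 0 < u.re := by
    rw [hu, one_div, Complex.cpow_inv_two_re]
    have : (-2 * I / p : ℂ).re = 0 := by
      rw [show (p:ℂ) = ((p:ℝ):ℂ) by simp, Complex.div_ofReal_re]; simp
    rw [this]
    have := norm_pos_iff.mpr h0
    positivity
  set v : ℂ := (√p / 2 : ℝ) * (1 + I) with hv
  have hsq : ((√p : ℝ) : ℂ)^2 = p := by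
    rw [← ofReal_pow, Real.sq_sqrt hpR.le]; simp
  have hprod : (u * v) ^ 2 = 1 := by
    rw [mul_pow, hu2, hv]
    push_cast
    rw [mul_pow, div_pow, hsq]
    field_simp
    linear_combination (-2 - I) * I_sq
  rcases (show u * v = 1 ∨ u * v = -1 from by simpa using hprod) with h | h
  · rw [div_eq_iff hu0, mul_comm]; exact h.symm
  · exfalso
    have h2 : u = -(1 / √p : ℝ) * (1 - I) := by
      have hv0 : v ≠ 0 := by
        intro h3; rw [h3] at h; simp at h
      apply mul_right_cancel₀ hv0
      rw [h, hv]
      push_cast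
      have : ((√p : ℝ):ℂ) ≠ 0 := by
        intro h3; rw [h3] at hsq; simp at hsq; exact hpC hsq.symm
      field_simp
      linear_combination - I_sq
    rw [h2, ← ofReal_neg, re_ofReal_mul] at hre
    simp at hre
    have := Real.sqrt_pos.mpr hpR
    linarith [inv_pos.mpr this]

lemma quad_gauss (p : ℕ) [NeZero p] :
    ∑ r : Fin p, cexp (2 * π * I * (r:ℕ) ^ 2 / p) = (√p / 2 : ℝ) * (1 + I) * (1 + cexp (-π * I * p / 2)) := by
  have hp : 0 < p := Nat.pos_of_ne_zero (NeZero.ne p)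
  have hpR : (0:ℝ) < p := by exact_mod_cast hp
  have hpC : (p:ℂ) ≠ 0 := by exact_mod_cast hp.ne'
  -- left
  have hare : ∀ x : ℝ, ((x:ℂ) - 2 * I / p).re = x := by
    intro x
    rw [sub_re, show (p:ℂ) = ((p:ℝ):ℂ) by simp, Complex.div_ofReal_re]; simp
  have hL := split_lim p (fun x n => cexp (-π * ((x:ℂ) - 2 * I / p) * n ^ 2))
    (fun r => cexp (2 * π * I * (r:ℕ) ^ 2 / p)) (fun x => ((x⁻¹ : ℝ) : ℂ)) 1 one_pos
    (by simpa using tendsto_inv_nhdsGT_zero)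
    (by
      refine tendsto_const_nhds.congr' ?_
      filter_upwards [self_mem_nhdsWithin] with x hx
      have hx : (0:ℝ) < x := hx
      rw [← ofReal_mul, mul_inv_cancel₀ hx.ne']; simp)
    (fun x hx => summable_quad _ (by rw [hare]; exact hx))
    (by
      intro x hx r k
      have hxC : (x:ℂ) ≠ 0 := by exact_mod_cast hx.ne'
      rw [← Complex.exp_add, Complex.exp_eq_exp_iff_exists_int]
      refine ⟨p * k^2 + 2 * k * r, ?_⟩
      push_cast
      field_simp
      ring)
  -- right
  have hR := split_lim 2 (fun x n => cexp (-π / ((x:ℂ) - 2 * I / p) * n ^ 2))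
    (fun r => if r = 0 then 1 else cexp (-π * I * p / 2)) (fun x => 2 * I / p + (((4 / (p:ℝ)^2) * x⁻¹ : ℝ) : ℂ)) (2/p) (by positivity)
    (by
      have : ∀ x : ℝ, (2 * I / p + (((4 / (p:ℝ)^2) * x⁻¹ : ℝ) : ℂ)).re = (4 / (p:ℝ)^2) * x⁻¹ := by
        intro x
        rw [add_re, show (p:ℂ) = ((p:ℝ):ℂ) by simp, Complex.div_ofReal_re, ofReal_re]; simp
      simp only [this]
      exact tendsto_inv_nhdsGT_zero.const_mul_atTop (by positivity))
    (by
      have h1 : Tendsto (fun x : ℝ => (x:ℂ) * (2 * I / p) + 4 / (p:ℂ)^2) (𝓝[>] 0) (𝓝 ((((2/p:ℝ)):ℂ)^2)) := by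
        have : Tendsto (fun x : ℝ => (x:ℂ) * (2 * I / p) + 4 / (p:ℂ)^2) (𝓝 0) (𝓝 (((0:ℝ):ℂ) * (2 * I / p) + 4 / (p:ℂ)^2)) := by
          refine Continuous.tendsto (by fun_prop) 0
        refine (this.mono_left nhdsWithin_le_nhds).trans (le_of_eq ?_)
        congr 1
        push_cast; field_simp; ring
      refine h1.congr' ?_
      filter_upwards [self_mem_nhdsWithin] with x hx
      have hxC : (x:ℂ) ≠ 0 := by
        have hx : (0:ℝ) < x := hx
        exact_mod_cast hx.ne'
      push_cast
      field_simp)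
    (fun x hx => by
      have := summable_quad (1 / ((x:ℂ) - 2 * I / p)) (by
        rw [one_div, Complex.inv_re, hare]
        apply div_pos hx
        rw [Complex.normSq_pos]
        intro h; have := hare x; rw [h] at this; simp at this; linarith)
      refine this.congr fun n => ?_
      congr 1; ring)
    (by
      intro x hx r k
      have hxC : (x:ℂ) ≠ 0 := by exact_mod_cast hx.ne'
      have hd : (x:ℂ) * p - 2 * I ≠ 0 := by
        intro h
        have := congrArg Complex.im h
        simp at this
      have e1 : (x:ℂ) - 2 * I / p = (x * p - 2 * I) / p := by field_simp
      have e2 : (2 * I / p + (((4 / (p:ℝ)^2) * x⁻¹ : ℝ) : ℂ)) = 2 * I * (x * p - 2 * I) / (p^2 * x) := by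
        push_cast; field_simp
        linear_combination (4:ℂ) * I_sq
      have key : -π / ((x:ℂ) - 2 * I / p) = -π / (2 * I / p + (((4 / (p:ℝ)^2) * x⁻¹ : ℝ) : ℂ)) - π * I * p / 2 := by
        rw [e1, e2]
        field_simp
        linear_combination (x * p - 2 * I) * I_sq
      rw [key]
      fin_cases r
      · simp only [Fin.zero_eta, Fin.val_zero, if_true, one_mul]
        rw [Complex.exp_eq_exp_iff_exists_int]
        refine ⟨-(p * k^2), ?_⟩
        push_cast; ring
      · simp only [Fin.mk_one, Fin.val_one, one_ne_zero, if_false]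
        rw [← Complex.exp_add, Complex.exp_eq_exp_iff_exists_int]
        refine ⟨-(p * (k^2 + k)), ?_⟩
        push_cast; ring)
  have hroot : Tendsto (fun x : ℝ => 1 / ((x:ℂ) - 2 * I / p) ^ (1/2:ℂ)) (𝓝[>] 0) (𝓝 ((√p / 2 : ℝ) * (1 + I))) := by
    rw [← root_val p hp]
    have hc : ContinuousAt (fun x : ℝ => ((x:ℂ) - 2 * I / p) ^ (1/2:ℂ)) 0 := by
      refine ContinuousAt.cpow (by fun_prop) (by fun_prop) ?_
      right
      rw [sub_im, show (p:ℂ) = ((p:ℝ):ℂ) by simp, Complex.div_ofReal_im]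
      simp [hp.ne']
    have h3 := (hc.tendsto.mono_left (nhdsWithin_le_nhds (s := Set.Ioi 0))).inv₀ (by
      simp [Complex.cpow_eq_zero_iff, hp.ne'])
    simp only [one_div] at h3 ⊢
    refine h3.trans (le_of_eq ?_)
    congr 3
    push_cast; ring
  have hR2 := hroot.mul hR
  have hEq := tendsto_nhds_unique (hL.congr' (by
    filter_upwards [self_mem_nhdsWithin] with x hx
    have := Complex.tsum_exp_neg_quadratic (a := (x:ℂ) - 2 * I / p) (by rw [hare]; exact hx) 0
    simp only [mul_zero, zero_mul, add_zero] at this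
    rw [this, mul_left_comm])) hR2
  simp only [Fin.sum_univ_two, if_true, one_ne_zero, if_false] at hEq
  have hp2 : ((1 / (p:ℝ) : ℝ) : ℂ) ≠ 0 := by
    simp [hp.ne']
  apply mul_right_cancel₀ hp2
  rw [hEq]
  push_cast
  field_simp

end GS
end

section
namespace GS
open Complex Filter Topology Finset
open scoped Real

noncomputable def gval (p : ℕ) : ℂ := if p % 4 = 1 then (√p : ℝ) else I * (√p : ℝ)

lemma quad_val (p : ℕ) (hp : p % 2 = 1) :
    ((√p / 2 : ℝ) : ℂ) * (1 + I) * (1 + cexp (-π * I * p / 2)) = gval p := by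
  unfold gval
  split_ifs with h
  · have : cexp (-π * I * p / 2) = -I := by
      obtain ⟨k, hk⟩ : ∃ k, p = 4 * k + 1 := ⟨p / 4, by omega⟩
      rw [show -I = cexp (-(π / 2 * I)) by rw [Complex.exp_neg, Complex.exp_pi_div_two_mul_I, Complex.inv_I],
        Complex.exp_eq_exp_iff_exists_int]
      refine ⟨-k, ?_⟩
      rw [hk]; push_cast; ring
    rw [this]; push_cast
    linear_combination (-(√p : ℝ) / 2 : ℂ) * I_sq
  · have : cexp (-π * I * p / 2) = I := by
      obtain ⟨k, hk⟩ : ∃ k, p = 4 * k + 3 := ⟨p / 4, by omega⟩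
      nth_rw 2 [show I = cexp (π / 2 * I) by rw [Complex.exp_pi_div_two_mul_I]]
      rw [Complex.exp_eq_exp_iff_exists_int]
      refine ⟨-k-1, ?_⟩
      rw [hk]; push_cast; ring
    rw [this]; push_cast
    linear_combination ((√p : ℝ) / 2 : ℂ) * I_sq

variable (p : ℕ) [Fact p.Prime]

lemma gauss_zmod (hp : p ≠ 2) :
    ∑ x : ZMod p, ((quadraticChar (ZMod p) x : ℤ) : ℂ) * ZMod.stdAddChar x = gval p := by
  have hpp : p.Prime := Fact.out
  have hodd : p % 2 = 1 := Nat.odd_iff.mp (hpp.odd_of_ne_two hp)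
  rw [← quad_val p hodd, ← quad_gauss p, Fin.sum_univ_eq_sum_range (fun r => cexp (2 * π * I * (r:ℕ) ^ 2 / p)) p]
  have h1 : ∑ r ∈ range p, cexp (2 * π * I * (r:ℕ) ^ 2 / p) = ∑ x : ZMod p, ZMod.stdAddChar (x^2) := by
    rw [PV.zmod_sum_range]
    refine Finset.sum_congr rfl fun r _ => ?_
    have := ZMod.stdAddChar_coe (N := p) ((r:ℤ)^2)
    push_cast at this
    rw [this]
  have h2 : ∑ x : ZMod p, ZMod.stdAddChar (x^2) = ∑ a : ZMod p, (((quadraticChar (ZMod p) a : ℤ) : ℂ) + 1) * ZMod.stdAddChar a := by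
    rw [← Finset.sum_fiberwise_of_maps_to (s := univ) (t := univ) (g := fun x : ZMod p => x^2) (fun _ _ => mem_univ _)]
    refine Finset.sum_congr rfl fun a _ => ?_
    rw [Finset.sum_congr rfl (g := fun _ => ZMod.stdAddChar a) (by
      intro x hx; rw [(Finset.mem_filter.mp hx).2])]
    rw [Finset.sum_const, nsmul_eq_mul]
    congr 1
    have := quadraticChar_card_sqrts (F := ZMod p) (by rw [ZMod.ringChar_zmod_n]; exact hp) a
    have h3 : ((univ.filter (fun x : ZMod p => x^2 = a)).card : ℤ) = quadraticChar (ZMod p) a + 1 := by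
      rw [← this]; congr 2; ext x; simp
    exact_mod_cast h3
  rw [h1, h2]
  simp only [add_mul, one_mul, Finset.sum_add_distrib]
  have h3 : ∑ a : ZMod p, ZMod.stdAddChar a = (0:ℂ) := by
    apply AddChar.sum_eq_zero_of_ne_one
    intro h
    have := ZMod.isPrimitive_stdAddChar p
    have h1 : (1 : ZMod p) ≠ 0 := one_ne_zero
    apply this h1
    simpa using h
  rw [h3, add_zero]

lemma gauss_shift (hp : p ≠ 2) (n : ℤ) :
    ∑ a ∈ range p, ((legendreSym p a : ℤ) : ℂ) * cexp (2 * π * I * (a * n) / p) = (legendreSym p n : ℤ) * gval p := by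
  have h1 : ∑ a ∈ range p, ((legendreSym p a : ℤ) : ℂ) * cexp (2 * π * I * (a * n) / p) =
      ∑ x : ZMod p, ((quadraticChar (ZMod p) x : ℤ) : ℂ) * ZMod.stdAddChar (x * (n : ZMod p)) := by
    rw [PV.zmod_sum_range]
    refine Finset.sum_congr rfl fun a _ => ?_
    have := ZMod.stdAddChar_coe (N := p) ((a:ℤ) * n)
    push_cast at this
    rw [this, legendreSym]
    push_cast; rfl
  rw [h1, ← gauss_zmod p hp]
  by_cases hn : (n : ZMod p) = 0
  · have h4 : legendreSym p n = 0 := (legendreSym.eq_zero_iff p n).mpr hn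
    rw [h4, hn]
    simp only [mul_zero, AddChar.map_zero_eq_one, mul_one, Int.cast_zero, zero_mul]
    have := quadraticChar_sum_zero (F := ZMod p) (by rw [ZMod.ringChar_zmod_n]; exact hp)
    exact_mod_cast this
  · have h5 : ∀ x : ZMod p, ((quadraticChar (ZMod p) x : ℤ) : ℂ) * ZMod.stdAddChar (x * (n : ZMod p)) =
        (legendreSym p n : ℤ) * (((quadraticChar (ZMod p) (x * n) : ℤ) : ℂ) * ZMod.stdAddChar (x * (n : ZMod p))) := by
      intro x
      rw [map_mul (quadraticChar (ZMod p)), legendreSym]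
      have h6 : (quadraticChar (ZMod p) (n:ZMod p))^2 = 1 := quadraticChar_sq_one hn
      have h7 : ((quadraticChar (ZMod p) (n:ZMod p) : ℤ) : ℂ)^2 = 1 := by exact_mod_cast h6
      push_cast
      linear_combination (-((quadraticChar (ZMod p) x : ℤ) : ℂ) * ZMod.stdAddChar (x * (n : ZMod p))) * h7
    rw [Finset.sum_congr rfl (fun x _ => h5 x), ← Finset.mul_sum]
    congr 1
    exact Equiv.sum_comp (Equiv.mulRight₀ (n : ZMod p) hn) (fun x => ((quadraticChar (ZMod p) x : ℤ) : ℂ) * ZMod.stdAddChar x)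

lemma gauss_cs (hp : p ≠ 2) (n : ℤ) :
    (∑ a ∈ range p, ((legendreSym p a : ℤ) : ℝ) * Real.cos (2 * π * (a * n) / p) = (legendreSym p n : ℤ) * (gval p).re) ∧
    (∑ a ∈ range p, ((legendreSym p a : ℤ) : ℝ) * Real.sin (2 * π * (a * n) / p) = (legendreSym p n : ℤ) * (gval p).im) := by
  have h := gauss_shift p hp n
  have e : ∀ a : ℕ, ((legendreSym p a : ℤ) : ℂ) * cexp (2 * π * I * (a * n) / p) =
      (((legendreSym p a : ℤ) : ℝ) : ℂ) * cexp ((2 * π * (a * n) / p : ℝ) * I) := by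
    intro a
    push_cast; congr 2; ring
  rw [Finset.sum_congr rfl (fun a _ => e a)] at h
  rw [show ((legendreSym p n : ℤ) : ℂ) = (((legendreSym p n : ℤ) : ℝ) : ℂ) by simp] at h
  constructor
  · have := congrArg Complex.re h
    rw [Complex.re_sum, re_ofReal_mul] at this
    rw [← this]
    refine Finset.sum_congr rfl fun a _ => ?_
    rw [re_ofReal_mul, Complex.exp_ofReal_mul_I_re]
  · have := congrArg Complex.im h
    rw [Complex.im_sum, im_ofReal_mul] at this
    rw [← this]
    refine Finset.sum_congr rfl fun a _ => ?_
    rw [im_ofReal_mul, Complex.exp_ofReal_mul_I_im]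

lemma gval1 (p : ℕ) (h : p % 4 = 1) : (gval p).re = √p ∧ (gval p).im = 0 := by
  simp [gval, h]
lemma gval3 (p : ℕ) (h : p % 4 = 3) : (gval p).re = 0 ∧ (gval p).im = √p := by
  simp [gval, h]

end GS
end

section
namespace LF
open Filter Topology Finset
open scoped Real

def HasT (f : ℕ → ℝ) (a : ℝ) : Prop := Tendsto (fun N : ℕ => ∑ n ∈ range N, f n / n) atTop (𝓝 a)

lemma abel_id {E : Type*} [AddCommGroup E] [Module ℝ E] (w : ℕ → ℝ) (z : ℕ → E) (n : ℕ) :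
    ∑ i ∈ range n, w i • z i = w n • (∑ i ∈ range n, z i) +
      ∑ i ∈ range n, (w i - w (i+1)) • ∑ j ∈ range (i+1), z j := by
  induction n with
  | zero => simp
  | succ n ih =>
    rw [sum_range_succ, ih, sum_range_succ (fun i => (w i - w (i+1)) • ∑ j ∈ range (i+1), z j),
      sum_range_succ z]
    module

lemma abel_bound {E : Type*} [NormedAddCommGroup E] [NormedSpace ℝ E] (w : ℕ → ℝ) (z : ℕ → E) (b : ℝ)
    (hw : Antitone w) (hw0 : ∀ n, 0 ≤ w n) (hz : ∀ n, ‖∑ i ∈ range n, z i‖ ≤ b) (n : ℕ) :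
    ‖∑ i ∈ range n, w i • z i‖ ≤ b * w 0 := by
  rw [abel_id]
  have h1 : ‖w n • (∑ i ∈ range n, z i)‖ ≤ w n * b := by
    rw [norm_smul, Real.norm_of_nonneg (hw0 n)]
    exact mul_le_mul_of_nonneg_left (hz n) (hw0 n)
  have h2 : ‖∑ i ∈ range n, (w i - w (i+1)) • ∑ j ∈ range (i+1), z j‖ ≤ ∑ i ∈ range n, (w i - w (i+1)) * b := by
    refine (norm_sum_le _ _).trans (sum_le_sum fun i _ => ?_)
    have h3 : 0 ≤ w i - w (i+1) := sub_nonneg.mpr (hw (Nat.le_succ i))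
    rw [norm_smul, Real.norm_of_nonneg h3]
    exact mul_le_mul_of_nonneg_left (hz _) h3
  rw [← sum_mul, sum_range_sub'] at h2
  calc _ ≤ _ := norm_add_le _ _
    _ ≤ w n * b + (w 0 - w n) * b := add_le_add h1 h2
    _ = _ := by ring

lemma tail_bound (h : ℕ → ℝ) (B : ℝ) (hB : ∀ X, |∑ n ∈ range X, h n| ≤ B) (M : ℕ) (hM : 1 ≤ M) (k : ℕ) :
    |∑ n ∈ range (M + k), h n / n - ∑ n ∈ range M, h n / n| ≤ 2 * B / M := by
  rw [sum_range_add, add_sub_cancel_left]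
  have := abel_bound (fun i => ((M + i : ℕ):ℝ)⁻¹) (fun i => h (M + i)) (2 * B) ?_ ?_ ?_ k
  · simp only [smul_eq_mul, Real.norm_eq_abs, add_zero] at this
    rw [div_eq_mul_inv (2 * B)]
    convert this using 3
    ring
  · intro i j hij
    have : (0:ℝ) < ((M + i : ℕ) : ℝ) := by exact_mod_cast (by omega)
    have : ((M + i : ℕ) : ℝ) ≤ ((M + j : ℕ) : ℝ) := by exact_mod_cast (by omega)
    show ((M + j : ℕ):ℝ)⁻¹ ≤ ((M + i : ℕ):ℝ)⁻¹
    gcongr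
  · intro n; positivity
  · intro n
    have h1 : ∑ i ∈ range n, h (M + i) = ∑ i ∈ range (M + n), h i - ∑ i ∈ range M, h i := by
      rw [sum_range_add]; ring
    rw [h1, Real.norm_eq_abs]
    calc _ ≤ _ := abs_sub _ _
      _ ≤ B + B := add_le_add (hB _) (hB _)
      _ = _ := by ring

lemma exT (h : ℕ → ℝ) (B : ℝ) (hB : ∀ X, |∑ n ∈ range X, h n| ≤ B) :
    ∃ t, HasT h t ∧ ∀ M : ℕ, 1 ≤ M → |t - ∑ n ∈ range M, h n / n| ≤ 2 * B / M := by
  have hc : CauchySeq (fun N : ℕ => ∑ n ∈ range N, h n / n) := by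
    rw [Metric.cauchySeq_iff']
    intro ε hε
    have h1 : Tendsto (fun M : ℕ => 2 * B / M) atTop (𝓝 0) := tendsto_const_div_atTop_nhds_zero_nat _
    obtain ⟨M, hM1, hM2⟩ := ((h1.eventually_lt_const hε).and (eventually_ge_atTop 1)).exists
    refine ⟨M, fun n hn => ?_⟩
    obtain ⟨k, rfl⟩ := Nat.exists_eq_add_of_le hn
    rw [Real.dist_eq]
    exact (tail_bound h B hB M hM2 k).trans_lt hM1
  obtain ⟨t, ht⟩ := cauchySeq_tendsto_of_complete hc
  refine ⟨t, ht, fun M hM => ?_⟩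
  have h2 : Tendsto (fun N : ℕ => |∑ n ∈ range N, h n / n - ∑ n ∈ range M, h n / n|) atTop
      (𝓝 |t - ∑ n ∈ range M, h n / n|) := (ht.sub_const _).abs
  refine le_of_tendsto h2 ?_
  filter_upwards [eventually_ge_atTop M] with n hn
  obtain ⟨k, rfl⟩ := Nat.exists_eq_add_of_le hn
  exact tail_bound h B hB M hM k

lemma HasT.add {f g : ℕ → ℝ} {a b : ℝ} (hf : HasT f a) (hg : HasT g b) : HasT (fun n => f n + g n) (a + b) := by
  unfold HasT at *
  simpa [add_div, sum_add_distrib] using Tendsto.add hf hg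

lemma HasT.mul {f : ℕ → ℝ} {a : ℝ} (c : ℝ) (hf : HasT f a) : HasT (fun n => c * f n) (c * a) := by
  unfold HasT at *
  simpa [mul_div_assoc, mul_sum] using Tendsto.const_mul c hf

lemma HasT.sum {ι : Type*} (s : Finset ι) {f : ι → ℕ → ℝ} {a : ι → ℝ} (hf : ∀ i ∈ s, HasT (f i) (a i)) :
    HasT (fun n => ∑ i ∈ s, f i n) (∑ i ∈ s, a i) := by
  unfold HasT at *
  have := tendsto_finsetSum s hf
  refine this.congr fun N => ?_
  rw [sum_comm]
  simp only [sum_div]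

lemma HasT.congr {f g : ℕ → ℝ} {a : ℝ} (hf : HasT f a) (h : ∀ n, f n = g n) : HasT g a := by
  have : f = g := funext h
  rwa [← this]

lemma HasT.unique {f : ℕ → ℝ} {a b : ℝ} (hf : HasT f a) (hg : HasT f b) : a = b := tendsto_nhds_unique hf hg

section saw
open Complex

lemma one_sub_exp (x : ℝ) : 1 - cexp (2 * π * x * I) = ((2 * Real.sin (π * x) : ℝ) : ℂ) *
    (Complex.cos ((π * x - π / 2 : ℝ)) + Complex.sin ((π * x - π / 2 : ℝ)) * I) := by
  have e1 : Complex.cos ((π * x - π / 2 : ℝ)) = ((Real.sin (π * x) : ℝ) : ℂ) := by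
    rw [← Complex.ofReal_cos, Real.cos_sub_pi_div_two]
  have e2 : Complex.sin ((π * x - π / 2 : ℝ)) = -((Real.cos (π * x) : ℝ) : ℂ) := by
    rw [← Complex.ofReal_sin, Real.sin_sub_pi_div_two]; push_cast; rfl
  rw [e1, e2, show (2 * π * x * I : ℂ) = ((2 * (π * x) : ℝ) : ℂ) * I by push_cast; ring, Complex.exp_mul_I,
    ← Complex.ofReal_cos, ← Complex.ofReal_sin, Real.cos_two_mul, Real.sin_two_mul]
  have := Real.sin_sq_add_cos_sq (π * x)
  have h2 : ((Real.sin (π * x) : ℝ) : ℂ)^2 + ((Real.cos (π * x) : ℝ) : ℂ)^2 = 1 := by exact_mod_cast this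
  push_cast at h2 ⊢
  linear_combination (-2 : ℂ) * h2

lemma saw (x : ℝ) (h0 : 0 < x) (h1 : x < 1) : HasT (fun n => Real.sin (2 * π * n * x)) (π * (1/2 - x)) := by
  set z : ℂ := cexp (2 * π * x * I) with hz
  have hs : 0 < Real.sin (π * x) := Real.sin_pos_of_pos_of_lt_pi (by positivity) (by nlinarith [Real.pi_pos])
  have harg : arg (1 - z) = π * x - π / 2 := by
    rw [hz, one_sub_exp, Complex.arg_mul_cos_add_sin_mul_I (by positivity)]
    constructor <;> nlinarith [Real.pi_pos]
  have hre : (1 - z).re = 2 * Real.sin (π * x) * Real.sin (π * x) := by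
    rw [hz, one_sub_exp, re_ofReal_mul, ← Complex.ofReal_cos, ← Complex.ofReal_sin, Real.cos_sub_pi_div_two,
      add_re, ofReal_re, re_ofReal_mul, I_re]
    ring
  have hre0 : 0 < (1 - z).re := by rw [hre]; positivity
  have hz1 : 1 - z ≠ 0 := by intro h; rw [h] at hre0; simp at hre0
  have hnz : ‖z‖ = 1 := by
    rw [hz, show (2 * π * x * I : ℂ) = ((2 * π * x : ℝ) : ℂ) * I by push_cast; ring, Complex.norm_exp_ofReal_mul_I]
  have hb : ∀ n, ‖∑ i ∈ range n, z ^ (i+1)‖ ≤ 2 / ‖1 - z‖ := by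
    intro n
    rw [le_div_iff₀ (norm_pos_iff.mpr hz1), ← norm_mul]
    have : (∑ i ∈ range n, z ^ (i+1)) * (1 - z) = z - z ^ (n+1) := by
      have := geom_sum_mul_neg z n
      simp only [pow_succ, ← sum_mul]
      linear_combination z * this
    rw [this]
    refine (norm_sub_le _ _).trans ?_
    rw [norm_pow, hnz]; norm_num
  have hanti : Antitone (fun i : ℕ => ((i:ℝ) + 1)⁻¹) := by
    intro i j hij
    have : (i:ℝ) ≤ j := by exact_mod_cast hij
    show ((j:ℝ)+1)⁻¹ ≤ ((i:ℝ)+1)⁻¹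
    gcongr
  have hlim0 : Tendsto (fun i : ℕ => ((i:ℝ) + 1)⁻¹) atTop (𝓝 0) := by
    simpa [one_div] using tendsto_one_div_add_atTop_nhds_zero_nat (𝕜 := ℝ)
  obtain ⟨l, hl⟩ := cauchySeq_tendsto_of_complete
    (hanti.cauchySeq_series_mul_of_tendsto_zero_of_bounded hlim0 hb)
  have hab := Complex.tendsto_tsum_powerSeries_nhdsWithin_lt hl
  rw [tendsto_map'_iff] at hab
  have hid : Tendsto (fun r : ℝ => (r:ℂ)) (𝓝[<] 1) (𝓝 1) := by
    have : Tendsto (fun r : ℝ => (r:ℂ)) (𝓝 1) (𝓝 ((1:ℝ):ℂ)) := Complex.continuous_ofReal.tendsto 1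
    simpa using this.mono_left nhdsWithin_le_nhds
  have hab2 := hid.mul hab
  have hlog : Tendsto (fun r : ℝ => -Complex.log (1 - r * z)) (𝓝[<] 1) (𝓝 (-Complex.log (1 - z))) := by
    have hc : ContinuousAt (fun r : ℝ => -Complex.log (1 - r * z)) 1 := by
      refine (ContinuousAt.clog (by fun_prop) ?_).neg
      left; simpa using hre0
    have := hc.tendsto.mono_left (nhdsWithin_le_nhds (s := Set.Iio 1))
    simpa using this
  have heq : l = -Complex.log (1 - z) := by
    rw [one_mul] at hab2
    refine tendsto_nhds_unique (hab2.congr' ?_) hlog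
    have : Set.Ioo (0:ℝ) 1 ∈ 𝓝[<] (1:ℝ) := Ioo_mem_nhdsLT (by norm_num)
    filter_upwards [this] with r hr
    have hnr : ‖(r:ℂ) * z‖ < 1 := by
      rw [norm_mul, hnz, mul_one, Complex.norm_real, Real.norm_of_nonneg hr.1.le]; exact hr.2
    have ht := Complex.hasSum_taylorSeries_neg_log hnr
    rw [← ht.tsum_eq, ht.summable.tsum_eq_zero_add, Function.comp, ← tsum_mul_left]
    simp only [Nat.cast_zero, div_zero, zero_add]
    refine tsum_congr fun n => ?_
    simp only [real_smul]
    push_cast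
    rw [mul_pow]; field_simp; ring
  unfold HasT
  rw [← tendsto_add_atTop_iff_nat 1]
  have him := (Complex.continuous_im.tendsto l).comp hl
  have : l.im = π * (1/2 - x) := by
    rw [heq, Complex.neg_im, Complex.log_im, harg]; ring
  rw [this] at him
  refine him.congr fun N => ?_
  rw [sum_range_succ']
  simp only [Function.comp, Complex.im_sum, Nat.cast_zero, div_zero, add_zero]
  refine sum_congr rfl fun n _ => ?_
  rw [real_smul, im_ofReal_mul, hz, ← Complex.exp_nat_mul,
    show (((n+1:ℕ):ℂ) * (2 * π * x * I)) = ((2 * π * ((n+1 : ℕ):ℝ) * x : ℝ) : ℂ) * I by push_cast; ring,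
    Complex.exp_ofReal_mul_I_im]
  push_cast
  rw [div_eq_inv_mul]

end saw

lemma saw_neg (x : ℝ) (h0 : -1 < x) (h1 : x < 0) : HasT (fun n => Real.sin (2 * π * n * x)) (π * (-1/2 - x)) := by
  have := (saw (-x) (by linarith) (by linarith)).mul (-1)
  rw [show -1 * (π * (1/2 - -x)) = π * (-1/2 - x) by ring] at this
  refine this.congr fun n => ?_
  rw [mul_neg, Real.sin_neg]; ring

lemma key (p : ℕ) [Fact p.Prime] (hp : p ≠ 2) (α : ℝ) (h0 : 0 < α) (h1 : α < 1)
    (hne : ∀ a : ℕ, (a:ℝ) ≠ α * p) :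
    HasT (fun n => (legendreSym p n : ℝ) * ((GS.gval p).re * Real.sin (2 * π * n * α) +
      (GS.gval p).im * (1 - Real.cos (2 * π * n * α))))
      (π * ((∑ n ∈ Icc 1 ⌊α * (p : ℝ)⌋₊, legendreSym p (n : ℤ) : ℤ) : ℝ)) := by
  have hpp : p.Prime := Fact.out
  have hpR : (0:ℝ) < p := by exact_mod_cast hpp.pos
  have hχ0 : legendreSym p ((0:ℕ):ℤ) = 0 := by simp
  have hT : HasT (fun n => ∑ a ∈ range p, (legendreSym p (a:ℤ) : ℝ) *
      (Real.sin (2 * π * n * (α - a / p)) + Real.sin (2 * π * n * (a / p))))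
      (∑ a ∈ range p, (legendreSym p (a:ℤ) : ℝ) * (π * ((if (a:ℝ) < α * p then 1 else 0) - α))) := by
    apply HasT.sum
    intro a ha
    have hap : (a:ℝ) < p := by exact_mod_cast mem_range.mp ha
    rcases Nat.eq_zero_or_pos a with h | h
    · subst h
      rw [hχ0]
      simp [HasT]
    · have haR : (0:ℝ) < a := by exact_mod_cast h
      have hlt : (a:ℝ)/p < 1 := by rw [div_lt_one hpR]; exact hap
      have hgt : 0 < (a:ℝ)/p := by positivity
      apply HasT.mul
      have hs1 := saw (a/p) hgt hlt
      split_ifs with hc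
      · have h3 : (a:ℝ)/p < α := by rw [div_lt_iff₀ hpR]; exact hc
        have := (saw (α - a/p) (by linarith) (by linarith)).add hs1
        convert this using 1; ring
      · have hc : α * p < a := lt_of_le_of_ne (not_lt.mp hc) (hne a).symm
        have h3 : α < (a:ℝ)/p := by rw [lt_div_iff₀ hpR]; exact hc
        have := (saw_neg (α - a/p) (by linarith) (by linarith)).add hs1
        convert this using 1; ring
  have hval : (∑ a ∈ range p, (legendreSym p (a:ℤ) : ℝ) * (π * ((if (a:ℝ) < α * p then 1 else 0) - α))) =
      π * ((∑ n ∈ Icc 1 ⌊α * (p : ℝ)⌋₊, legendreSym p (n : ℤ) : ℤ) : ℝ) := by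
    have hs0 : ∑ a ∈ range p, (legendreSym p (a:ℤ) : ℝ) = 0 := by
      have := (GS.gauss_cs p hp 0).1
      simpa using this
    have e : ∀ a ∈ range p, (legendreSym p (a:ℤ) : ℝ) * (π * ((if (a:ℝ) < α * p then 1 else 0) - α)) =
        π * (if (a:ℝ) < α * p then (legendreSym p (a:ℤ) : ℝ) else 0) - π * α * (legendreSym p (a:ℤ) : ℝ) := by
      intro a _; split_ifs <;> ring
    rw [sum_congr rfl e, sum_sub_distrib, ← mul_sum, ← mul_sum, hs0, mul_zero, sub_zero, ← sum_filter]
    congr 1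
    push_cast
    symm
    apply sum_subset_zero_on_sdiff
    · intro n hn
      rw [mem_Icc] at hn
      have h5 : (n:ℝ) ≤ α * p := (Nat.le_floor_iff (by positivity)).mp hn.2
      have h6 : (n:ℝ) < α * p := lt_of_le_of_ne h5 (hne n)
      rw [mem_filter, mem_range]
      refine ⟨?_, h6⟩
      have : (n:ℝ) < p := by nlinarith
      exact_mod_cast this
    · intro n hn
      rw [Finset.mem_sdiff, mem_filter, mem_Icc] at hn
      have : n = 0 := by
        by_contra hn0
        exact hn.2 ⟨Nat.pos_of_ne_zero hn0, Nat.le_floor hn.1.2.le⟩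
      rw [this, hχ0]; simp
    · intros; rfl
  rw [← hval]
  refine hT.congr fun n => ?_
  obtain ⟨hc, hs⟩ := GS.gauss_cs p hp n
  have e : ∀ a ∈ range p, (legendreSym p (a:ℤ) : ℝ) *
      (Real.sin (2 * π * n * (α - a / p)) + Real.sin (2 * π * n * (a / p))) =
      Real.sin (2 * π * n * α) * ((legendreSym p (a:ℤ) : ℝ) * Real.cos (2 * π * (a * (n:ℤ)) / p)) +
      (1 - Real.cos (2 * π * n * α)) * ((legendreSym p (a:ℤ) : ℝ) * Real.sin (2 * π * (a * (n:ℤ)) / p)) := by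
    intro a _
    rw [show 2 * π * n * (α - a / p) = 2 * π * n * α - 2 * π * (a * (n:ℤ)) / p by push_cast; ring,
      show 2 * π * n * ((a:ℝ) / p) = 2 * π * (a * (n:ℤ)) / p by push_cast; ring, Real.sin_sub]
    ring
  rw [sum_congr rfl e, sum_add_distrib, ← mul_sum, ← mul_sum, hc, hs]
  ring

end LF
end

section
namespace LF
open Filter Topology Finset
open scoped Real

lemma sum_blocks (F : ℕ → ℝ) (k q r : ℕ) :
    ∑ n ∈ range (k * q + r), F n = ∑ c ∈ range k, ∑ j ∈ range q, F (c + k * j) + ∑ c ∈ range r, F (k * q + c) := by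
  rw [sum_range_add]
  congr 1
  induction q with
  | zero => simp
  | succ q ih =>
    rw [Nat.mul_succ, sum_range_add, ih, ← sum_add_distrib]
    refine sum_congr rfl fun c _ => ?_
    rw [sum_range_succ, add_comm c (k * q)]

lemma leg_abs_le (p : ℕ) [Fact p.Prime] (a : ℤ) : |(legendreSym p a : ℝ)| ≤ 1 := by
  rw [jacobiSym.legendreSym.to_jacobiSym]; exact PV.jacobi_abs_le a p

lemma persum (p : ℕ) [Fact p.Prime] (hp : p ≠ 2) (k : ℕ) (hk : 0 < k) (hpk : Nat.Coprime p k)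
    (g : ℕ → ℝ) (C : ℝ) (hg : ∀ n, |g n| ≤ C) (hper : ∀ n, g (n + k) = g n) (X : ℕ) :
    |∑ n ∈ range X, (legendreSym p n : ℝ) * g n| ≤ k * C * (√p * (1 + Real.log p) + 1) := by
  have hpp : p.Prime := Fact.out
  have hC : 0 ≤ C := (abs_nonneg _).trans (hg 0)
  have hgk : ∀ c j, g (c + k * j) = g c := by
    intro c j
    induction j with
    | zero => simp
    | succ j ih => rw [Nat.mul_succ, ← add_assoc, hper, ih]
  set P := √p * (1 + Real.log p) with hP
  have hP0 : 0 ≤ P := by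
    have : 0 ≤ Real.log p := Real.log_natCast_nonneg p
    positivity
  have hin : ∀ c q, |∑ j ∈ range q, (legendreSym p ((c + k * j : ℕ) : ℤ) : ℝ)| ≤ P := by
    intro c q
    have hkz : ((k : ℕ) : ZMod p) ≠ 0 := by
      rw [Ne, ZMod.natCast_eq_zero_iff]
      intro h
      have := Nat.Coprime.eq_one_of_dvd hpk h
      exact hpp.one_lt.ne' this
    have h1 := PV.polya_jacobi hpp.prime.irreducible.squarefree (hpp.odd_of_ne_two hp) hpp.one_lt ((c : ZMod p) * (k : ZMod p)⁻¹) q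
    have h2 : ∀ j : ℕ, ((legendreSym p ((c + k * j : ℕ) : ℤ) : ℝ) : ℂ) = PV.jf p (k : ZMod p) * PV.jf p ((j : ZMod p) + (c : ZMod p) * (k : ZMod p)⁻¹) := by
      intro j
      rw [← PV.jf_mul, show (k : ZMod p) * ((j : ZMod p) + (c : ZMod p) * (k : ZMod p)⁻¹) = ((c + k * j : ℕ) : ZMod p) by
        push_cast; field_simp; ring, PV.jf_nat, jacobiSym.legendreSym.to_jacobiSym]
      push_cast; rfl
    have h3 : ((∑ j ∈ range q, (legendreSym p ((c + k * j : ℕ) : ℤ) : ℝ) : ℝ) : ℂ) =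
        PV.jf p (k : ZMod p) * ∑ j ∈ range q, PV.jf p ((j : ZMod p) + (c : ZMod p) * (k : ZMod p)⁻¹) := by
      rw [mul_sum, Complex.ofReal_sum]
      exact sum_congr rfl fun j _ => h2 j
    rw [← Real.norm_eq_abs, ← Complex.norm_real, h3, norm_mul]
    calc _ ≤ 1 * P := mul_le_mul (PV.jf_norm_le _) h1 (norm_nonneg _) zero_le_one
      _ = P := one_mul _
  have hX : X = k * (X / k) + X % k := (Nat.div_add_mod X k).symm
  rw [hX, sum_blocks]
  refine (abs_add_le _ _).trans ?_
  have hA : |∑ c ∈ range k, ∑ j ∈ range (X / k), (legendreSym p ((c + k * j : ℕ):ℤ) : ℝ) * g (c + k * j)| ≤ k * (C * P) := by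
    refine (abs_sum_le_sum_abs _ _).trans ?_
    calc _ ≤ ∑ c ∈ range k, C * P := by
          refine sum_le_sum fun c _ => ?_
          simp only [hgk]
          rw [← sum_mul, abs_mul, mul_comm]
          exact mul_le_mul (hg _) (hin _ _) (abs_nonneg _) hC
      _ = _ := by simp
  have hBd : |∑ c ∈ range (X % k), (legendreSym p ((k * (X/k) + c : ℕ):ℤ) : ℝ) * g (k * (X/k) + c)| ≤ k * C := by
    refine (abs_sum_le_sum_abs _ _).trans ?_
    calc _ ≤ ∑ c ∈ range (X % k), C := by
          refine sum_le_sum fun c _ => ?_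
          rw [abs_mul]
          calc _ ≤ 1 * C := mul_le_mul (leg_abs_le p _) (hg _) (abs_nonneg _) zero_le_one
            _ = C := one_mul C
      _ = (X % k : ℕ) * C := by simp
      _ ≤ _ := by
        have : ((X % k : ℕ):ℝ) ≤ k := by exact_mod_cast (Nat.mod_lt X hk).le
        gcongr
  push_cast at hA hBd ⊢
  linarith

def D (d : ℕ) (ψ : ℕ → ℝ) (n : ℕ) : ℝ := if d ∣ n then ψ (n / d) else 0

lemma sum_D (d : ℕ) (hd : 0 < d) (F : ℕ → ℝ) (N : ℕ) :
    ∑ n ∈ range N, D d F n = ∑ m ∈ range ((N + d - 1) / d), F m := by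
  unfold D
  rw [← sum_filter]
  symm
  refine sum_bij (fun m _ => d * m) ?_ ?_ ?_ ?_
  · intro m hm
    rw [mem_range, Nat.lt_div_iff_mul_lt hd] at hm
    rw [mem_filter, mem_range]
    refine ⟨?_, dvd_mul_right _ _⟩
    have : m * d = d * m := mul_comm _ _
    omega
  · intro a _ b _ h
    exact Nat.eq_of_mul_eq_mul_left hd h
  · intro n hn
    rw [mem_filter, mem_range] at hn
    obtain ⟨m, rfl⟩ := hn.2
    refine ⟨m, ?_, rfl⟩
    rw [mem_range, Nat.lt_div_iff_mul_lt hd]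
    have : m * d = d * m := mul_comm _ _
    omega
  · intro m _
    rw [Nat.mul_div_cancel_left _ hd]

lemma HasT.D {χ ψ : ℕ → ℝ} (hχ : ∀ m n, χ (m * n) = χ m * χ n) {t : ℝ} (d : ℕ) (hd : 0 < d)
    (h : HasT (fun n => χ n * ψ n) t) : HasT (fun n => χ n * D d ψ n) (χ d / d * t) := by
  unfold HasT at *
  have hlim : Tendsto (fun N : ℕ => (N + d - 1) / d) atTop atTop := by
    refine tendsto_atTop.mpr fun b => ?_
    filter_upwards [eventually_ge_atTop (b * d)] with N hN
    rw [Nat.le_div_iff_mul_le hd]; omega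
  have := (h.comp hlim).const_mul (χ d / d)
  refine this.congr fun N => ?_
  simp only [Function.comp]
  rw [mul_sum, ← sum_D d hd]
  refine sum_congr rfl fun n _ => ?_
  unfold LF.D
  split_ifs with hdn
  · obtain ⟨m, rfl⟩ := hdn
    rw [Nat.mul_div_cancel_left _ hd, hχ]
    push_cast
    have : (d:ℝ) ≠ 0 := by exact_mod_cast hd.ne'
    field_simp
  · simp

lemma tsum_nonneg_of_mult (f : ℕ →*₀ ℝ) (hf : ∀ n, |f n| ≤ 1) (hs : Summable (fun n => ‖f n‖)) : 0 ≤ ∑' n, f n := by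
  have := EulerProduct.eulerProduct_completely_multiplicative_hasProd hs
  refine ge_of_tendsto' this fun s => ?_
  refine prod_nonneg fun p _ => inv_nonneg.mpr ?_
  have := (abs_le.mp (hf p)).2
  linarith

lemma nonneg (f : ℕ → ℝ) (f0 : f 0 = 0) (f1 : f 1 = 1) (fm : ∀ m n, f (m * n) = f m * f n)
    (hf : ∀ n, |f n| ≤ 1) (t : ℝ) (ht : HasT f t) : 0 ≤ t := by
  by_contra hneg
  push Not at hneg
  set G : ℕ → ℝ := fun N => ∑ n ∈ range N, f n / n with hG
  obtain ⟨N0, hN0⟩ := eventually_atTop.mp (ht.eventually_le_const (show t < t / 2 by linarith))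
  set w : ℝ → ℕ → ℝ := fun δ n => if n = 0 then 1 else (n:ℝ) ^ (-δ) with hw
  have hwanti : ∀ δ, 0 < δ → ∀ n, 0 ≤ w δ n - w δ (n+1) := by
    intro δ hδ n
    simp only [hw, Nat.succ_ne_zero, if_false]
    rcases Nat.eq_zero_or_pos n with h | h
    · subst h; simp
    · rw [if_neg h.ne', sub_nonneg]
      have : (0:ℝ) < n := by exact_mod_cast h
      apply Real.rpow_le_rpow_of_nonpos this (by push_cast; linarith) (by linarith)
  have hw0 : ∀ δ n, 0 ≤ w δ n := by
    intro δ n; simp only [hw]; split_ifs <;> positivity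
  have hmain : ∀ δ, 0 < δ → 0 ≤ t / 2 + ∑ i ∈ range N0, (w δ i - w δ (i+1)) * |G (i+1) - t/2| := by
    intro δ hδ
    let φ : ℕ →*₀ ℝ :=
      { toFun := fun n => f n * (n:ℝ) ^ (-(1+δ))
        map_zero' := by simp [f0]
        map_one' := by simp [f1]
        map_mul' := by
          intro m n
          rw [fm, Nat.cast_mul, Real.mul_rpow (by positivity) (by positivity)]; ring }
    have hφ : ∀ n, φ n = f n * (n:ℝ) ^ (-(1+δ)) := fun n => rfl
    have hsum1 : Summable (fun n : ℕ => (n:ℝ) ^ (-(1+δ))) := Real.summable_nat_rpow.mpr (by linarith)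
    have hle : ∀ n, |φ n| ≤ (n:ℝ) ^ (-(1+δ)) := by
      intro n
      rw [hφ, abs_mul, abs_of_nonneg (Real.rpow_nonneg (Nat.cast_nonneg n) _)]
      exact mul_le_of_le_one_left (by positivity) (hf n)
    have hs : Summable (fun n => ‖φ n‖) := Summable.of_nonneg_of_le (fun _ => norm_nonneg _) hle hsum1
    have h1 := tsum_nonneg_of_mult φ (by
      intro n
      refine (hle n).trans ?_
      rcases Nat.eq_zero_or_pos n with h | h
      · subst h
        rw [Nat.cast_zero, Real.zero_rpow (by linarith)]; norm_num
      · exact Real.rpow_le_one_of_one_le_of_nonpos (by exact_mod_cast h) (by linarith)) hs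
    have h2 := hs.of_norm.hasSum.tendsto_sum_nat
    have h3 : ∀ N, N0 ≤ N → ∑ n ∈ range N, φ n ≤ t / 2 + ∑ i ∈ range N0, (w δ i - w δ (i+1)) * |G (i+1) - t/2| := by
      intro N hN
      have e : ∑ n ∈ range N, φ n = ∑ n ∈ range N, w δ n • (f n / n) := by
        refine sum_congr rfl fun n _ => ?_
        rw [hφ, smul_eq_mul]
        rcases Nat.eq_zero_or_pos n with h | h
        · subst h; simp [f0]
        · have hn : (0:ℝ) < n := by exact_mod_cast h
          simp only [hw, if_neg h.ne']
          rw [neg_add, Real.rpow_add hn, Real.rpow_neg_one]; ring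
      rw [e, abel_id]
      set v : ℕ → ℝ := fun i => w δ i - w δ (i+1) with hv
      have hv0 : ∀ i, 0 ≤ v i := hwanti δ hδ
      have hGb : ∀ m, G m ≤ t/2 + (if m < N0 + 1 then |G m - t/2| else 0) := by
        intro m
        split_ifs with hm
        · linarith [le_abs_self (G m - t/2)]
        · rw [add_zero]; exact hN0 m (by omega)
      have hvs : ∑ i ∈ range N, v i = w δ 0 - w δ N := sum_range_sub' _ _
      have hw00 : w δ 0 = 1 := by simp [hw]
      have hA : ∑ i ∈ range N, v i * G (i+1) ≤ (1 - w δ N) * (t/2) + ∑ i ∈ range N, (if i < N0 then v i * |G (i+1) - t/2| else 0) := by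
        rw [← hw00, ← hvs, sum_mul, ← sum_add_distrib]
        refine sum_le_sum fun i _ => ?_
        have := mul_le_mul_of_nonneg_left (hGb (i+1)) (hv0 i)
        refine this.trans (le_of_eq ?_)
        by_cases hi : i < N0
        · rw [if_pos hi, if_pos (by omega)]; ring
        · rw [if_neg hi, if_neg (by omega)]; ring
      have hB : w δ N * G N ≤ w δ N * (t/2) := mul_le_mul_of_nonneg_left (hN0 N hN) (hw0 δ N)
      have hC : ∑ i ∈ range N, (if i < N0 then v i * |G (i+1) - t/2| else 0) = ∑ i ∈ range N0, v i * |G (i+1) - t/2| := by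
        rw [← sum_filter]
        congr 1
        ext i; simp; omega
      rw [hC] at hA
      simp only [smul_eq_mul]
      show w δ N * G N + ∑ i ∈ range N, v i * G (i+1) ≤ _
      linarith
    exact h1.trans (le_of_tendsto h2 ((eventually_ge_atTop N0).mono h3))
  have hlim : Tendsto (fun δ => t / 2 + ∑ i ∈ range N0, (w δ i - w δ (i+1)) * |G (i+1) - t/2|) (𝓝[>] 0)
      (𝓝 (t/2 + ∑ i ∈ range N0, (1 - 1) * |G (i+1) - t/2|)) := by
    have hwl : ∀ n, Tendsto (fun δ => w δ n) (𝓝[>] 0) (𝓝 1) := by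
      intro n
      simp only [hw]
      split_ifs with h
      · exact tendsto_const_nhds
      · have hn : (n:ℝ) ≠ 0 := by exact_mod_cast h
        have hc : Continuous (fun δ : ℝ => (n:ℝ) ^ (-δ)) := by
          exact Continuous.rpow continuous_const continuous_neg (fun _ => Or.inl hn)
        have := (hc.tendsto 0).mono_left (nhdsWithin_le_nhds (s := Set.Ioi 0))
        simpa using this
    exact (tendsto_finsetSum _ fun i _ => ((hwl i).sub (hwl (i+1))).mul_const _).const_add _
  have h5 : 0 ≤ t/2 + ∑ i ∈ range N0, (1 - 1) * |G (i+1) - t/2| := by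
    refine ge_of_tendsto hlim ?_
    filter_upwards [self_mem_nhdsWithin] with δ hδ using hmain δ hδ
  simp at h5
  linarith

end LF
end

section
namespace LF
open Filter Topology Finset
open scoped Real

/-- the sum in the statement, for a prime -/
noncomputable def LL (p : ℕ) [Fact p.Prime] (α : ℝ) : ℤ := ∑ n ∈ Icc 1 ⌊α * (p : ℝ)⌋₊, legendreSym p (n : ℤ)

noncomputable def chi (p : ℕ) [Fact p.Prime] (n : ℕ) : ℝ := (legendreSym p (n : ℤ) : ℝ)

section
variable (p : ℕ) [Fact p.Prime]

lemma chi_mul (m n : ℕ) : chi p (m * n) = chi p m * chi p n := by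
  unfold chi; push_cast; rw [legendreSym.mul]; push_cast; rfl
lemma chi_zero : chi p 0 = 0 := by simp [chi]
lemma chi_one : chi p 1 = 1 := by simp [chi]
lemma chi_abs (n : ℕ) : |chi p n| ≤ 1 := leg_abs_le p n
lemma chi_sq (n : ℕ) (h : Nat.Coprime p n) : chi p n = 1 ∨ chi p n = -1 := by
  unfold chi
  have h0 : ((n : ℤ) : ZMod p) ≠ 0 := by
    have hpp : p.Prime := Fact.out
    push_cast
    rw [Ne, ZMod.natCast_eq_zero_iff]
    intro hd
    exact hpp.one_lt.ne' (Nat.Coprime.eq_one_of_dvd h hd)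
  rcases legendreSym.eq_one_or_neg_one p h0 with h | h <;> rw [h] <;> simp

lemma ne_int {b k : ℕ} (hb : 0 < b) (hbk : b < k) (hpk : Nat.Coprime p k) (a : ℕ) :
    (a:ℝ) ≠ ((b:ℝ) / k) * p := by
  have hpp : p.Prime := Fact.out
  intro h
  have hk : (k:ℝ) ≠ 0 := by
    have : 0 < k := by omega
    exact_mod_cast this.ne'
  field_simp at h
  have h2 : a * k = b * p := by exact_mod_cast h
  have h3 : p ∣ a := hpk.dvd_of_dvd_mul_right (Dvd.intro_left b h2.symm)
  have h4 : 0 < b * p := Nat.mul_pos hb hpp.pos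
  rcases Nat.eq_zero_or_pos a with h5 | h5
  · subst h5; omega
  · have := Nat.le_of_dvd h5 h3
    have h6 : b * p < k * p := Nat.mul_lt_mul_of_pos_right hbk hpp.pos
    have h7 : p * k ≤ a * k := Nat.mul_le_mul_right k this
    have : p * k = k * p := mul_comm _ _
    omega

lemma T1 (hp1 : p % 4 = 1) {b k : ℕ} (hb : 0 < b) (hbk : b < k) (hpk : Nat.Coprime p k) :
    ∃ c : ℝ, 0 < c ∧ HasT (fun n => chi p n * Real.sin (2 * π * n * ((b:ℝ)/k))) (c * (LL p ((b:ℝ)/k) : ℝ)) := by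
  have hpp : p.Prime := Fact.out
  have hpR : (0:ℝ) < √p := Real.sqrt_pos.mpr (by exact_mod_cast hpp.pos)
  have hk : (0:ℝ) < k := by exact_mod_cast (by omega)
  have hbR : (0:ℝ) < b := by exact_mod_cast hb
  have hbkR : (b:ℝ) < k := by exact_mod_cast hbk
  have := key p (by intro h; subst h; omega) ((b:ℝ)/k) (by positivity) (by rw [div_lt_one hk]; exact hbkR) (ne_int p hb hbk hpk)
  refine ⟨π / √p, by positivity, ?_⟩
  rw [(GS.gval1 p hp1).1, (GS.gval1 p hp1).2] at this
  have h2 := this.mul (1/√p)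
  rw [show π / √p * (LL p ((b:ℝ)/k) : ℝ) = 1/√p * (π * (LL p ((b:ℝ)/k) : ℝ)) by ring]
  refine h2.congr fun n => ?_
  unfold chi
  field_simp
  ring

lemma T3 (hp1 : p % 4 = 3) {b k : ℕ} (hb : 0 < b) (hbk : b < k) (hpk : Nat.Coprime p k) :
    ∃ c : ℝ, 0 < c ∧ HasT (fun n => chi p n * (1 - Real.cos (2 * π * n * ((b:ℝ)/k)))) (c * (LL p ((b:ℝ)/k) : ℝ)) := by
  have hpp : p.Prime := Fact.out
  have hpR : (0:ℝ) < √p := Real.sqrt_pos.mpr (by exact_mod_cast hpp.pos)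
  have hk : (0:ℝ) < k := by exact_mod_cast (by omega)
  have hbR : (0:ℝ) < b := by exact_mod_cast hb
  have hbkR : (b:ℝ) < k := by exact_mod_cast hbk
  have := key p (by intro h; subst h; omega) ((b:ℝ)/k) (by positivity) (by rw [div_lt_one hk]; exact hbkR) (ne_int p hb hbk hpk)
  refine ⟨π / √p, by positivity, ?_⟩
  rw [(GS.gval3 p hp1).1, (GS.gval3 p hp1).2] at this
  have h2 := this.mul (1/√p)
  rw [show π / √p * (LL p ((b:ℝ)/k) : ℝ) = 1/√p * (π * (LL p ((b:ℝ)/k) : ℝ)) by ring]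
  refine h2.congr fun n => ?_
  unfold chi
  field_simp
  ring

lemma nonneg1 (hp1 : p % 4 = 1) {b k : ℕ} (hb : 0 < b) (hbk : b < k) (hpk : Nat.Coprime p k)
    {t : ℝ} (h : HasT (fun n => chi p n * Real.sin (2 * π * n * ((b:ℝ)/k))) t) (ht : 0 ≤ t) : 0 ≤ LL p ((b:ℝ)/k) := by
  obtain ⟨c, hc, h2⟩ := T1 p hp1 hb hbk hpk
  have := h.unique h2
  rw [this] at ht
  have := nonneg_of_mul_nonneg_right ht hc
  exact_mod_cast this

lemma nonneg3 (hp1 : p % 4 = 3) {b k : ℕ} (hb : 0 < b) (hbk : b < k) (hpk : Nat.Coprime p k)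
    {t : ℝ} (h : HasT (fun n => chi p n * (1 - Real.cos (2 * π * n * ((b:ℝ)/k)))) t) (ht : 0 ≤ t) : 0 ≤ LL p ((b:ℝ)/k) := by
  obtain ⟨c, hc, h2⟩ := T3 p hp1 hb hbk hpk
  have := h.unique h2
  rw [this] at ht
  have := nonneg_of_mul_nonneg_right ht hc
  exact_mod_cast this

lemma exTpos (hp : p ≠ 2) {k : ℕ} (hk : 0 < k) (hpk : Nat.Coprime p k) (ψ : ℕ → ℝ) (h1 : ψ 1 = 1)
    (hm : ∀ m n, ψ (m * n) = ψ m * ψ n) (hb : ∀ n, |ψ n| ≤ 1) (hper : ∀ n, ψ (n + k) = ψ n) :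
    ∃ t, 0 ≤ t ∧ HasT (fun n => chi p n * ψ n) t := by
  obtain ⟨t, ht, -⟩ := exT (fun n => chi p n * ψ n) _ (persum p hp k hk hpk ψ 1 hb hper)
  refine ⟨t, nonneg _ ?_ ?_ ?_ ?_ t ht, ht⟩
  · simp [chi_zero]
  · simp [chi_one, h1]
  · intro m n; rw [chi_mul, hm]; ring
  · intro n
    rw [abs_mul]
    exact mul_le_one₀ (chi_abs p n) (abs_nonneg _) (hb n)

/-- real function attached to an integer valued character -/
def cR {k : ℕ} (ψ : MulChar (ZMod k) ℤ) (n : ℕ) : ℝ := ((ψ (n : ZMod k) : ℤ) : ℝ)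

lemma exTc (hp : p ≠ 2) {k : ℕ} (hk : 0 < k) (hpk : Nat.Coprime p k) (ψ : MulChar (ZMod k) ℤ)
    (hb : ∀ x, |ψ x| ≤ 1) : ∃ t, 0 ≤ t ∧ HasT (fun n => chi p n * cR ψ n) t := by
  apply exTpos p hp hk hpk
  · simp [cR]
  · intro m n; simp [cR]
  · intro n; unfold cR; exact_mod_cast hb n
  · intro n; simp [cR]

lemma exTone (hp : p ≠ 2) : ∃ t, 0 ≤ t ∧ HasT (fun n => chi p n * 1) t :=
  exTpos p hp (k := 1) one_pos (by simp) (fun _ => 1) rfl (by simp) (by simp) (by simp)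

end

lemma per_ext {f g : ℕ → ℝ} (k : ℕ) (hk : 0 < k) (hf : ∀ n, f (n + k) = f n) (hg : ∀ n, g (n + k) = g n)
    (h : ∀ r, r < k → f r = g r) (n : ℕ) : f n = g n := by
  have aux : ∀ f : ℕ → ℝ, (∀ n, f (n + k) = f n) → ∀ n, f n = f (n % k) := by
    intro f hf n
    have : ∀ q r, f (r + k * q) = f r := by
      intro q r
      induction q with
      | zero => simp
      | succ q ih => rw [Nat.mul_succ, ← add_assoc, hf, ih]
    conv_lhs => rw [← Nat.mod_add_div n k]
    exact this _ _
  rw [aux f hf, aux g hg]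
  exact h _ (Nat.mod_lt _ hk)

lemma D_per {d m : ℕ} (hd : 0 < d) {ψ : ℕ → ℝ} (hψ : ∀ n, ψ (n + m) = ψ n) (n : ℕ) : D d ψ (n + d * m) = D d ψ n := by
  unfold D
  have : d ∣ n + d * m ↔ d ∣ n := (Nat.dvd_add_left (dvd_mul_right d m))
  simp only [this]
  split_ifs with h
  · rw [Nat.add_mul_div_left _ _ hd, hψ]
  · rfl

lemma cR_per {k : ℕ} (ψ : MulChar (ZMod k) ℤ) (q : ℕ) (n : ℕ) : cR ψ (n + k * q) = cR ψ n := by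
  simp [cR]

lemma sin_per (b k : ℕ) (hk : 0 < k) (n : ℕ) :
    Real.sin (2 * π * ((n + k : ℕ) : ℝ) * ((b:ℝ)/k)) = Real.sin (2 * π * n * ((b:ℝ)/k)) := by
  have : (k:ℝ) ≠ 0 := by exact_mod_cast hk.ne'
  rw [show 2 * π * ((n + k : ℕ) : ℝ) * ((b:ℝ)/k) = 2 * π * n * ((b:ℝ)/k) + b * (2 * π) by push_cast; field_simp,
    Real.sin_add_nat_mul_two_pi]

lemma cos_per (b k : ℕ) (hk : 0 < k) (n : ℕ) :
    Real.cos (2 * π * ((n + k : ℕ) : ℝ) * ((b:ℝ)/k)) = Real.cos (2 * π * n * ((b:ℝ)/k)) := by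
  have : (k:ℝ) ≠ 0 := by exact_mod_cast hk.ne'
  rw [show 2 * π * ((n + k : ℕ) : ℝ) * ((b:ℝ)/k) = 2 * π * n * ((b:ℝ)/k) + b * (2 * π) by push_cast; field_simp,
    Real.cos_add_nat_mul_two_pi]

end LF
end

section
namespace LF
set_option linter.unusedSimpArgs false
set_option linter.unusedTactic false
set_option linter.unreachableTactic false
open Filter Topology Finset
open scoped Real

noncomputable def SN (b k n : ℕ) : ℝ := Real.sin (2 * π * n * ((b:ℝ)/k))
noncomputable def CN (b k n : ℕ) : ℝ := 1 - Real.cos (2 * π * n * ((b:ℝ)/k))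

lemma SN_rec (b k n : ℕ) : SN b k (n+2) = 2 * (1 - CN b k 1) * SN b k (n+1) - SN b k n := by
  unfold SN CN
  set x := (b:ℝ)/k
  have h := Real.sin_add (2 * π * ((n+1:ℕ):ℝ) * x) (2 * π * ((1:ℕ):ℝ) * x)
  have h' := Real.sin_sub (2 * π * ((n+1:ℕ):ℝ) * x) (2 * π * ((1:ℕ):ℝ) * x)
  rw [show 2 * π * ((n+1:ℕ):ℝ) * x + 2 * π * ((1:ℕ):ℝ) * x = 2 * π * ((n+2:ℕ):ℝ) * x by push_cast; ring] at h
  rw [show 2 * π * ((n+1:ℕ):ℝ) * x - 2 * π * ((1:ℕ):ℝ) * x = 2 * π * (n:ℝ) * x by push_cast; ring] at h'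
  rw [h, h']; ring

lemma CN_rec (b k n : ℕ) : CN b k (n+2) = 1 - (2 * (1 - CN b k 1) * (1 - CN b k (n+1)) - (1 - CN b k n)) := by
  unfold CN
  set x := (b:ℝ)/k
  have h := Real.cos_add (2 * π * ((n+1:ℕ):ℝ) * x) (2 * π * ((1:ℕ):ℝ) * x)
  have h' := Real.cos_sub (2 * π * ((n+1:ℕ):ℝ) * x) (2 * π * ((1:ℕ):ℝ) * x)
  rw [show 2 * π * ((n+1:ℕ):ℝ) * x + 2 * π * ((1:ℕ):ℝ) * x = 2 * π * ((n+2:ℕ):ℝ) * x by push_cast; ring] at h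
  rw [show 2 * π * ((n+1:ℕ):ℝ) * x - 2 * π * ((1:ℕ):ℝ) * x = 2 * π * (n:ℝ) * x by push_cast; ring] at h'
  rw [h, h']; ring

lemma SN_zero (b k : ℕ) : SN b k 0 = 0 := by simp [SN]
lemma CN_zero (b k : ℕ) : CN b k 0 = 0 := by simp [CN]
lemma SN_per (b k : ℕ) (hk : 0 < k) (n : ℕ) : SN b k (n + k) = SN b k n := sin_per b k hk n
lemma CN_per (b k : ℕ) (hk : 0 < k) (n : ℕ) : CN b k (n + k) = CN b k n := by
  unfold CN; rw [cos_per b k hk n]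

instance fact5 : Fact (Nat.Prime 5) := ⟨by norm_num⟩

abbrev ψ3 : MulChar (ZMod 3) ℤ := quadraticChar (ZMod 3)
abbrev ψ5 : MulChar (ZMod 5) ℤ := quadraticChar (ZMod 5)

lemma v3_0 : cR ψ3 0 = 0 := by
  have : ψ3 ((0:ℕ):ZMod 3) = 0 := by decide
  simp only [cR, this]; norm_num
lemma v3_1 : cR ψ3 1 = 1 := by
  have : ψ3 ((1:ℕ):ZMod 3) = 1 := by decide
  simp only [cR, this]; norm_num
lemma v3_2 : cR ψ3 2 = -1 := by
  have : ψ3 ((2:ℕ):ZMod 3) = -1 := by decide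
  simp only [cR, this]; norm_num
lemma v3_3 : cR ψ3 3 = 0 := by
  have : ψ3 ((3:ℕ):ZMod 3) = 0 := by decide
  simp only [cR, this]; norm_num
lemma v3_4 : cR ψ3 4 = 1 := by
  have : ψ3 ((4:ℕ):ZMod 3) = 1 := by decide
  simp only [cR, this]; norm_num
lemma v3_5 : cR ψ3 5 = -1 := by
  have : ψ3 ((5:ℕ):ZMod 3) = -1 := by decide
  simp only [cR, this]; norm_num
lemma v3_6 : cR ψ3 6 = 0 := by
  have : ψ3 ((6:ℕ):ZMod 3) = 0 := by decide
  simp only [cR, this]; norm_num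
lemma v3_7 : cR ψ3 7 = 1 := by
  have : ψ3 ((7:ℕ):ZMod 3) = 1 := by decide
  simp only [cR, this]; norm_num
lemma v3_8 : cR ψ3 8 = -1 := by
  have : ψ3 ((8:ℕ):ZMod 3) = -1 := by decide
  simp only [cR, this]; norm_num
lemma v3_9 : cR ψ3 9 = 0 := by
  have : ψ3 ((9:ℕ):ZMod 3) = 0 := by decide
  simp only [cR, this]; norm_num
lemma v3_10 : cR ψ3 10 = 1 := by
  have : ψ3 ((10:ℕ):ZMod 3) = 1 := by decide
  simp only [cR, this]; norm_num
lemma v3_11 : cR ψ3 11 = -1 := by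
  have : ψ3 ((11:ℕ):ZMod 3) = -1 := by decide
  simp only [cR, this]; norm_num
lemma v3_r (n : ℕ) : cR ψ3 (n+3) = cR ψ3 n := cR_per ψ3 1 n
lemma v4_0 : cR ZMod.χ₄ 0 = 0 := by
  have : ZMod.χ₄ ((0:ℕ):ZMod 4) = 0 := by decide
  simp only [cR, this]; norm_num
lemma v4_1 : cR ZMod.χ₄ 1 = 1 := by
  have : ZMod.χ₄ ((1:ℕ):ZMod 4) = 1 := by decide
  simp only [cR, this]; norm_num
lemma v4_2 : cR ZMod.χ₄ 2 = 0 := by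
  have : ZMod.χ₄ ((2:ℕ):ZMod 4) = 0 := by decide
  simp only [cR, this]; norm_num
lemma v4_3 : cR ZMod.χ₄ 3 = -1 := by
  have : ZMod.χ₄ ((3:ℕ):ZMod 4) = -1 := by decide
  simp only [cR, this]; norm_num
lemma v4_4 : cR ZMod.χ₄ 4 = 0 := by
  have : ZMod.χ₄ ((4:ℕ):ZMod 4) = 0 := by decide
  simp only [cR, this]; norm_num
lemma v4_5 : cR ZMod.χ₄ 5 = 1 := by
  have : ZMod.χ₄ ((5:ℕ):ZMod 4) = 1 := by decide
  simp only [cR, this]; norm_num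
lemma v4_6 : cR ZMod.χ₄ 6 = 0 := by
  have : ZMod.χ₄ ((6:ℕ):ZMod 4) = 0 := by decide
  simp only [cR, this]; norm_num
lemma v4_7 : cR ZMod.χ₄ 7 = -1 := by
  have : ZMod.χ₄ ((7:ℕ):ZMod 4) = -1 := by decide
  simp only [cR, this]; norm_num
lemma v4_8 : cR ZMod.χ₄ 8 = 0 := by
  have : ZMod.χ₄ ((8:ℕ):ZMod 4) = 0 := by decide
  simp only [cR, this]; norm_num
lemma v4_9 : cR ZMod.χ₄ 9 = 1 := by
  have : ZMod.χ₄ ((9:ℕ):ZMod 4) = 1 := by decide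
  simp only [cR, this]; norm_num
lemma v4_10 : cR ZMod.χ₄ 10 = 0 := by
  have : ZMod.χ₄ ((10:ℕ):ZMod 4) = 0 := by decide
  simp only [cR, this]; norm_num
lemma v4_11 : cR ZMod.χ₄ 11 = -1 := by
  have : ZMod.χ₄ ((11:ℕ):ZMod 4) = -1 := by decide
  simp only [cR, this]; norm_num
lemma v4_r (n : ℕ) : cR ZMod.χ₄ (n+4) = cR ZMod.χ₄ n := cR_per ZMod.χ₄ 1 n
lemma v5_0 : cR ψ5 0 = 0 := by
  have : ψ5 ((0:ℕ):ZMod 5) = 0 := by decide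
  simp only [cR, this]; norm_num
lemma v5_1 : cR ψ5 1 = 1 := by
  have : ψ5 ((1:ℕ):ZMod 5) = 1 := by decide
  simp only [cR, this]; norm_num
lemma v5_2 : cR ψ5 2 = -1 := by
  have : ψ5 ((2:ℕ):ZMod 5) = -1 := by decide
  simp only [cR, this]; norm_num
lemma v5_3 : cR ψ5 3 = -1 := by
  have : ψ5 ((3:ℕ):ZMod 5) = -1 := by decide
  simp only [cR, this]; norm_num
lemma v5_4 : cR ψ5 4 = 1 := by
  have : ψ5 ((4:ℕ):ZMod 5) = 1 := by decide
  simp only [cR, this]; norm_num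
lemma v5_r (n : ℕ) : cR ψ5 (n+5) = cR ψ5 n := cR_per ψ5 1 n
lemma v8_0 : cR ZMod.χ₈ 0 = 0 := by
  have : ZMod.χ₈ ((0:ℕ):ZMod 8) = 0 := by decide
  simp only [cR, this]; norm_num
lemma v8_1 : cR ZMod.χ₈ 1 = 1 := by
  have : ZMod.χ₈ ((1:ℕ):ZMod 8) = 1 := by decide
  simp only [cR, this]; norm_num
lemma v8_2 : cR ZMod.χ₈ 2 = 0 := by
  have : ZMod.χ₈ ((2:ℕ):ZMod 8) = 0 := by decide
  simp only [cR, this]; norm_num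
lemma v8_3 : cR ZMod.χ₈ 3 = -1 := by
  have : ZMod.χ₈ ((3:ℕ):ZMod 8) = -1 := by decide
  simp only [cR, this]; norm_num
lemma v8_4 : cR ZMod.χ₈ 4 = 0 := by
  have : ZMod.χ₈ ((4:ℕ):ZMod 8) = 0 := by decide
  simp only [cR, this]; norm_num
lemma v8_5 : cR ZMod.χ₈ 5 = -1 := by
  have : ZMod.χ₈ ((5:ℕ):ZMod 8) = -1 := by decide
  simp only [cR, this]; norm_num
lemma v8_6 : cR ZMod.χ₈ 6 = 0 := by
  have : ZMod.χ₈ ((6:ℕ):ZMod 8) = 0 := by decide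
  simp only [cR, this]; norm_num
lemma v8_7 : cR ZMod.χ₈ 7 = 1 := by
  have : ZMod.χ₈ ((7:ℕ):ZMod 8) = 1 := by decide
  simp only [cR, this]; norm_num
lemma v8_r (n : ℕ) : cR ZMod.χ₈ (n+8) = cR ZMod.χ₈ n := cR_per ZMod.χ₈ 1 n
lemma w8_0 : cR ZMod.χ₈' 0 = 0 := by
  have : ZMod.χ₈' ((0:ℕ):ZMod 8) = 0 := by decide
  simp only [cR, this]; norm_num
lemma w8_1 : cR ZMod.χ₈' 1 = 1 := by
  have : ZMod.χ₈' ((1:ℕ):ZMod 8) = 1 := by decide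
  simp only [cR, this]; norm_num
lemma w8_2 : cR ZMod.χ₈' 2 = 0 := by
  have : ZMod.χ₈' ((2:ℕ):ZMod 8) = 0 := by decide
  simp only [cR, this]; norm_num
lemma w8_3 : cR ZMod.χ₈' 3 = 1 := by
  have : ZMod.χ₈' ((3:ℕ):ZMod 8) = 1 := by decide
  simp only [cR, this]; norm_num
lemma w8_4 : cR ZMod.χ₈' 4 = 0 := by
  have : ZMod.χ₈' ((4:ℕ):ZMod 8) = 0 := by decide
  simp only [cR, this]; norm_num
lemma w8_5 : cR ZMod.χ₈' 5 = -1 := by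
  have : ZMod.χ₈' ((5:ℕ):ZMod 8) = -1 := by decide
  simp only [cR, this]; norm_num
lemma w8_6 : cR ZMod.χ₈' 6 = 0 := by
  have : ZMod.χ₈' ((6:ℕ):ZMod 8) = 0 := by decide
  simp only [cR, this]; norm_num
lemma w8_7 : cR ZMod.χ₈' 7 = -1 := by
  have : ZMod.χ₈' ((7:ℕ):ZMod 8) = -1 := by decide
  simp only [cR, this]; norm_num
lemma w8_r (n : ℕ) : cR ZMod.χ₈' (n+8) = cR ZMod.χ₈' n := cR_per ZMod.χ₈' 1 n

lemma b3 (x : ZMod 3) : |ψ3 x| ≤ 1 := by revert x; decide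
lemma b4 (x : ZMod 4) : |ZMod.χ₄ x| ≤ 1 := by revert x; decide
lemma b5 (x : ZMod 5) : |ψ5 x| ≤ 1 := by revert x; decide
lemma b8 (x : ZMod 8) : |ZMod.χ₈ x| ≤ 1 := by revert x; decide
lemma b8' (x : ZMod 8) : |ZMod.χ₈' x| ≤ 1 := by revert x; decide

lemma D_add {d m k : ℕ} (hd : 0 < d) (hk : k = d * m) {ψ : ℕ → ℝ} (hψ : ∀ n, ψ (n + m) = ψ n) (n : ℕ) :
    D d ψ (n + k) = D d ψ n := by subst hk; exact D_per hd hψ n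

lemma SN1 {b k : ℕ} {x s : ℝ} (hx : 2 * π * ((b:ℝ)/k) = x) (hs : Real.sin x = s) : SN b k 1 = s := by
  rw [← hs, ← hx]; unfold SN; congr 1; push_cast; ring
lemma CN1 {b k : ℕ} {x c : ℝ} (hx : 2 * π * ((b:ℝ)/k) = x) (hs : Real.cos x = c) : CN b k 1 = 1 - c := by
  rw [← hs, ← hx]; unfold CN; congr 2; push_cast; ring

lemma id13 (n : ℕ) : √3/2 * cR ψ3 n = SN 1 3 n := by
  have h1 : SN 1 3 1 = √3/2 := SN1 (x := π - π/3) (by push_cast; ring) (by rw [Real.sin_pi_sub, Real.sin_pi_div_three])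
  have c1 : CN 1 3 1 = 1 - (-1/2) := CN1 (x := π - π/3) (by push_cast; ring) (by rw [Real.cos_pi_sub, Real.cos_pi_div_three]; norm_num)
  have h0 := SN_zero 1 3
  have h2 := SN_rec 1 3 0
  rw [c1, zero_add, zero_add, h1, h0] at h2
  refine per_ext (f := fun n => √3/2 * cR ψ3 n) 3 (by norm_num) (fun n => by simp only [v3_r]) (SN_per 1 3 (by norm_num)) (fun r hr => ?_) n
  interval_cases r <;> simp only [v3_0, v3_1, v3_2, h0, h1, h2] <;> ring

lemma id14 (n : ℕ) : cR ZMod.χ₄ n = SN 1 4 n := by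
  have h1 : SN 1 4 1 = 1 := SN1 (x := π / 2) (by push_cast; ring) (by rw [Real.sin_pi_div_two])
  have c1 : CN 1 4 1 = 1 - 0 := CN1 (x := π / 2) (by push_cast; ring) (by rw [Real.cos_pi_div_two])
  have h0 := SN_zero 1 4
  have h2 := SN_rec 1 4 0
  rw [c1, zero_add, zero_add, h1, h0] at h2
  have h3 := SN_rec 1 4 1
  norm_num only at h3
  rw [c1, h2, h1] at h3
  refine per_ext (f := fun n => cR ZMod.χ₄ n) 4 (by norm_num) (fun n => by simp only [v4_r]) (SN_per 1 4 (by norm_num)) (fun r hr => ?_) n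
  interval_cases r <;> simp only [v4_0, v4_1, v4_2, v4_3, h0, h1, h2, h3] <;> ring

lemma id16 (n : ℕ) : √3/2 * (cR ψ3 n + 2 * D 2 (cR ψ3) n) = SN 1 6 n := by
  have h1 : SN 1 6 1 = √3/2 := SN1 (x := π / 3) (by push_cast; ring) (by rw [Real.sin_pi_div_three])
  have c1 : CN 1 6 1 = 1 - 1/2 := CN1 (x := π / 3) (by push_cast; ring) (by rw [Real.cos_pi_div_three])
  have h0 := SN_zero 1 6
  have h2 := SN_rec 1 6 0
  have h3 := SN_rec 1 6 1
  have h4 := SN_rec 1 6 2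
  have h5 := SN_rec 1 6 3
  norm_num only at h2 h3 h4 h5
  refine per_ext (f := fun n => √3/2 * (cR ψ3 n + 2 * D 2 (cR ψ3) n)) 6 (by norm_num)
    (fun n => by simp only [cR_per ψ3 2 n, D_add (k := 6) two_pos rfl (cR_per ψ3 1) n]) (SN_per 1 6 (by norm_num)) (fun r hr => ?_) n
  interval_cases r <;> norm_num [v3_0, v3_1, v3_2, D, h0, h1, h2, h3, h4, h5, c1] <;> simp only [v3_0, v3_1, v3_2, v3_r 0, v3_r 1, v3_r 2] <;> ring

lemma id112 (n : ℕ) : 1/2 * cR ZMod.χ₄ n + 3/2 * D 3 (cR ZMod.χ₄) n + √3/2 * (D 2 (cR ψ3) n + 2 * D 4 (cR ψ3) n) = SN 1 12 n := by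
  have q : √3 * √3 = 3 := Real.mul_self_sqrt (by norm_num)
  have h1 : SN 1 12 1 = 1/2 := SN1 (x := π / 6) (by push_cast; ring) (by rw [Real.sin_pi_div_six])
  have c1 : CN 1 12 1 = 1 - (√3/2) := CN1 (x := π / 6) (by push_cast; ring) (by rw [Real.cos_pi_div_six])
  have h0 := SN_zero 1 12
  have h2 : SN 1 12 2 = √3/2 := by
    have h := SN_rec 1 12 0
    norm_num only at h
    rw [c1, h1, h0] at h
    grind
  have h3 : SN 1 12 3 = 1 := by
    have h := SN_rec 1 12 1
    norm_num only at h
    rw [c1, h2, h1] at h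
    grind
  have h4 : SN 1 12 4 = √3/2 := by
    have h := SN_rec 1 12 2
    norm_num only at h
    rw [c1, h3, h2] at h
    grind
  have h5 : SN 1 12 5 = 1/2 := by
    have h := SN_rec 1 12 3
    norm_num only at h
    rw [c1, h4, h3] at h
    grind
  have h6 : SN 1 12 6 = 0 := by
    have h := SN_rec 1 12 4
    norm_num only at h
    rw [c1, h5, h4] at h
    grind
  have h7 : SN 1 12 7 = -1/2 := by
    have h := SN_rec 1 12 5
    norm_num only at h
    rw [c1, h6, h5] at h
    grind
  have h8 : SN 1 12 8 = -√3/2 := by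
    have h := SN_rec 1 12 6
    norm_num only at h
    rw [c1, h7, h6] at h
    grind
  have h9 : SN 1 12 9 = -1 := by
    have h := SN_rec 1 12 7
    norm_num only at h
    rw [c1, h8, h7] at h
    grind
  have h10 : SN 1 12 10 = -√3/2 := by
    have h := SN_rec 1 12 8
    norm_num only at h
    rw [c1, h9, h8] at h
    grind
  have h11 : SN 1 12 11 = -1/2 := by
    have h := SN_rec 1 12 9
    norm_num only at h
    rw [c1, h10, h9] at h
    grind
  refine per_ext (f := fun n => 1/2 * cR ZMod.χ₄ n + 3/2 * D 3 (cR ZMod.χ₄) n + √3/2 * (D 2 (cR ψ3) n + 2 * D 4 (cR ψ3) n)) 12 (by norm_num)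
    (fun n => by simp only [cR_per ZMod.χ₄ 3 n, D_add (k := 12) three_pos rfl (cR_per ZMod.χ₄ 1) n, D_add (k := 12) two_pos rfl (cR_per ψ3 2) n, D_add (k := 12) four_pos rfl (cR_per ψ3 1) n]) (SN_per 1 12 (by norm_num)) (fun r hr => ?_) n
  interval_cases r <;> simp only [v3_0, v3_1, v3_2, v3_3, v3_4, v3_5, v3_6, v3_7, v3_8, v3_9, v3_10, v3_11, v4_0, v4_1, v4_2, v4_3, v4_4, v4_5, v4_6, v4_7, v4_8, v4_9, v4_10, v4_11, D, h0, h1, h2, h3, h4, h5, h6, h7, h8, h9, h10, h11] <;> norm_num <;> (try simp only [v3_0, v3_1, v3_2, v3_3, v3_4, v3_5, v3_6, v3_7, v3_8, v3_9, v3_10, v3_11, v4_0, v4_1, v4_2, v4_3, v4_4, v4_5, v4_6, v4_7, v4_8, v4_9, v4_10, v4_11]) <;> (try ring)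

lemma id18 (n : ℕ) : √2/2 * cR ZMod.χ₈' n + D 2 (cR ZMod.χ₄) n = SN 1 8 n := by
  have q : √2 * √2 = 2 := Real.mul_self_sqrt (by norm_num)
  have h1 : SN 1 8 1 = √2/2 := SN1 (x := π / 4) (by push_cast; ring) (by rw [Real.sin_pi_div_four])
  have c1 : CN 1 8 1 = 1 - (√2/2) := CN1 (x := π / 4) (by push_cast; ring) (by rw [Real.cos_pi_div_four])
  have h0 := SN_zero 1 8
  have h2 : SN 1 8 2 = 1 := by
    have h := SN_rec 1 8 0
    norm_num only at h
    rw [c1, h1, h0] at h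
    grind
  have h3 : SN 1 8 3 = √2/2 := by
    have h := SN_rec 1 8 1
    norm_num only at h
    rw [c1, h2, h1] at h
    grind
  have h4 : SN 1 8 4 = 0 := by
    have h := SN_rec 1 8 2
    norm_num only at h
    rw [c1, h3, h2] at h
    grind
  have h5 : SN 1 8 5 = -√2/2 := by
    have h := SN_rec 1 8 3
    norm_num only at h
    rw [c1, h4, h3] at h
    grind
  have h6 : SN 1 8 6 = -1 := by
    have h := SN_rec 1 8 4
    norm_num only at h
    rw [c1, h5, h4] at h
    grind
  have h7 : SN 1 8 7 = -√2/2 := by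
    have h := SN_rec 1 8 5
    norm_num only at h
    rw [c1, h6, h5] at h
    grind
  refine per_ext (f := fun n => √2/2 * cR ZMod.χ₈' n + D 2 (cR ZMod.χ₄) n) 8 (by norm_num)
    (fun n => by simp only [cR_per ZMod.χ₈' 1 n, D_add (k := 8) two_pos rfl (cR_per ZMod.χ₄ 1) n]) (SN_per 1 8 (by norm_num)) (fun r hr => ?_) n
  interval_cases r <;> simp only [v4_0, v4_1, v4_2, v4_3, v4_4, v4_5, v4_6, v4_7, v4_8, v4_9, v4_10, v4_11, w8_0, w8_1, w8_2, w8_3, w8_4, w8_5, w8_6, w8_7, D, h0, h1, h2, h3, h4, h5, h6, h7] <;> norm_num <;> (try simp only [v4_0, v4_1, v4_2, v4_3, v4_4, v4_5, v4_6, v4_7, v4_8, v4_9, v4_10, v4_11, w8_0, w8_1, w8_2, w8_3, w8_4, w8_5, w8_6, w8_7]) <;> (try ring)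

lemma id38 (n : ℕ) : √2/2 * cR ZMod.χ₈ n + 1 + D 4 (fun _ => 1) n - 2 * D 8 (fun _ => 1) n = CN 3 8 n := by
  have q : √2 * √2 = 2 := Real.mul_self_sqrt (by norm_num)
  have c1 : CN 3 8 1 = 1 - (-(√2/2)) := CN1 (x := π - π / 4) (by push_cast; ring) (by rw [Real.cos_pi_sub, Real.cos_pi_div_four])
  have h0 := CN_zero 3 8
  have h2 : CN 3 8 2 = 1 := by
    have h := CN_rec 3 8 0
    norm_num only at h
    rw [c1, h0] at h
    grind
  have h3 : CN 3 8 3 = 1-√2/2 := by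
    have h := CN_rec 3 8 1
    norm_num only at h
    rw [c1, h2] at h
    grind
  have h4 : CN 3 8 4 = 2 := by
    have h := CN_rec 3 8 2
    norm_num only at h
    rw [c1, h3, h2] at h
    grind
  have h5 : CN 3 8 5 = 1-√2/2 := by
    have h := CN_rec 3 8 3
    norm_num only at h
    rw [c1, h4, h3] at h
    grind
  have h6 : CN 3 8 6 = 1 := by
    have h := CN_rec 3 8 4
    norm_num only at h
    rw [c1, h5, h4] at h
    grind
  have h7 : CN 3 8 7 = 1+√2/2 := by
    have h := CN_rec 3 8 5
    norm_num only at h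
    rw [c1, h6, h5] at h
    grind
  refine per_ext (f := fun n => √2/2 * cR ZMod.χ₈ n + 1 + D 4 (fun _ => 1) n - 2 * D 8 (fun _ => 1) n) 8 (by norm_num)
    (fun n => by simp only [cR_per ZMod.χ₈ 1 n, D_add (k := 8) (m := 2) four_pos rfl (ψ := fun _ => 1) (fun _ => rfl) n, D_add (k := 8) (m := 1) (d := 8) (by norm_num) rfl (ψ := fun _ => 1) (fun _ => rfl) n]) (CN_per 3 8 (by norm_num)) (fun r hr => ?_) n
  interval_cases r <;> simp only [v8_0, v8_1, v8_2, v8_3, v8_4, v8_5, v8_6, v8_7, D, h0, c1, h2, h3, h4, h5, h6, h7] <;> norm_num <;> (try simp only [v8_0, v8_1, v8_2, v8_3, v8_4, v8_5, v8_6, v8_7]) <;> (try ring)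

lemma id25 (n : ℕ) : √5/4 * cR ψ5 n + 5/4 * (1 - D 5 (fun _ => 1) n) = CN 2 5 n := by
  have q : √5 * √5 = 5 := Real.mul_self_sqrt (by norm_num)
  have c1 : CN 2 5 1 = 1 - (-((1+√5)/4)) := CN1 (x := π - π / 5) (by push_cast; ring) (by rw [Real.cos_pi_sub, Real.cos_pi_div_five])
  have h0 := CN_zero 2 5
  have h2 : CN 2 5 2 = 1-(√5-1)/4 := by
    have h := CN_rec 2 5 0
    norm_num only at h
    rw [c1, h0] at h
    grind
  have h3 : CN 2 5 3 = 1-(√5-1)/4 := by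
    have h := CN_rec 2 5 1
    norm_num only at h
    rw [c1, h2] at h
    grind
  have h4 : CN 2 5 4 = 1+(1+√5)/4 := by
    have h := CN_rec 2 5 2
    norm_num only at h
    rw [c1, h3, h2] at h
    grind
  refine per_ext (f := fun n => √5/4 * cR ψ5 n + 5/4 * (1 - D 5 (fun _ => 1) n)) 5 (by norm_num)
    (fun n => by simp only [cR_per ψ5 1 n, D_add (k := 5) (m := 1) (d := 5) (by norm_num) rfl (ψ := fun _ => 1) (fun _ => rfl) n]) (CN_per 2 5 (by norm_num)) (fun r hr => ?_) n
  interval_cases r <;> simp only [v5_0, v5_1, v5_2, v5_3, v5_4, D, h0, c1, h2, h3, h4] <;> norm_num <;> (try simp only [v5_0, v5_1, v5_2, v5_3, v5_4]) <;> (try ring)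

lemma id512 (n : ℕ) : √3/2 * (cR ZMod.χ₄ n * cR ψ3 n) + 1 - 1/2 * D 2 (fun _ => 1) n + D 4 (fun _ => 1) n + 3/2 * D 6 (fun _ => 1) n - 3 * D 12 (fun _ => 1) n = CN 5 12 n := by
  have q : √3 * √3 = 3 := Real.mul_self_sqrt (by norm_num)
  have c1 : CN 5 12 1 = 1 - (-(√3/2)) := CN1 (x := π - π / 6) (by push_cast; ring) (by rw [Real.cos_pi_sub, Real.cos_pi_div_six])
  have h0 := CN_zero 5 12
  have h2 : CN 5 12 2 = 1/2 := by
    have h := CN_rec 5 12 0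
    norm_num only at h
    rw [c1, h0] at h
    grind
  have h3 : CN 5 12 3 = 1 := by
    have h := CN_rec 5 12 1
    norm_num only at h
    rw [c1, h2] at h
    grind
  have h4 : CN 5 12 4 = 3/2 := by
    have h := CN_rec 5 12 2
    norm_num only at h
    rw [c1, h3, h2] at h
    grind
  have h5 : CN 5 12 5 = 1-√3/2 := by
    have h := CN_rec 5 12 3
    norm_num only at h
    rw [c1, h4, h3] at h
    grind
  have h6 : CN 5 12 6 = 2 := by
    have h := CN_rec 5 12 4
    norm_num only at h
    rw [c1, h5, h4] at h
    grind
  have h7 : CN 5 12 7 = 1-√3/2 := by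
    have h := CN_rec 5 12 5
    norm_num only at h
    rw [c1, h6, h5] at h
    grind
  have h8 : CN 5 12 8 = 3/2 := by
    have h := CN_rec 5 12 6
    norm_num only at h
    rw [c1, h7, h6] at h
    grind
  have h9 : CN 5 12 9 = 1 := by
    have h := CN_rec 5 12 7
    norm_num only at h
    rw [c1, h8, h7] at h
    grind
  have h10 : CN 5 12 10 = 1/2 := by
    have h := CN_rec 5 12 8
    norm_num only at h
    rw [c1, h9, h8] at h
    grind
  have h11 : CN 5 12 11 = 1+√3/2 := by
    have h := CN_rec 5 12 9
    norm_num only at h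
    rw [c1, h10, h9] at h
    grind
  refine per_ext (f := fun n => √3/2 * (cR ZMod.χ₄ n * cR ψ3 n) + 1 - 1/2 * D 2 (fun _ => 1) n + D 4 (fun _ => 1) n + 3/2 * D 6 (fun _ => 1) n - 3 * D 12 (fun _ => 1) n) 12 (by norm_num)
    (fun n => by simp only [cR_per ZMod.χ₄ 3 n, cR_per ψ3 4 n, D_add (k := 12) (m := 6) (d := 2) (by norm_num) rfl (ψ := fun _ => 1) (fun _ => rfl) n, D_add (k := 12) (m := 3) (d := 4) (by norm_num) rfl (ψ := fun _ => 1) (fun _ => rfl) n, D_add (k := 12) (m := 2) (d := 6) (by norm_num) rfl (ψ := fun _ => 1) (fun _ => rfl) n, D_add (k := 12) (m := 1) (d := 12) (by norm_num) rfl (ψ := fun _ => 1) (fun _ => rfl) n]) (CN_per 5 12 (by norm_num)) (fun r hr => ?_) n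
  interval_cases r <;> simp only [v3_0, v3_1, v3_2, v3_3, v3_4, v3_5, v3_6, v3_7, v3_8, v3_9, v3_10, v3_11, v4_0, v4_1, v4_2, v4_3, v4_4, v4_5, v4_6, v4_7, v4_8, v4_9, v4_10, v4_11, D, h0, c1, h2, h3, h4, h5, h6, h7, h8, h9, h10, h11] <;> norm_num <;> (try simp only [v3_0, v3_1, v3_2, v3_3, v3_4, v3_5, v3_6, v3_7, v3_8, v3_9, v3_10, v3_11, v4_0, v4_1, v4_2, v4_3, v4_4, v4_5, v4_6, v4_7, v4_8, v4_9, v4_10, v4_11]) <;> (try ring)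

section
variable (p : ℕ) [Fact p.Prime]

lemma cm : ∀ m n, chi p (m * n) = chi p m * chi p n := chi_mul p

lemma case13 (hp1 : p % 4 = 1) (hpk : Nat.Coprime p 3) : 0 ≤ LL p (((1:ℕ):ℝ)/(3:ℕ)) := by
  have hp2 : p ≠ 2 := by rintro rfl; omega
  obtain ⟨t, ht, h⟩ := exTc p hp2 (by norm_num) hpk ψ3 b3
  refine nonneg1 p hp1 (by norm_num) (by norm_num) hpk ((h.mul (√3/2)).congr fun n => ?_) (by positivity)
  change _ = chi p n * SN 1 3 n
  rw [← id13]; ring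

lemma case14 (hp1 : p % 4 = 1) (hpk : Nat.Coprime p 4) : 0 ≤ LL p (((1:ℕ):ℝ)/(4:ℕ)) := by
  have hp2 : p ≠ 2 := by rintro rfl; omega
  obtain ⟨t, ht, h⟩ := exTc p hp2 (by norm_num) hpk ZMod.χ₄ b4
  refine nonneg1 p hp1 (by norm_num) (by norm_num) hpk (h.congr fun n => ?_) (by positivity)
  change _ = chi p n * SN 1 4 n
  rw [← id14]

lemma case12 (hp1 : p % 4 = 1) (hpk : Nat.Coprime p 2) : 0 ≤ LL p (((1:ℕ):ℝ)/(2:ℕ)) := by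
  have hp2 : p ≠ 2 := by rintro rfl; omega
  obtain ⟨t, ht, h⟩ := exTone p hp2
  refine nonneg1 p hp1 (by norm_num) (by norm_num) hpk ((h.mul 0).congr fun n => ?_) (by simp)
  rw [show 2 * π * (n:ℝ) * (((1:ℕ):ℝ)/(2:ℕ)) = n * π by push_cast; ring, Real.sin_nat_mul_pi]; ring

lemma case16 (hp1 : p % 4 = 1) (hpk : Nat.Coprime p 6) : 0 ≤ LL p (((1:ℕ):ℝ)/(6:ℕ)) := by
  have hp2 : p ≠ 2 := by rintro rfl; omega
  have h3 : Nat.Coprime p 3 := Nat.Coprime.coprime_dvd_right (by norm_num) hpk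
  have h2 : Nat.Coprime p 2 := Nat.Coprime.coprime_dvd_right (by norm_num) hpk
  obtain ⟨t, ht, h⟩ := exTc p hp2 (by norm_num) h3 ψ3 b3
  have hd := h.D (cm p) 2 two_pos
  refine nonneg1 p hp1 (by norm_num) (by norm_num) hpk ((((hd.mul 2).add h).mul (√3/2)).congr (fun n => ?_)) ?_
  · change _ = chi p n * SN 1 6 n
    rw [← id16]; ring
  · rcases chi_sq p 2 h2 with h | h <;> rw [h]
    · positivity
    · apply le_of_eq; push_cast; ring

lemma case112 (hp1 : p % 4 = 1) (hpk : Nat.Coprime p 12) : 0 ≤ LL p (((1:ℕ):ℝ)/(12:ℕ)) := by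
  have hp2 : p ≠ 2 := by rintro rfl; omega
  have h3 : Nat.Coprime p 3 := Nat.Coprime.coprime_dvd_right (by norm_num) hpk
  have h4 : Nat.Coprime p 4 := Nat.Coprime.coprime_dvd_right (by norm_num) hpk
  have h2 : Nat.Coprime p 2 := Nat.Coprime.coprime_dvd_right (by norm_num) hpk
  obtain ⟨t, ht, h⟩ := exTc p hp2 (by norm_num) h3 ψ3 b3
  obtain ⟨s, hs, g⟩ := exTc p hp2 (by norm_num) h4 ZMod.χ₄ b4
  have hd2 := h.D (cm p) 2 two_pos
  have hd4 := h.D (cm p) 4 four_pos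
  have gd3 := g.D (cm p) 3 three_pos
  refine nonneg1 p hp1 (by norm_num) (by norm_num) hpk
    (((g.mul (1/2)).add ((gd3.mul (3/2)).add ((hd2.add (hd4.mul 2)).mul (√3/2)))).congr (fun n => ?_)) ?_
  · change _ = chi p n * SN 1 12 n
    rw [← id112]; ring
  · have e4 : chi p 4 = 1 := by
      rw [show 4 = 2 * 2 by norm_num, chi_mul]
      rcases chi_sq p 2 h2 with h | h <;> rw [h] <;> norm_num
    rw [e4]
    have q : 0 ≤ √3 := Real.sqrt_nonneg _
    have hst : 0 ≤ √3 * t := by positivity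
    rcases chi_sq p 2 h2 with h | h <;> rcases chi_sq p 3 h3 with h' | h' <;> rw [h, h'] <;> push_cast <;> nlinarith

lemma case18 (hp1 : p % 8 = 1) : 0 ≤ LL p (((1:ℕ):ℝ)/(8:ℕ)) := by
  have hp2 : p ≠ 2 := by rintro rfl; omega
  have hpp : p.Prime := Fact.out
  have h2 : Nat.Coprime p 2 := (Nat.coprime_primes hpp Nat.prime_two).mpr hp2
  have h4 : Nat.Coprime p 4 := Nat.Coprime.mul_right h2 h2
  have h8 : Nat.Coprime p 8 := Nat.Coprime.mul_right h2 h4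
  obtain ⟨t, ht, h⟩ := exTc p hp2 (by norm_num) h8 ZMod.χ₈' b8'
  obtain ⟨s, hs, g⟩ := exTc p hp2 (by norm_num) h4 ZMod.χ₄ b4
  have gd := g.D (cm p) 2 two_pos
  refine nonneg1 p (by omega) (by norm_num) (by norm_num) h8
    (((h.mul (√2/2)).add gd).congr (fun n => ?_)) ?_
  · change _ = chi p n * SN 1 8 n
    rw [← id18]; ring
  · have e2 : chi p 2 = 1 := by
      unfold chi
      have := legendreSym.at_two hp2
      push_cast
      rw [this, ZMod.χ₈_nat_eq_if_mod_eight]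
      simp [hp1]; omega
    rw [e2]; positivity

lemma case38 (hp1 : p % 4 = 3) : 0 ≤ LL p (((3:ℕ):ℝ)/(8:ℕ)) := by
  have hp2 : p ≠ 2 := by rintro rfl; omega
  have hpp : p.Prime := Fact.out
  have h2 : Nat.Coprime p 2 := (Nat.coprime_primes hpp Nat.prime_two).mpr hp2
  have h4 : Nat.Coprime p 4 := Nat.Coprime.mul_right h2 h2
  have h8 : Nat.Coprime p 8 := Nat.Coprime.mul_right h2 h4
  obtain ⟨t, ht, h⟩ := exTc p hp2 (by norm_num) h8 ZMod.χ₈ b8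
  obtain ⟨s, hs, g⟩ := exTone p hp2
  have gd4 := HasT.D (ψ := fun _ => 1) (cm p) 4 four_pos g
  have gd8 := HasT.D (ψ := fun _ => 1) (cm p) 8 (by norm_num) g
  refine nonneg3 p hp1 (by norm_num) (by norm_num) h8
    (((h.mul (√2/2)).add (g.add (gd4.add (gd8.mul (-2))))).congr (fun n => ?_)) ?_
  · change _ = chi p n * CN 3 8 n
    rw [← id38]; ring
  · have q : 0 ≤ √2 := Real.sqrt_nonneg _
    have hst : 0 ≤ √2 * t := by positivity
    rcases chi_sq p 4 h4 with h | h <;> rcases chi_sq p 8 h8 with h' | h' <;> rw [h, h'] <;> push_cast <;> nlinarith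

lemma case25 (hp1 : p % 4 = 3) (h5 : Nat.Coprime p 5) : 0 ≤ LL p (((2:ℕ):ℝ)/(5:ℕ)) := by
  have hp2 : p ≠ 2 := by rintro rfl; omega
  obtain ⟨t, ht, h⟩ := exTc p hp2 (by norm_num) h5 ψ5 b5
  obtain ⟨s, hs, g⟩ := exTone p hp2
  have gd := HasT.D (ψ := fun _ => 1) (cm p) 5 (by norm_num) g
  refine nonneg3 p hp1 (by norm_num) (by norm_num) h5
    (((h.mul (√5/4)).add ((g.add (gd.mul (-1))).mul (5/4))).congr (fun n => ?_)) ?_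
  · change _ = chi p n * CN 2 5 n
    rw [← id25]; ring
  · have q : 0 ≤ √5 := Real.sqrt_nonneg _
    have hst : 0 ≤ √5 * t := by positivity
    rcases chi_sq p 5 h5 with h | h <;> rw [h] <;> push_cast <;> nlinarith

lemma case512 (hp1 : p % 4 = 3) (hpk : Nat.Coprime p 12) : 0 ≤ LL p (((5:ℕ):ℝ)/(12:ℕ)) := by
  have hp2 : p ≠ 2 := by rintro rfl; omega
  have h3 : Nat.Coprime p 3 := Nat.Coprime.coprime_dvd_right (by norm_num) hpk
  have h2 : Nat.Coprime p 2 := Nat.Coprime.coprime_dvd_right (by norm_num) hpk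
  obtain ⟨t, ht, h⟩ := exTpos p hp2 (k := 12) (by norm_num) hpk (fun n => cR ZMod.χ₄ n * cR ψ3 n) (by simp [cR])
    (fun m n => by simp only [cR, Nat.cast_mul, map_mul, Int.cast_mul]; ring) (fun n => by
      rw [abs_mul]
      refine mul_le_one₀ ?_ (abs_nonneg _) ?_
      · unfold cR; exact_mod_cast b4 _
      · unfold cR; exact_mod_cast b3 _) (fun n => by simp only [cR_per ZMod.χ₄ 3 n, cR_per ψ3 4 n])
  obtain ⟨s, hs, g⟩ := exTone p hp2
  have gd2 := HasT.D (ψ := fun _ => 1) (cm p) 2 (by norm_num) g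
  have gd4 := HasT.D (ψ := fun _ => 1) (cm p) 4 (by norm_num) g
  have gd6 := HasT.D (ψ := fun _ => 1) (cm p) 6 (by norm_num) g
  have gd12 := HasT.D (ψ := fun _ => 1) (cm p) 12 (by norm_num) g
  refine nonneg3 p hp1 (by norm_num) (by norm_num) hpk
    (((h.mul (√3/2)).add (g.add ((gd2.mul (-1/2)).add (gd4.add ((gd6.mul (3/2)).add (gd12.mul (-3))))))).congr (fun n => ?_)) ?_
  · change _ = chi p n * CN 5 12 n
    rw [← id512]; ring
  · have e4 : chi p 4 = 1 := by
      rw [show 4 = 2 * 2 by norm_num, chi_mul]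
      rcases chi_sq p 2 h2 with h | h <;> rw [h] <;> norm_num
    have e6 : chi p 6 = chi p 2 * chi p 3 := by rw [← chi_mul]
    have e12 : chi p 12 = chi p 4 * chi p 3 := by rw [← chi_mul]
    rw [e12, e6, e4]
    have q : 0 ≤ √3 := Real.sqrt_nonneg _
    have hst : 0 ≤ √3 * t := by positivity
    rcases chi_sq p 2 h2 with h | h <;> rcases chi_sq p 3 h3 with h' | h' <;> rw [h, h'] <;> push_cast <;> nlinarith

end
end LF
end

section
namespace SM
open Filter Topology Finset

/-- Selberg majorant -/
noncomputable def w (R m : ℕ) : ℝ := (∑ d ∈ (Icc 1 R).filter (· ∣ m), Sel.lam R d) ^ 2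

lemma w_nonneg (R m : ℕ) : 0 ≤ w R m := sq_nonneg _

lemma w_prime (R p : ℕ) (hR : 1 ≤ R) (hp : p.Prime) (h : R < p) : w R p = 1 := by
  unfold w
  have : (Icc 1 R).filter (· ∣ p) = {1} := by
    ext d
    simp only [mem_filter, mem_Icc, mem_singleton]
    constructor
    · rintro ⟨⟨h1, h2⟩, h3⟩
      rcases (Nat.dvd_prime hp).mp h3 with h | h <;> omega
    · rintro rfl; exact ⟨⟨le_rfl, hR⟩, one_dvd _⟩
  rw [this, sum_singleton, Sel.lam_one hR]; norm_num

lemma sum_mult (N e : ℕ) (he : 0 < e) (h : ℕ → ℝ) :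
    ∑ m ∈ (Icc 1 N).filter (e ∣ ·), h m = ∑ l ∈ Icc 1 (N / e), h (e * l) := by
  symm
  refine sum_bij (fun l _ => e * l) ?_ ?_ ?_ ?_
  · intro l hl
    simp only [mem_Icc, mem_filter] at hl ⊢
    refine ⟨⟨Nat.mul_pos he hl.1, ?_⟩, dvd_mul_right _ _⟩
    calc e * l ≤ e * (N / e) := Nat.mul_le_mul_left _ hl.2
      _ ≤ N := Nat.mul_div_le N e
  · intro a _ b _ hab
    exact Nat.eq_of_mul_eq_mul_left he hab
  · intro m hm
    simp only [mem_Icc, mem_filter] at hm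
    obtain ⟨⟨h1, h2⟩, l, rfl⟩ := hm
    refine ⟨l, ?_, rfl⟩
    simp only [mem_Icc]
    refine ⟨Nat.pos_of_mul_pos_left (by omega : 0 < e * l), ?_⟩
    rw [Nat.le_div_iff_mul_le he, mul_comm]; exact h2
  · intros; rfl

lemma expand (R N : ℕ) (h : ℕ → ℝ) :
    ∑ m ∈ Icc 1 N, w R m * h m = ∑ d ∈ Icc 1 R, ∑ d' ∈ Icc 1 R, Sel.lam R d * Sel.lam R d' *
      ∑ l ∈ Icc 1 (N / Nat.lcm d d'), h (Nat.lcm d d' * l) := by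
  have h1 : ∀ m, w R m * h m = ∑ d ∈ Icc 1 R, ∑ d' ∈ Icc 1 R, Sel.lam R d * Sel.lam R d' *
      (if Nat.lcm d d' ∣ m then h m else 0) := by
    intro m
    unfold w
    rw [sq, sum_filter, sum_mul_sum, sum_mul]
    refine sum_congr rfl fun d _ => ?_
    rw [sum_mul]
    refine sum_congr rfl fun d' _ => ?_
    simp only [Nat.lcm_dvd_iff]
    by_cases h1 : d ∣ m <;> by_cases h2 : d' ∣ m <;> simp [h1, h2]
  simp_rw [h1]
  rw [sum_comm]
  refine sum_congr rfl fun d hd => ?_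
  rw [sum_comm]
  refine sum_congr rfl fun d' hd' => ?_
  rw [← mul_sum, ← sum_filter, sum_mult]
  simp only [mem_Icc] at hd hd'
  exact Nat.lcm_pos (by omega) (by omega)

lemma lam_le_R {R d : ℕ} (hR : 1 ≤ R) (hd : d ∈ Icc 1 R) : |Sel.lam R d| ≤ R := by
  simp only [mem_Icc] at hd
  exact (Sel.lam_le hR d).trans (by exact_mod_cast hd.2)

lemma W1 (R N : ℕ) (hR : 1 ≤ R) : ∑ m ∈ Icc 1 N, w R m ≤ N / Sel.V R + R ^ 4 := by
  have h := expand R N (fun _ => 1)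
  simp only [mul_one, sum_const, nsmul_eq_mul, Nat.card_Icc, Nat.add_sub_cancel] at h
  rw [h]
  have h2 : (N:ℝ) / Sel.V R + R ^ 4 = ∑ d ∈ Icc 1 R, ∑ d' ∈ Icc 1 R, (N * (Sel.lam R d * Sel.lam R d' / (Nat.lcm d d' : ℝ)) + R ^ 2) := by
    simp_rw [sum_add_distrib, ← mul_sum]
    rw [Sel.quad hR]
    simp
    ring
  rw [h2]
  refine sum_le_sum fun d hd => sum_le_sum fun d' hd' => ?_
  have a1 := lam_le_R hR hd
  have a2 := lam_le_R hR hd'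
  simp only [mem_Icc] at hd hd'
  have he : 0 < Nat.lcm d d' := Nat.lcm_pos (by omega) (by omega)
  set e := Nat.lcm d d'
  have heR : (0:ℝ) < e := by exact_mod_cast he
  have f1 : ((N / e : ℕ) : ℝ) ≤ N / e := Nat.cast_div_le
  have f2 : (N:ℝ) / e - 1 ≤ ((N / e : ℕ) : ℝ) := by
    have : N < e * (N / e + 1) := Nat.lt_mul_div_succ N he
    have h3 : (N:ℝ) < e * ((N/e:ℕ) + 1) := by exact_mod_cast this
    rw [sub_le_iff_le_add, div_le_iff₀ heR]; linarith
  have hb : |Sel.lam R d * Sel.lam R d'| ≤ R ^ 2 := by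
    rw [abs_mul, sq]; exact mul_le_mul a1 a2 (abs_nonneg _) (by positivity)
  have h4 : Sel.lam R d * Sel.lam R d' * (((N / e : ℕ) : ℝ) - N / e) ≤ R ^ 2 := by
    refine (le_abs_self _).trans ?_
    rw [abs_mul]
    have : |((N / e : ℕ) : ℝ) - N / e| ≤ 1 := by rw [abs_le]; constructor <;> linarith
    calc _ ≤ (R:ℝ)^2 * 1 := mul_le_mul hb this (abs_nonneg _) (by positivity)
      _ = _ := mul_one _
  calc _ = N * (Sel.lam R d * Sel.lam R d' / (e : ℝ)) + Sel.lam R d * Sel.lam R d' * (((N / e : ℕ) : ℝ) - N / e) := by ring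
    _ ≤ _ := by linarith

lemma W2 (R N b : ℕ) (hR : 1 ≤ R) (hb : Odd b) (hs : ¬ IsSquare b) :
    |∑ m ∈ Icc 1 N, w R m * (jacobiSym m b : ℝ)| ≤ R ^ 4 * (√b * (1 + Real.log b)) := by
  rw [expand R N (fun m => (jacobiSym m b : ℝ))]
  have hnn : 0 ≤ √(b:ℝ) * (1 + Real.log b) := by
    have : 0 ≤ Real.log (b:ℝ) := Real.log_natCast_nonneg b
    positivity
  have h2 : (R:ℝ) ^ 4 * (√b * (1 + Real.log b)) = ∑ d ∈ Icc 1 R, ∑ d' ∈ Icc 1 R, ((R:ℝ) ^ 2 * (√b * (1 + Real.log b))) := by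
    simp; ring
  rw [h2]
  refine (abs_sum_le_sum_abs _ _).trans (sum_le_sum fun d hd => (abs_sum_le_sum_abs _ _).trans (sum_le_sum fun d' hd' => ?_))
  have a1 := lam_le_R hR hd
  have a2 := lam_le_R hR hd'
  set e := Nat.lcm d d'
  have hb1 : 1 < b := by
    rcases hb with ⟨k, rfl⟩
    rcases Nat.eq_zero_or_pos k with h | h
    · subst h; exact absurd ⟨1, rfl⟩ hs
    · omega
  have h3 : ∑ l ∈ Icc 1 (N / e), (jacobiSym ((e * l : ℕ) : ℤ) b : ℝ) = (jacobiSym e b : ℝ) * ∑ j ∈ range (N / e + 1), (jacobiSym j b : ℝ) := by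
    have h0 : jacobiSym ((0:ℕ):ℤ) b = 0 := by
      push_cast; exact jacobiSym.zero_left hb1
    rw [range_eq_Ico, sum_eq_sum_Ico_succ_bot (Nat.add_pos_right _ one_pos), h0, mul_add, Int.cast_zero, mul_zero, zero_add, zero_add,
      Finset.Ico_add_one_right_eq_Icc, mul_sum]
    refine sum_congr rfl fun l _ => ?_
    push_cast
    rw [jacobiSym.mul_left]; push_cast; rfl
  rw [h3, abs_mul, abs_mul, abs_mul]
  have := PV.polya_nonsq b hb hs (N / e + 1)
  have h5 := PV.jacobi_abs_le e b
  calc |Sel.lam R d| * |Sel.lam R d'| * (|(jacobiSym e b : ℝ)| * |∑ j ∈ range (N / e + 1), (jacobiSym j b : ℝ)|)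
      ≤ R * R * (1 * (√b * (1 + Real.log b))) := by gcongr
    _ = _ := by ring

lemma sum_inv_sqrt' (X : ℕ) : ∑ n ∈ range (X+1), (√(n:ℝ))⁻¹ ≤ 2 * √X := by
  induction X with
  | zero => simp
  | succ n ih =>
    rw [sum_range_succ]
    have h1 : √(n:ℝ) * √n = n := Real.mul_self_sqrt (by positivity)
    have h2 : √((n+1:ℕ):ℝ) * √((n+1:ℕ):ℝ) = n + 1 := by rw [Real.mul_self_sqrt (by positivity)]; push_cast; rfl
    have h3 : 0 < √((n+1:ℕ):ℝ) := Real.sqrt_pos.mpr (by positivity)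
    have h4 : √(n:ℝ) ≤ √((n+1:ℕ):ℝ) := Real.sqrt_le_sqrt (by push_cast; linarith)
    have : (√((n+1:ℕ):ℝ))⁻¹ ≤ 2 * (√((n+1:ℕ):ℝ) - √n) := by
      rw [inv_le_iff_one_le_mul₀ h3]
      nlinarith [mul_self_nonneg (√((n+1:ℕ):ℝ) - √n)]
    linarith

lemma sum_inv_sqrt (X : ℕ) : ∑ n ∈ range X, (√(n:ℝ))⁻¹ ≤ 2 * √X := by
  refine le_trans ?_ (sum_inv_sqrt' X)
  exact sum_le_sum_of_subset_of_nonneg (range_mono (Nat.le_succ X)) (fun _ _ _ => by positivity)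

open Classical in
noncomputable def Sq (y X : ℕ) : ℝ := ∑ n ∈ Ico y X, ∑ n' ∈ Ico y X, if IsSquare (n * n') then ((n:ℝ) * n')⁻¹ else 0

theorem I1 (N R y X : ℕ) (hR : 1 ≤ R) (c : ℕ → ℝ) (hc : ∀ n, |c n| ≤ 1) (hc0 : ∀ n, ¬ Odd n → c n = 0) :
    ∑ m ∈ Icc 1 N, w R m * (∑ n ∈ Ico y X, c n * (jacobiSym m n : ℝ) / n) ^ 2 ≤
      (N / Sel.V R + R ^ 4) * Sq y X + R ^ 4 * (4 * X * (1 + 2 * Real.log X)) := by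
  classical
  have hV := Sel.V_pos hR
  set A : ℝ := N / Sel.V R + R ^ 4
  have hA : 0 ≤ A := by positivity
  have hlX : 0 ≤ Real.log X := Real.log_natCast_nonneg X
  set B : ℝ := R ^ 4 * (1 + 2 * Real.log X)
  have hB : 0 ≤ B := by positivity
  have h1 : ∑ m ∈ Icc 1 N, w R m * (∑ n ∈ Ico y X, c n * (jacobiSym m n : ℝ) / n) ^ 2 =
      ∑ n ∈ Ico y X, ∑ n' ∈ Ico y X, (c n * c n' / (n * n')) * ∑ m ∈ Icc 1 N, w R m * ((jacobiSym m n : ℝ) * (jacobiSym m n' : ℝ)) := by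
    simp_rw [sq, sum_mul_sum, mul_sum]
    rw [sum_comm]
    refine sum_congr rfl fun n _ => ?_
    rw [sum_comm]
    refine sum_congr rfl fun n' _ => sum_congr rfl fun m _ => ?_
    rw [div_mul_div_comm]; ring
  rw [h1]
  have h2 : ∀ n ∈ Ico y X, ∀ n' ∈ Ico y X, (c n * c n' / (n * n')) * ∑ m ∈ Icc 1 N, w R m * ((jacobiSym m n : ℝ) * (jacobiSym m n' : ℝ))
      ≤ A * (if IsSquare (n * n') then ((n:ℝ) * n')⁻¹ else 0) + B * ((√(n:ℝ))⁻¹ * (√(n':ℝ))⁻¹) := by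
    intro n hn n' hn'
    have hpos1 : 0 ≤ A * (if IsSquare (n * n') then ((n:ℝ) * n')⁻¹ else 0) := by split_ifs <;> positivity
    have hpos2 : 0 ≤ B * ((√(n:ℝ))⁻¹ * (√(n':ℝ))⁻¹) := by positivity
    by_cases ho : Odd n
    swap
    · rw [hc0 n ho]; simp only [zero_mul, zero_div]; positivity
    by_cases ho' : Odd n'
    swap
    · rw [hc0 n' ho']; simp only [zero_mul, mul_zero, zero_div]; positivity
    have hne : NeZero n := ⟨by rintro rfl; simp at ho⟩
    have hne' : NeZero n' := ⟨by rintro rfl; simp at ho'⟩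
    have hJ : ∀ m : ℕ, (jacobiSym m n : ℝ) * (jacobiSym m n' : ℝ) = (jacobiSym m (n * n') : ℝ) := by
      intro m; rw [jacobiSym.mul_right]; push_cast; rfl
    simp_rw [hJ]
    have hnR : (0:ℝ) < n := by exact_mod_cast Nat.pos_of_ne_zero hne.out
    have hnR' : (0:ℝ) < n' := by exact_mod_cast Nat.pos_of_ne_zero hne'.out
    have hcc : |c n * c n' / ((n:ℝ) * n')| ≤ ((n:ℝ) * n')⁻¹ := by
      rw [abs_div, abs_mul, abs_of_pos (mul_pos hnR hnR'), div_eq_mul_inv]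
      have : |c n| * |c n'| ≤ 1 := mul_le_one₀ (hc n) (abs_nonneg _) (hc n')
      calc _ ≤ 1 * ((n:ℝ) * n')⁻¹ := by gcongr
        _ = _ := one_mul _
    refine (le_abs_self _).trans ?_
    rw [abs_mul]
    by_cases hs : IsSquare (n * n')
    · rw [if_pos hs]
      have : |∑ m ∈ Icc 1 N, w R m * (jacobiSym m (n * n') : ℝ)| ≤ A := by
        refine (abs_sum_le_sum_abs _ _).trans ((sum_le_sum fun m _ => ?_).trans (W1 R N hR))
        rw [abs_mul, abs_of_nonneg (w_nonneg R m)]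
        exact mul_le_of_le_one_right (w_nonneg R m) (PV.jacobi_abs_le _ _)
      calc _ ≤ ((n:ℝ) * n')⁻¹ * A := by gcongr
        _ ≤ _ := by rw [mul_comm]; linarith
    · rw [if_neg hs, mul_zero, zero_add]
      have h3 := W2 R N (n * n') hR (ho.mul ho') hs
      have h4 : Real.log ((n * n' : ℕ) : ℝ) ≤ 2 * Real.log X := by
        simp only [mem_Ico] at hn hn'
        push_cast
        rw [Real.log_mul hnR.ne' hnR'.ne']
        have a1 : Real.log n ≤ Real.log X := Real.log_le_log hnR (by exact_mod_cast hn.2.le)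
        have a2 : Real.log n' ≤ Real.log X := Real.log_le_log hnR' (by exact_mod_cast hn'.2.le)
        linarith
      have h5 : ((n:ℝ) * n')⁻¹ * √((n * n' : ℕ) : ℝ) = (√(n:ℝ))⁻¹ * (√(n':ℝ))⁻¹ := by
        push_cast
        rw [Real.sqrt_mul hnR.le]
        have e1 : √(n:ℝ) * √n = n := Real.mul_self_sqrt hnR.le
        have e2 : √(n':ℝ) * √n' = n' := Real.mul_self_sqrt hnR'.le
        have h3 : 0 < √(n:ℝ) := Real.sqrt_pos.mpr hnR
        have h4 : 0 < √(n':ℝ) := Real.sqrt_pos.mpr hnR'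
        rw [← mul_inv, inv_mul_eq_div, div_eq_iff (by positivity), inv_mul_eq_div, eq_div_iff (by positivity)]
        nlinarith
      calc _ ≤ ((n:ℝ) * n')⁻¹ * (R ^ 4 * (√((n * n' : ℕ) : ℝ) * (1 + Real.log ((n * n' : ℕ) : ℝ)))) := by gcongr
        _ ≤ ((n:ℝ) * n')⁻¹ * (R ^ 4 * (√((n * n' : ℕ) : ℝ) * (1 + 2 * Real.log X))) := by gcongr
        _ = (((n:ℝ) * n')⁻¹ * √((n * n' : ℕ) : ℝ)) * (R ^ 4 * (1 + 2 * Real.log X)) := by ring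
        _ = _ := by rw [h5, mul_comm]
  refine (sum_le_sum fun n hn => sum_le_sum fun n' hn' => h2 n hn n' hn').trans ?_
  simp_rw [sum_add_distrib, ← mul_sum]
  have h6 : ∑ n ∈ Ico y X, (√(n:ℝ))⁻¹ ≤ 2 * √X :=
    (sum_le_sum_of_subset_of_nonneg (fun n hn => by simp only [mem_Ico, mem_range] at *; exact hn.2) (fun _ _ _ => by positivity)).trans (sum_inv_sqrt X)
  have h7 : 0 ≤ ∑ n ∈ Ico y X, (√(n:ℝ))⁻¹ := sum_nonneg fun _ _ => by positivity
  rw [← sum_mul]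
  have h8 : √(X:ℝ) * √X = X := Real.mul_self_sqrt (by positivity)
  have h9 : (∑ n ∈ Ico y X, (√(n:ℝ))⁻¹) * (∑ n ∈ Ico y X, (√(n:ℝ))⁻¹) ≤ 4 * X := by
    calc _ ≤ (2 * √X) * (2 * √X) := by gcongr
      _ = 4 * (√(X:ℝ) * √X) := by ring
      _ = _ := by rw [h8]
  unfold Sq
  have : B * ((∑ n ∈ Ico y X, (√(n:ℝ))⁻¹) * (∑ n ∈ Ico y X, (√(n:ℝ))⁻¹)) ≤ B * (4 * X) := by gcongr
  have h10 : B * (4 * X) = R ^ 4 * (4 * X * (1 + 2 * Real.log X)) := by simp only [B]; ring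
  linarith

end SM
end

section
namespace SM
open Filter Topology Finset

lemma sqf_unique {s s' : ℕ} (hs : Squarefree s) (hs' : Squarefree s') (h : IsSquare (s * s')) : s = s' := by
  have s0 : 0 < s := Nat.pos_of_ne_zero hs.ne_zero
  have s0' : 0 < s' := Nat.pos_of_ne_zero hs'.ne_zero
  obtain ⟨g, u, v, hg, hco, rfl, rfl⟩ := Nat.exists_coprime' (m := s) (n := s') (Nat.gcd_pos_of_pos_left _ s0)
  have h1 : IsSquare (u * v) := by
    obtain ⟨k, hk⟩ := h
    have h2 : g ∣ k := by
      have : g ^ 2 ∣ k ^ 2 := ⟨u * v, by rw [sq k, ← hk]; ring⟩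
      exact (Nat.pow_dvd_pow_iff two_ne_zero).mp this
    obtain ⟨l, rfl⟩ := h2
    refine ⟨l, ?_⟩
    have : (g * g) * (u * v) = (g * g) * (l * l) := by linarith
    exact Nat.eq_of_mul_eq_mul_left (Nat.mul_pos hg hg) this
  obtain ⟨k, hk⟩ := h1
  have hu : ∃ a, u = a ^ 2 := by
    exact exists_eq_pow_of_mul_eq_pow (Nat.isUnit_iff.mpr hco) (show u * v = k ^ 2 by rw [hk, sq])
  have hv : ∃ a, v = a ^ 2 := by
    exact exists_eq_pow_of_mul_eq_pow (Nat.isUnit_iff.mpr hco.symm) (show v * u = k ^ 2 by rw [mul_comm, hk, sq])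
  obtain ⟨a, rfl⟩ := hu
  obtain ⟨b, rfl⟩ := hv
  have ha : a = 1 := by
    have := hs a (Dvd.intro g (by ring))
    exact Nat.isUnit_iff.mp this
  have hb : b = 1 := by
    have := hs' b (Dvd.intro g (by ring))
    exact Nat.isUnit_iff.mp this
  subst ha hb; rfl

open Classical in
noncomputable def GG (f : ℕ → ℝ) (x : ℕ × ℕ) : ℝ := if IsSquare (x.1 * x.2) then f x.1 * f x.2 / (x.1 * x.2) else 0

def Tr : Set (ℕ × ℕ × ℕ) := {t | Squarefree t.1 ∧ 0 < t.2.1 ∧ 0 < t.2.2}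

def iT (t : Tr) : ℕ × ℕ := (t.1.1 * t.1.2.1 ^ 2, t.1.1 * t.1.2.2 ^ 2)

lemma sq_cancel {x a : ℕ} (ha : 0 < a) (h : IsSquare (x * a ^ 2)) : IsSquare x := by
  obtain ⟨k, hk⟩ := h
  have h5 : a ∣ k := by
    have : a ^ 2 ∣ k ^ 2 := ⟨x, by rw [sq k, ← hk]; ring⟩
    exact (Nat.pow_dvd_pow_iff two_ne_zero).mp this
  obtain ⟨l, rfl⟩ := h5
  refine ⟨l, ?_⟩
  have : (a * a) * x = (a * a) * (l * l) := by linarith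
  exact Nat.eq_of_mul_eq_mul_left (Nat.mul_pos ha ha) this

lemma iT_inj : Function.Injective iT := by
  rintro ⟨⟨s, a, b⟩, hs, ha, hb⟩ ⟨⟨s', a', b'⟩, hs', ha', hb'⟩ h
  simp only [iT, Prod.mk.injEq] at h hs ha hb hs' ha' hb'
  obtain ⟨h1, h2⟩ := h
  have h3 : s = s' := by
    apply sqf_unique hs hs'
    exact sq_cancel (a := a') ha' ⟨s * a, by rw [show s * s' * a' ^ 2 = s * (s' * a' ^ 2) by ring, ← h1]; ring⟩
  subst h3
  have hs0 : 0 < s := Nat.pos_of_ne_zero hs.ne_zero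
  have h4 : a = a' := by
    have := Nat.eq_of_mul_eq_mul_left hs0 h1
    exact (Nat.pow_left_injective two_ne_zero) this
  have h5 : b = b' := by
    have := Nat.eq_of_mul_eq_mul_left hs0 h2
    exact (Nat.pow_left_injective two_ne_zero) this
  subst h4 h5; rfl

lemma supp (f : ℕ → ℝ) (x : ℕ × ℕ) (hx : x ∉ Set.range iT) : GG f x = 0 := by
  unfold GG
  split_ifs with h
  · obtain ⟨n, m⟩ := x
    simp only at h ⊢
    rcases Nat.eq_zero_or_pos n with hn | hn
    · simp [hn]
    rcases Nat.eq_zero_or_pos m with hm | hm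
    · simp [hm]
    exfalso; apply hx
    obtain ⟨s, a, hs, ha, e1, q1⟩ := Nat.sq_mul_squarefree_of_pos hn
    obtain ⟨s', b, hs', hb, e2, q2⟩ := Nat.sq_mul_squarefree_of_pos hm
    have h3 : s = s' := by
      apply sqf_unique q1 q2
      apply sq_cancel ha
      apply sq_cancel hb
      convert h using 1
      rw [← e1, ← e2]; ring
    subst h3
    refine ⟨⟨(s, a, b), q1, ha, hb⟩, ?_⟩
    simp only [iT, Prod.mk.injEq]
    exact ⟨by rw [← e1]; ring, by rw [← e2]; ring⟩
  · rfl

open Classical in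
noncomputable def uu (f : ℕ → ℝ) (s : ℕ) : ℝ := if Squarefree s then f s ^ 2 / s ^ 2 else 0

lemma summ_inv_sq : Summable (fun n : ℕ => ((n:ℝ) ^ 2)⁻¹) := Real.summable_nat_pow_inv.mpr (by norm_num)

lemma summ_uu (f : ℕ → ℝ) (hf : ∀ n, |f n| ≤ 1) : Summable (uu f) := by
  refine Summable.of_nonneg_of_le (fun n => ?_) (fun n => ?_) summ_inv_sq
  · unfold uu; split_ifs <;> positivity
  · unfold uu
    split_ifs
    · rw [div_eq_mul_inv]
      have : f n ^ 2 ≤ 1 := by rw [sq_le_one_iff_abs_le_one]; exact hf n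
      exact mul_le_of_le_one_left (by positivity) this
    · positivity

lemma summ_vv (e : ℕ → ℝ) (he : ∀ n, |e n| ≤ 1) : Summable (fun a : ℕ => e a / (a:ℝ) ^ 2) := by
  refine Summable.of_norm_bounded summ_inv_sq (fun n => ?_)
  rw [Real.norm_eq_abs, abs_div, div_eq_mul_inv, abs_of_nonneg (show (0:ℝ) ≤ (n:ℝ)^2 by positivity)]
  exact mul_le_of_le_one_left (by positivity) (he n)

noncomputable def FF (f e : ℕ → ℝ) (x : ℕ × (ℕ × ℕ)) : ℝ := uu f x.1 * ((e x.2.1 / (x.2.1:ℝ)^2) * (e x.2.2 / (x.2.2:ℝ)^2))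

lemma FF_sup (f e : ℕ → ℝ) : Function.support (FF f e) ⊆ Tr := by
  rintro ⟨s, a, b⟩ h
  simp only [Function.mem_support, FF, uu] at h
  refine ⟨?_, ?_, ?_⟩
  · by_contra hh; simp only at hh; rw [if_neg hh] at h; simp at h
  · by_contra hh; have : a = 0 := by simp only at hh; omega
    subst this; simp at h
  · by_contra hh; have : b = 0 := by simp only at hh; omega
    subst this; simp at h

lemma FF_eq (f e : ℕ → ℝ) (hfe : ∀ s a, 0 < a → f (s * a ^ 2) = f s * e a) (s a b : ℕ) (hs : Squarefree s) (ha : 0 < a) (hb : 0 < b) :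
    GG f (s * a ^ 2, s * b ^ 2) = FF f e (s, a, b) := by
  have s0 : (s:ℝ) ≠ 0 := by exact_mod_cast hs.ne_zero
  have a0 : (a:ℝ) ≠ 0 := by exact_mod_cast ha.ne'
  have b0 : (b:ℝ) ≠ 0 := by exact_mod_cast hb.ne'
  have hq : IsSquare (s * a ^ 2 * (s * b ^ 2)) := ⟨s * a * b, by ring⟩
  unfold GG FF uu
  simp only
  rw [if_pos hs, if_pos hq, hfe s a ha, hfe s b hb]
  push_cast
  field_simp

lemma FF_sum (f e : ℕ → ℝ) (hf : ∀ n, |f n| ≤ 1) (he : ∀ n, |e n| ≤ 1) :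
    HasSum (FF f e) ((∑' s, uu f s) * ((∑' a : ℕ, e a / (a:ℝ) ^ 2) * (∑' a : ℕ, e a / (a:ℝ) ^ 2))) := by
  have hu := summ_uu f hf
  have hv := summ_vv e he
  obtain ⟨v, hvd⟩ : ∃ v : ℕ → ℝ, v = fun a : ℕ => e a / (a:ℝ) ^ 2 := ⟨_, rfl⟩
  rw [← hvd] at hv ⊢
  have hvv : Summable (fun x : ℕ × ℕ => v x.1 * v x.2) := summable_mul_of_summable_norm hv.norm hv.norm
  have h2 : HasSum (fun x : ℕ × ℕ => v x.1 * v x.2) ((∑' a, v a) * ∑' a, v a) := hv.hasSum.mul hv.hasSum hvv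
  have e1 : FF f e = fun x : ℕ × (ℕ × ℕ) => uu f x.1 * (fun x : ℕ × ℕ => v x.1 * v x.2) x.2 := by
    funext x; simp only [FF, hvd]
  rw [e1]
  obtain ⟨g, hg⟩ : ∃ g : ℕ × ℕ → ℝ, g = fun x : ℕ × ℕ => v x.1 * v x.2 := ⟨_, rfl⟩
  rw [← hg] at hvv h2 ⊢
  have huv : Summable (fun x : ℕ × (ℕ × ℕ) => uu f x.1 * g x.2) := summable_mul_of_summable_norm hu.norm hvv.norm
  exact hu.hasSum.mul h2 huv

theorem hasSum_GG (f e : ℕ → ℝ) (hf : ∀ n, |f n| ≤ 1) (he : ∀ n, |e n| ≤ 1)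
    (hfe : ∀ s a, 0 < a → f (s * a ^ 2) = f s * e a) :
    HasSum (GG f) ((∑' s, uu f s) * ((∑' a : ℕ, e a / (a:ℝ) ^ 2) * (∑' a : ℕ, e a / (a:ℝ) ^ 2))) := by
  have h4 := (hasSum_subtype_iff_of_support_subset (FF_sup f e)).mpr (FF_sum f e hf he)
  have heq : GG f ∘ iT = FF f e ∘ (Subtype.val : Tr → _) := by
    funext t
    exact FF_eq f e hfe _ _ _ t.2.1 t.2.2.1 t.2.2.2
  rw [← Function.Injective.hasSum_iff iT_inj (supp f), heq]
  exact h4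

open Classical in
theorem hasSum_sq (f e : ℕ → ℝ) (he : ∀ n, |e n| ≤ 1)
    (hfe : ∀ s a, 0 < a → f (s * a ^ 2) = f s * e a) :
    HasSum (fun n : ℕ => if IsSquare n then f n / n else 0) (f 1 * (∑' a : ℕ, e a / (a:ℝ) ^ 2)) := by
  have h1 := (summ_vv e he).hasSum.mul_left (f 1)
  have hinj : Function.Injective (fun a : ℕ => a ^ 2) := Nat.pow_left_injective two_ne_zero
  rw [← Function.Injective.hasSum_iff hinj]
  · have heq : ((fun n : ℕ => if IsSquare n then f n / n else 0) ∘ fun a : ℕ => a ^ 2) = fun i => f 1 * (e i / (i:ℝ) ^ 2) := ?_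
    · rw [heq]; exact h1
    funext a
    simp only [Function.comp]
    rw [if_pos ⟨a, by ring⟩]
    rcases Nat.eq_zero_or_pos a with h | h
    · subst h; simp
    · have := hfe 1 a h
      rw [one_mul] at this
      rw [this]; push_cast; ring
  · intro n hn
    rw [if_neg]
    rintro ⟨k, rfl⟩
    exact hn ⟨k, by simp only; ring⟩

lemma summ_GG1 : Summable (GG (fun _ => 1)) :=
  (hasSum_GG (fun _ => 1) (fun _ => 1) (by simp) (by simp) (by simp)).summable

theorem Sq_tail (ε : ℝ) (hε : 0 < ε) : ∃ y0 : ℕ, ∀ y ≥ y0, ∀ X, Sq y X ≤ ε := by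
  obtain ⟨t, ht⟩ := (summable_iff_vanishing_norm.mp summ_GG1) ε hε
  refine ⟨t.sup Prod.fst + 1, fun y hy X => ?_⟩
  have h := ht (Ico y X ×ˢ Ico y X) (by
    rw [Finset.disjoint_left]
    rintro ⟨n, m⟩ hnm hh
    have : n ≤ t.sup Prod.fst := Finset.le_sup (f := Prod.fst) hh
    simp only [mem_product, mem_Ico] at hnm
    omega)
  have h2 : Sq y X = ∑ x ∈ Ico y X ×ˢ Ico y X, GG (fun _ => 1) x := by
    rw [sum_product]
    unfold Sq GG
    refine sum_congr rfl fun n _ => sum_congr rfl fun m _ => ?_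
    simp only [one_mul, one_div]
  rw [h2]
  exact (le_abs_self _).trans h.le

end SM
end

section
namespace SM
open Filter Topology Finset

lemma exists_odd_fact (n : ℕ) (hn : 0 < n) (h : ¬ IsSquare n) : ∃ q e m, q.Prime ∧ Odd e ∧ ¬ q ∣ m ∧ n = q ^ e * m := by
  have : ∃ q, q.Prime ∧ Odd (n.factorization q) := by
    by_contra hcon
    push Not at hcon
    apply h
    have h1 : ∀ q ∈ n.primeFactors, Even (n.factorization q) := by
      intro q hq
      exact Nat.not_odd_iff_even.mp (hcon q (Nat.prime_of_mem_primeFactors hq))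
    rw [← Nat.prod_factorization_pow_eq_self hn.ne']
    refine Finset.isSquare_prod _ fun q hq => ?_
    exact (h1 q hq).isSquare_pow q
  obtain ⟨q, hq, ho⟩ := this
  exact ⟨q, n.factorization q, n / q ^ n.factorization q, hq, ho, Nat.not_dvd_ordCompl hq hn.ne', (Nat.ordProj_mul_ordCompl_eq_self n q).symm⟩

lemma exists_u (K n : ℕ) (hn : Odd n) (hK : Nat.Coprime n K) (h : ¬ IsSquare n) :
    ∃ u : ℕ, (u : ZMod K) = 1 ∧ jacobiSym u n = -1 := by
  obtain ⟨q, e, m, hq, he, hqm, rfl⟩ := exists_odd_fact n hn.pos h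
  have he0 : e ≠ 0 := by rintro rfl; simp at he
  have hq2 : q ≠ 2 := by
    rintro rfl
    have h2 := (Nat.odd_mul.mp hn).1
    exact absurd ((Nat.odd_pow_iff he0).mp h2) (by decide)
  have hqK : Nat.Coprime q K := by
    have := Nat.Coprime.coprime_mul_right hK
    exact (Nat.coprime_pow_left_iff (Nat.pos_of_ne_zero he0) _ _).mp this
  have hqm' : Nat.Coprime q m := (Nat.Prime.coprime_iff_not_dvd hq).mpr hqm
  obtain ⟨u, hu1, hu2⟩ := PV.exists_nonres q hq hq2 (K * m) (hqK.mul_right hqm')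
  refine ⟨u, ?_, ?_⟩
  · have := congrArg (ZMod.castHom (dvd_mul_right K m) (ZMod K)) hu1
    simpa using this
  · have hum : jacobiSym u m = 1 := by
      have h3 : ((u:ℕ) : ZMod m) = ((1:ℕ) : ZMod m) := by
        have := congrArg (ZMod.castHom (dvd_mul_left m K) (ZMod m)) hu1
        simpa using this
      have h4 : (u : ℤ) % m = 1 % m := by
        have := (ZMod.natCast_eq_natCast_iff' _ _ _).mp h3
        exact_mod_cast this
      rw [jacobiSym.mod_left, h4, ← jacobiSym.mod_left, jacobiSym.one_left]
    have : NeZero m := ⟨by rintro rfl; simp at hn⟩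
    have : NeZero q := ⟨hq.ne_zero⟩
    rw [jacobiSym.mul_right, jacobiSym.pow_right, hu2, hum, he.neg_one_pow, mul_one]

/-- weighted sum over primes in a class -/
noncomputable def av {K : ℕ} (r : ZMod K) (F : ℕ → ℝ) (N : ℕ) : ℝ := (∑ p ∈ PNT.cls r N, F p) * Real.log N / N

lemma char_sum_zero (K n : ℕ) [NeZero (K * n)] (r : ZMod K) (hn : Odd n) (hK : Nat.Coprime n K) (h : ¬ IsSquare n) :
    ∑ a ∈ (univ : Finset (ZMod (K * n))).filter (fun a => ZMod.castHom (dvd_mul_right K n) (ZMod K) a = r), (jacobiSym a.val n : ℝ) = 0 := by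
  obtain ⟨u, hu1, hu2⟩ := exists_u K n hn hK h
  have hval : ∀ x : ℕ, jacobiSym (((x : ZMod (K * n)).val : ℕ) : ℤ) n = jacobiSym x n := by
    intro x
    rw [ZMod.val_natCast, jacobiSym.mod_left, jacobiSym.mod_left (x:ℤ)]
    congr 1
    have : x % (K * n) % n = x % n := Nat.mod_mul_left_mod x K n
    exact_mod_cast this
  have hcop : Nat.Coprime u (K * n) := by
    apply Nat.Coprime.mul_right
    · have : IsUnit ((u:ℕ) : ZMod K) := by rw [hu1]; exact isUnit_one
      exact (ZMod.isUnit_iff_coprime u K).mp this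
    · have hne : NeZero n := ⟨by rintro rfl; simp at hn⟩
      by_contra hc
      have : jacobiSym u n = 0 := jacobiSym.eq_zero_iff_not_coprime.mpr (by simpa [Int.gcd_natCast_natCast] using hc)
      omega
  have hun : IsUnit ((u:ℕ) : ZMod (K * n)) := (ZMod.isUnit_iff_coprime u (K * n)).mpr hcop
  obtain ⟨U, hU⟩ := hun
  set S := ∑ a ∈ (univ : Finset (ZMod (K * n))).filter (fun a => ZMod.castHom (dvd_mul_right K n) (ZMod K) a = r), (jacobiSym a.val n : ℝ) with hS
  have hUc : ZMod.castHom (dvd_mul_right K n) (ZMod K) (U : ZMod (K * n)) = 1 := by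
    rw [hU, map_natCast, hu1]
  have h2 : S = ∑ a ∈ (univ : Finset (ZMod (K * n))).filter (fun a => ZMod.castHom (dvd_mul_right K n) (ZMod K) a = r), (jacobiSym ((U : ZMod (K * n)) * a).val n : ℝ) := by
    rw [hS]
    symm
    refine sum_bij (fun a _ => (U : ZMod (K * n)) * a) ?_ ?_ ?_ ?_
    · intro a ha
      simp only [mem_filter, mem_univ, true_and] at ha ⊢
      rw [map_mul, hUc, ha, one_mul]
    · intro a _ b _ hab
      exact U.isUnit.mul_left_cancel hab
    · intro b hb
      refine ⟨(↑U⁻¹ : ZMod (K * n)) * b, ?_, by simp⟩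
      simp only [mem_filter, mem_univ, true_and] at hb ⊢
      have h3 : ZMod.castHom (dvd_mul_right K n) (ZMod K) (↑U⁻¹ : ZMod (K * n)) = 1 := by
        have : ZMod.castHom (dvd_mul_right K n) (ZMod K) ((U : ZMod (K * n)) * (↑U⁻¹ : ZMod (K * n))) = 1 := by simp
        rw [map_mul, hUc, one_mul] at this; exact this
      rw [map_mul, h3, hb, one_mul]
    · intros; rfl
  have h3 : S = -S := by
    conv_lhs => rw [h2]
    rw [hS, ← sum_neg_distrib]
    refine sum_congr rfl fun a _ => ?_
    have : jacobiSym ((U : ZMod (K * n)) * a).val n = - jacobiSym a.val n := by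
      rw [hU]
      conv_lhs => rw [← ZMod.natCast_zmod_val a, ← Nat.cast_mul]
      rw [hval]; push_cast
      rw [jacobiSym.mul_left, hu2]; ring
    rw [this]; push_cast; rfl
  linarith

theorem av_nonsq (K n : ℕ) [NeZero K] (r : ZMod K) (hr : IsUnit r) (hn : Odd n) (hK : Nat.Coprime n K) (h : ¬ IsSquare n) :
    Tendsto (av r (fun p => (jacobiSym p n : ℝ))) atTop (𝓝 0) := by
  have hne : NeZero n := ⟨by rintro rfl; simp at hn⟩
  have hKn : NeZero (K * n) := inferInstance
  set A := (univ : Finset (ZMod (K * n))).filter (fun a => ZMod.castHom (dvd_mul_right K n) (ZMod K) a = r)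
  have h1 : ∀ N, av r (fun p => (jacobiSym p n : ℝ)) N = ∑ a ∈ A, (jacobiSym a.val n : ℝ) * ((PNT.cls a N).card * Real.log N / N) := by
    intro N
    have : ∑ p ∈ PNT.cls r N, (jacobiSym p n : ℝ) = ∑ a ∈ A, (jacobiSym a.val n : ℝ) * (PNT.cls a N).card := by
      rw [← sum_fiberwise_of_maps_to (s := PNT.cls r N) (t := A) (g := fun p : ℕ => ((p : ℕ) : ZMod (K * n)))]
      · refine sum_congr rfl fun a ha => ?_
        have hset : (PNT.cls r N).filter (fun p : ℕ => ((p : ℕ) : ZMod (K * n)) = a) = PNT.cls a N := by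
          ext p
          simp only [PNT.cls, mem_filter, A, mem_univ, true_and] at ha ⊢
          constructor
          · rintro ⟨⟨h1, h2, _⟩, h3⟩; exact ⟨h1, h2, h3⟩
          · rintro ⟨h1, h2, h3⟩
            refine ⟨⟨h1, h2, ?_⟩, h3⟩
            rw [← ha, ← h3, map_natCast]
        rw [hset, mul_comm (jacobiSym a.val n : ℝ), ← nsmul_eq_mul, ← sum_const]
        refine sum_congr rfl fun p hp => ?_
        simp only [PNT.cls, mem_filter] at hp
        rw [← hp.2.2, ZMod.val_natCast]
        congr 1
        rw [jacobiSym.mod_left, jacobiSym.mod_left ((p % (K * n) : ℕ) : ℤ)]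
        congr 1
        have : p % (K * n) % n = p % n := Nat.mod_mul_left_mod p K n
        exact_mod_cast this.symm
      · intro p hp
        simp only [PNT.cls, mem_filter, A, mem_univ, true_and] at hp ⊢
        rw [map_natCast]; exact hp.2.2
    unfold av
    rw [this, sum_mul, sum_div]
    refine sum_congr rfl fun a _ => by ring
  have h2 : Tendsto (fun N : ℕ => ∑ a ∈ A, (jacobiSym a.val n : ℝ) * ((PNT.cls a N).card * Real.log N / N)) atTop
      (𝓝 (∑ a ∈ A, (jacobiSym a.val n : ℝ) * ((K * n).totient : ℝ)⁻¹)) := by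
    refine tendsto_finsetSum _ fun a ha => ?_
    by_cases hu : IsUnit a
    · exact (PNT.cls_tendsto a hu).const_mul _
    · have : jacobiSym a.val n = 0 := by
        apply jacobiSym.eq_zero_iff_not_coprime.mpr
        intro hc
        apply hu
        rw [← ZMod.natCast_zmod_val a, ZMod.isUnit_iff_coprime]
        apply Nat.Coprime.mul_right
        · rw [← ZMod.isUnit_iff_coprime]
          simp only [A, mem_filter, mem_univ, true_and] at ha
          have : ((a.val : ℕ) : ZMod K) = r := by
            rw [← ha]; conv_rhs => rw [← ZMod.natCast_zmod_val a, map_natCast]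
          rw [this]; exact hr
        · rw [Int.gcd_natCast_natCast] at hc; exact hc
      rw [this]; simp
  rw [← sum_mul, char_sum_zero K n r hn hK h, zero_mul] at h2
  exact h2.congr (fun N => (h1 N).symm)

theorem av_one (K : ℕ) [NeZero K] (r : ZMod K) (hr : IsUnit r) :
    Tendsto (av r (fun _ => 1)) atTop (𝓝 (K.totient : ℝ)⁻¹) := by
  refine (PNT.cls_tendsto r hr).congr fun N => ?_
  unfold av; simp

lemma log_div_tendsto : Tendsto (fun N : ℕ => Real.log N / N) atTop (𝓝 0) := by
  have := (Real.isLittleO_log_id_atTop.tendsto_div_nhds_zero).comp tendsto_natCast_atTop_atTop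
  exact this

theorem av_sq (K n : ℕ) [NeZero K] (r : ZMod K) (hr : IsUnit r) (hn : 0 < n) (h : IsSquare n) :
    Tendsto (av r (fun p => (jacobiSym p n : ℝ))) atTop (𝓝 (K.totient : ℝ)⁻¹) := by
  have h1 := av_one K r hr
  have h2 : Tendsto (fun N : ℕ => (n:ℝ) * (Real.log N / N)) atTop (𝓝 0) := by
    simpa using log_div_tendsto.const_mul (n:ℝ)
  have h3 : ∀ N, |av r (fun p => (jacobiSym p n : ℝ)) N - av r (fun _ => 1) N| ≤ n * (Real.log N / N) := by
    intro N
    have hl : 0 ≤ Real.log (N:ℝ) / N := div_nonneg (Real.log_natCast_nonneg N) (by positivity)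
    unfold av
    rw [← sub_div, ← sub_mul, ← sum_sub_distrib, mul_div_assoc, abs_mul, abs_of_nonneg hl]
    refine mul_le_mul_of_nonneg_right ?_ hl
    refine (abs_sum_le_sum_abs _ _).trans ?_
    have h4 : ∀ p ∈ PNT.cls r N, |(jacobiSym p n : ℝ) - 1| ≤ if p ≤ n then 1 else 0 := by
      intro p hp
      have hpp : p.Prime := (mem_filter.mp hp).2.1
      obtain ⟨k, rfl⟩ := h
      have hk0 : k ≠ 0 := by rintro rfl; simp at hn
      have : NeZero k := ⟨hk0⟩
      rw [jacobiSym.mul_right]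
      by_cases hd : p ∣ k
      · have hle : p ≤ k * k := (Nat.le_of_dvd (Nat.pos_of_ne_zero hk0) hd).trans (Nat.le_mul_self k)
        have : jacobiSym p k = 0 := by
          apply jacobiSym.eq_zero_iff_not_coprime.mpr
          rw [Int.gcd_natCast_natCast]
          intro hc
          exact hpp.one_lt.ne' (Nat.Coprime.eq_one_of_dvd hc hd)
        rw [this, if_pos hle]; norm_num
      · have : jacobiSym p k ≠ 0 := by
          intro h0
          have := jacobiSym.eq_zero_iff_not_coprime.mp h0
          rw [Int.gcd_natCast_natCast] at this
          exact this ((Nat.Prime.coprime_iff_not_dvd hpp).mpr hd)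
        have h5 : jacobiSym p k * jacobiSym p k = 1 := by
          rcases jacobiSym.trichotomy p k with h | h | h
          · exact absurd h this
          · rw [h]; rfl
          · rw [h]; rfl
        rw [h5]
        simp only [Int.cast_one, sub_self, abs_zero]
        split_ifs <;> norm_num
    refine (sum_le_sum h4).trans ?_
    rw [← sum_filter, sum_const, nsmul_eq_mul, mul_one]
    have : ((PNT.cls r N).filter (· ≤ n)) ⊆ Icc 1 n := by
      intro p hp
      simp only [PNT.cls, mem_filter, mem_Icc] at hp ⊢
      exact ⟨hp.1.2.1.one_lt.le, hp.2⟩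
    have := card_le_card this
    rw [Nat.card_Icc, Nat.add_sub_cancel] at this
    exact_mod_cast this
  have h4 := squeeze_zero_norm (f := fun N : ℕ => av r (fun p => (jacobiSym p n : ℝ)) N - av r (fun _ => 1) N) (fun N => by rw [Real.norm_eq_abs]; exact h3 N) h2
  have h5 := h4.add h1
  rw [zero_add] at h5
  exact h5.congr fun N => by ring

end SM
end

section
namespace SM
open Filter Topology Finset

/-- partial sums of the twisted series -/
noncomputable def Zy (c : ℕ → ℝ) (y p : ℕ) : ℝ := ∑ n ∈ range y, c n * (jacobiSym p n : ℝ) / n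

lemma div_le_of_R {a b x : ℝ} (hx : 0 < x) (h : a * x ≤ b) : a ≤ b / x := (le_div_iff₀ hx).mpr h

lemma sq_add_le' (a b : ℝ) : (a + b) ^ 2 ≤ 2 * a ^ 2 + 2 * b ^ 2 := by nlinarith [sq_nonneg (a - b)]

lemma tail_R {K : ℕ} (r : ZMod K) (hKe : Even K) (c : ℕ → ℝ) (hc : ∀ n, |c n| ≤ 1)
    (hc0 : ∀ n, ¬ Nat.Coprime n K → c n = 0) (Z : ℕ → ℝ) (A : ℝ) (hA : 0 ≤ A)
    (hZ : ∀ p : ℕ, p.Prime → (p : ZMod K) = r → ∀ s : ℕ, p ≤ s ^ 4 → ∀ M : ℕ, 1 ≤ M →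
      |Z p - Zy c M p| ≤ A * s ^ 3 / M)
    (y R N X : ℕ) (hy : 1 ≤ y) (hR : 2 ≤ R) (hX : (X : ℝ) = ((R : ℝ) + 1) ^ 32) (hRy : y ≤ X)
    (hNr2 : (R : ℝ) ^ 40 ≤ N) (hN' : (N : ℝ) ≤ ((R : ℝ) + 1) ^ 40) :
    av r (fun p => (Z p - Zy c y p) ^ 2) N ≤ 400 * Sq y X + (120 * A ^ 2 + 20800 * 2 ^ 32) / R := by
  set L := Real.log N with hL
  have hSq : 0 ≤ Sq y X := by
    unfold Sq
    refine sum_nonneg fun n _ => sum_nonneg fun n' _ => ?_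
    split_ifs <;> positivity
  have hR1 : 1 ≤ R := by omega
  have hRr : (2:ℝ) ≤ R := by exact_mod_cast hR
  have hNr : (0:ℝ) < N := lt_of_lt_of_le (by positivity) hNr2
  have hL0 : 0 ≤ L := Real.log_natCast_nonneg N
  have hlog1 : Real.log (R + 1 : ℝ) ≤ R := by
    have := Real.log_le_sub_one_of_pos (show (0:ℝ) < R + 1 by positivity)
    linarith
  have hL1 : L ≤ 40 * Real.log (R + 1 : ℝ) := by
    have h1 : L ≤ Real.log ((R + 1 : ℝ) ^ 40) := by
      exact Real.log_le_log hNr hN'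
    rwa [Real.log_pow] at h1
  have hpN' : ∀ p : ℕ, p < N + 1 → p ≤ ((R + 1) ^ 10) ^ 4 := by
    intro p hpN
    have h0 : (p:ℝ) ≤ N := by exact_mod_cast Nat.lt_succ_iff.mp hpN
    have h00 : (p:ℝ) ≤ (((R + 1) ^ 10) ^ 4 : ℕ) := by
      push_cast
      rw [← pow_mul]
      exact h0.trans hN'
    exact Nat.cast_le.mp h00
  clear hN'
  have hAX : A * (((R + 1) ^ 10 : ℕ) : ℝ) ^ 3 / (X : ℕ) = A / ((R:ℝ) + 1) ^ 2 := by
    rw [hX]; push_cast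
    field_simp
  have hX1 : (X:ℝ) ≤ 2 ^ 32 * (R:ℝ) ^ 32 := by
    rw [hX, ← mul_pow]
    clear hX hAX
    exact pow_le_pow_left₀ (by positivity) (by linarith) 32
  have hX2 : 1 + 2 * Real.log X ≤ 65 * R := by
    rw [hX, Real.log_pow]
    clear hX hAX
    push_cast
    linarith
  clear hX
  have hlog2 : Real.log (R + 1 : ℝ) ≤ 2 * Real.log R := by
    have h1 : Real.log (R + 1 : ℝ) ≤ Real.log ((R:ℝ) ^ 2) := by
      apply Real.log_le_log (by positivity)
      nlinarith
    rw [Real.log_pow] at h1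
    exact_mod_cast h1
  have hV := Sel.V_ge R
  have hVpos : 0 < Sel.V R := Sel.V_pos hR1
  have hL2 : L ≤ 40 * R := by linarith
  have hLV : L ≤ 160 * Sel.V R := by linarith
  -- pointwise
  set E : ℕ → ℝ := fun p => ∑ n ∈ Ico y X, c n * (jacobiSym p n : ℝ) / n with hE
  have hpt : ∀ p ∈ PNT.cls r N, (Z p - Zy c y p) ^ 2 ≤ (if p ≤ R then A ^ 2 * (R:ℝ) ^ 6 else 0) + 2 * (A / (R + 1) ^ 2) ^ 2 + 2 * (w R p * E p ^ 2) := by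
    intro p hp
    simp only [PNT.cls, mem_filter, mem_range] at hp
    obtain ⟨hpN, hpp, hpr⟩ := hp
    have hw := w_nonneg R p
    have hwE : 0 ≤ 2 * (w R p * E p ^ 2) := by positivity
    have hq : 0 ≤ 2 * (A / ((R:ℝ) + 1) ^ 2) ^ 2 := by positivity
    split_ifs with hpR
    · have h1 := hZ p hpp hpr R (hpR.trans (Nat.le_self_pow (by norm_num) R)) y hy
      have h2 : A * (R:ℝ) ^ 3 / y ≤ A * (R:ℝ) ^ 3 := by
        apply div_le_self (by positivity)
        exact_mod_cast hy
      have h3 : (Z p - Zy c y p) ^ 2 ≤ (A * (R:ℝ) ^ 3) ^ 2 := by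
        rw [← sq_abs]
        exact pow_le_pow_left₀ (abs_nonneg _) (h1.trans h2) 2
      have : (A * (R:ℝ) ^ 3) ^ 2 = A ^ 2 * (R:ℝ) ^ 6 := by ring
      linarith
    · push Not at hpR
      rw [w_prime R p hR1 hpp hpR, one_mul, zero_add]
      have h1 := hZ p hpp hpr ((R + 1) ^ 10) (hpN' p hpN) X (hy.trans hRy)
      rw [hAX] at h1
      have h3 : Zy c X p - Zy c y p = E p := by
        simp only [Zy, hE]
        rw [sum_Ico_eq_sub _ hRy]
      have h4 : (Z p - Zy c X p) ^ 2 ≤ (A / ((R:ℝ) + 1) ^ 2) ^ 2 := by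
        rw [← sq_abs]
        exact pow_le_pow_left₀ (abs_nonneg _) h1 2
      have h5 : Z p - Zy c y p = (Z p - Zy c X p) + E p := by linarith
      rw [h5]
      have h6 := sq_add_le' (Z p - Zy c X p) (E p)
      linarith
  have hsub : PNT.cls r N ⊆ Icc 1 N := by
    intro p hp
    simp only [PNT.cls, mem_filter, mem_range, mem_Icc] at hp ⊢
    exact ⟨hp.2.1.one_lt.le, by omega⟩
  have hI1 := I1 N R y X hR1 c hc (fun n hn => hc0 n (fun hcop => hn (by
    rcases Nat.even_or_odd n with he | ho
    · exfalso
      have : 2 ∣ Nat.gcd n K := Nat.dvd_gcd he.two_dvd hKe.two_dvd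
      rw [hcop] at this
      omega
    · exact ho)))
  have hsum : ∑ p ∈ PNT.cls r N, (Z p - Zy c y p) ^ 2 ≤ R * (A ^ 2 * (R:ℝ) ^ 6) + N * (2 * (A / (R + 1) ^ 2) ^ 2)
      + 2 * ((N / Sel.V R + R ^ 4) * Sq y X + R ^ 4 * (4 * X * (1 + 2 * Real.log X))) := by
    refine (sum_le_sum hpt).trans ?_
    refine (sum_le_sum_of_subset_of_nonneg hsub (fun p _ _ => ?_)).trans ?_
    · have hw := w_nonneg R p
      split_ifs <;> positivity
    rw [sum_add_distrib, sum_add_distrib]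
    refine add_le_add (add_le_add ?_ ?_) ?_
    · rw [← sum_filter, sum_const, nsmul_eq_mul]
      refine mul_le_mul_of_nonneg_right ?_ (by positivity)
      have : (Icc 1 N).filter (· ≤ R) ⊆ Icc 1 R := by
        intro p hp
        simp only [mem_filter, mem_Icc] at hp ⊢
        omega
      have := card_le_card this
      rw [Nat.card_Icc, Nat.add_sub_cancel] at this
      exact_mod_cast this
    · rw [sum_const, nsmul_eq_mul, Nat.card_Icc, Nat.add_sub_cancel]
    · rw [← mul_sum]
      exact mul_le_mul_of_nonneg_left hI1 (by norm_num)
  unfold av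
  have hpos : 0 ≤ L / N := by positivity
  have hLN : L / N ≤ 40 * R / (R:ℝ) ^ 40 := div_le_div₀ (by positivity) hL2 (by positivity) hNr2
  have hRp : (0:ℝ) < R := by linarith
  have hR1' : (1:ℝ) ≤ R := by linarith
  have hpowle : ∀ i j : ℕ, i ≤ j → (R:ℝ) ^ i ≤ (R:ℝ) ^ j := fun i j hij => pow_le_pow_right₀ hR1' hij
  have hdiv : ∀ i : ℕ, i ≤ 38 → (R:ℝ) ^ i * (40 * R / (R:ℝ) ^ 40) ≤ 40 / R := by
    intro i hi
    rw [mul_div_assoc', div_le_div_iff₀ (by positivity) hRp]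
    have := hpowle (i + 2) 40 (by omega)
    calc (R:ℝ) ^ i * (40 * R) * R = 40 * R ^ (i + 2) := by ring
      _ ≤ 40 * R ^ 40 := by linarith
  have hdiv' : ∀ i : ℕ, i ≤ 38 → (R:ℝ) ^ i * (L / N) ≤ 40 / R := fun i hi =>
    (mul_le_mul_of_nonneg_left hLN (by positivity)).trans (hdiv i hi)
  have t1 : R * (A ^ 2 * (R:ℝ) ^ 6) * (L / N) ≤ 40 * A ^ 2 / R := by
    have := mul_le_mul_of_nonneg_left (hdiv' 7 (by norm_num)) (sq_nonneg A)
    calc R * (A ^ 2 * (R:ℝ) ^ 6) * (L / N) = A ^ 2 * (R ^ 7 * (L / N)) := by ring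
      _ ≤ A ^ 2 * (40 / R) := this
      _ = _ := by ring
  have t2 : N * (2 * (A / ((R:ℝ) + 1) ^ 2) ^ 2) * (L / N) ≤ 80 * A ^ 2 / R := by
    have e : N * (2 * (A / ((R:ℝ) + 1) ^ 2) ^ 2) * (L / N) = 2 * A ^ 2 * (L / (R + 1) ^ 4) := by
      field_simp
    rw [e]
    have : L / ((R:ℝ) + 1) ^ 4 ≤ 40 / R := by
      rw [div_le_div_iff₀ (by positivity) hRp]
      have h1 : (R:ℝ) ^ 2 ≤ (R + 1) ^ 4 :=
        (hpowle 2 4 (by norm_num)).trans (pow_le_pow_left₀ hRp.le (by linarith) 4)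
      nlinarith
    calc _ ≤ 2 * A ^ 2 * (40 / R) := mul_le_mul_of_nonneg_left this (by positivity)
      _ = _ := by ring
  have t3 : (N / Sel.V R) * Sq y X * (L / N) ≤ 160 * Sq y X := by
    have e : (N / Sel.V R) * Sq y X * (L / N) = (L / Sel.V R) * Sq y X := by field_simp
    rw [e]
    exact mul_le_mul_of_nonneg_right ((div_le_iff₀ hVpos).mpr hLV) hSq
  have t4 : (R:ℝ) ^ 4 * Sq y X * (L / N) ≤ 40 * Sq y X := by
    have h1 := hdiv' 4 (by norm_num)
    have h2 : 40 / (R:ℝ) ≤ 40 := div_le_self (by norm_num) hR1'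
    calc (R:ℝ) ^ 4 * Sq y X * (L / N) = ((R:ℝ) ^ 4 * (L / N)) * Sq y X := by ring
      _ ≤ 40 * Sq y X := mul_le_mul_of_nonneg_right (h1.trans h2) hSq
  have t5 : (R:ℝ) ^ 4 * (4 * X * (1 + 2 * Real.log X)) * (L / N) ≤ 10400 * 2 ^ 32 / R := by
    have hX3 : 0 ≤ 1 + 2 * Real.log (X:ℝ) := by
      have := Real.log_natCast_nonneg X
      linarith
    have h6 : 4 * X * (1 + 2 * Real.log X) ≤ 4 * (2 ^ 32 * (R:ℝ) ^ 32) * (65 * R) :=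
      mul_le_mul (by linarith) hX2 hX3 (by positivity)
    have h7 : (R:ℝ) ^ 4 * (4 * X * (1 + 2 * Real.log X)) ≤ 260 * 2 ^ 32 * R ^ 37 := by
      calc _ ≤ (R:ℝ) ^ 4 * (4 * (2 ^ 32 * (R:ℝ) ^ 32) * (65 * R)) := mul_le_mul_of_nonneg_left h6 (by positivity)
        _ = _ := by ring
    calc _ ≤ 260 * 2 ^ 32 * R ^ 37 * (L / N) := mul_le_mul_of_nonneg_right h7 hpos
      _ = 260 * 2 ^ 32 * (R ^ 37 * (L / N)) := by ring
      _ ≤ 260 * 2 ^ 32 * (40 / R) := mul_le_mul_of_nonneg_left (hdiv' 37 (by norm_num)) (by norm_num)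
      _ = _ := by ring
  rw [mul_div_assoc]
  refine (mul_le_mul_of_nonneg_right hsum hpos).trans ?_
  have e1 : (120 * A ^ 2 + 20800 * 2 ^ 32) / (R:ℝ) = 40 * A ^ 2 / R + 80 * A ^ 2 / R + 2 * (10400 * 2 ^ 32 / R) := by ring
  rw [e1]
  calc _ = R * (A ^ 2 * (R:ℝ) ^ 6) * (L / N) + N * (2 * (A / ((R:ℝ) + 1) ^ 2) ^ 2) * (L / N)
      + 2 * ((N / Sel.V R) * Sq y X * (L / N) + (R:ℝ) ^ 4 * Sq y X * (L / N) + (R:ℝ) ^ 4 * (4 * X * (1 + 2 * Real.log X)) * (L / N)) := by ring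
    _ ≤ _ := by linarith

lemma exists_R_aux (N : ℕ) (P : ℕ → Prop) [DecidablePred P] (h0 : P 0) (h : ∀ n, P n → n ≤ N) :
    ∃ R, P R ∧ ¬ P (R + 1) := by
  refine ⟨Nat.findGreatest P N, Nat.findGreatest_spec (P := P) (m := 0) (Nat.zero_le _) h0, fun hcon => ?_⟩
  have := Nat.le_findGreatest (P := P) (h _ hcon) hcon
  omega

lemma exists_R (N m : ℕ) (h : m ^ 40 ≤ N) :
    ∃ R : ℕ, m ≤ R ∧ (R : ℝ) ^ 40 ≤ N ∧ (N : ℝ) ≤ ((R : ℝ) + 1) ^ 40 := by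
  obtain ⟨R, h1, h2⟩ := exists_R_aux N (fun R => R ^ 40 ≤ N) (by simp) (fun n hn => (Nat.le_self_pow (by norm_num) n).trans hn)
  have h3 := not_le.mp h2
  refine ⟨R, ?_, ?_, ?_⟩
  · exact Nat.lt_succ_iff.mp (lt_of_pow_lt_pow_left₀ 40 (Nat.zero_le _) (lt_of_le_of_lt h h3))
  · have : ((R ^ 40 : ℕ) : ℝ) ≤ N := Nat.cast_le.mpr h1
    rwa [Nat.cast_pow] at this
  · have : (N : ℝ) ≤ (((R + 1) ^ 40 : ℕ) : ℝ) := Nat.cast_le.mpr h3.le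
    rwa [Nat.cast_pow, Nat.cast_add, Nat.cast_one] at this

theorem tail {K : ℕ} (r : ZMod K) (hKe : Even K) (c : ℕ → ℝ) (hc : ∀ n, |c n| ≤ 1)
    (hc0 : ∀ n, ¬ Nat.Coprime n K → c n = 0) (Z : ℕ → ℝ) (A : ℝ) (hA : 0 ≤ A)
    (hZ : ∀ p : ℕ, p.Prime → (p : ZMod K) = r → ∀ s : ℕ, p ≤ s ^ 4 → ∀ M : ℕ, 1 ≤ M →
      |Z p - Zy c M p| ≤ A * s ^ 3 / M) (ε : ℝ) (hε : 0 < ε) :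
    ∃ y0, ∀ y ≥ y0, ∀ᶠ N in atTop, av r (fun p => (Z p - Zy c y p) ^ 2) N ≤ ε := by
  obtain ⟨y0, hy0⟩ := Sq_tail (ε / 800) (by positivity)
  refine ⟨y0 + 1, fun y hy => ?_⟩
  set C := 120 * A ^ 2 + 20800 * 2 ^ 32 with hC
  obtain ⟨R0, hR0⟩ := exists_nat_gt (2 * C / ε)
  filter_upwards [eventually_ge_atTop ((R0 + y + 2) ^ 40)] with N hN
  obtain ⟨R, hR, hR1, hR2⟩ := exists_R N _ hN
  have h1 := tail_R r hKe c hc hc0 Z A hA hZ y R N ((R + 1) ^ 32) (by linarith) (by linarith) (by push_cast; rfl)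
    ((show y ≤ R + 1 by linarith).trans (Nat.le_self_pow (by norm_num) _)) hR1 hR2
  have h2 := hy0 y (by linarith) ((R + 1) ^ 32)
  have hRp : (0:ℝ) < R := by exact_mod_cast (show 0 < R by linarith)
  have h3 : C / R ≤ ε / 2 := by
    rw [div_le_iff₀ hRp]
    have h4 : (R0:ℝ) ≤ R := by exact_mod_cast (show R0 ≤ R by linarith)
    rw [div_lt_iff₀ hε] at hR0
    nlinarith
  clear hR1 hR2 hN
  rw [← hC] at h1
  clear_value C
  linarith

end SM
end

section
namespace SM
open Filter Topology Finset

lemma av_mono {K : ℕ} (r : ZMod K) (F G : ℕ → ℝ) (h : ∀ p, F p ≤ G p) (N : ℕ) : av r F N ≤ av r G N := by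
  unfold av
  have hl : 0 ≤ Real.log (N:ℝ) := Real.log_natCast_nonneg N
  have := sum_le_sum (s := PNT.cls r N) (fun p _ => h p)
  gcongr

lemma av_add {K : ℕ} (r : ZMod K) (F G : ℕ → ℝ) (N : ℕ) : av r (fun p => F p + G p) N = av r F N + av r G N := by
  unfold av; rw [sum_add_distrib]; ring

lemma av_mul {K : ℕ} (r : ZMod K) (a : ℝ) (F : ℕ → ℝ) (N : ℕ) : av r (fun p => a * F p) N = a * av r F N := by
  unfold av; rw [← mul_sum]; ring

lemma av_sum {K : ℕ} {ι : Type} (r : ZMod K) (s : Finset ι) (F : ι → ℕ → ℝ) (N : ℕ) :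
    av r (fun p => ∑ i ∈ s, F i p) N = ∑ i ∈ s, av r (F i) N := by
  unfold av; rw [sum_comm, sum_mul, sum_div]

lemma av_zero {K : ℕ} (r : ZMod K) (N : ℕ) : av r (fun _ => 0) N = 0 := by
  unfold av; simp

lemma odd_of_cop {n K : ℕ} (hKe : Even K) (h : Nat.Coprime n K) : Odd n := by
  rcases Nat.even_or_odd n with he | ho
  · exfalso
    have : 2 ∣ Nat.gcd n K := Nat.dvd_gcd he.two_dvd hKe.two_dvd
    rw [h] at this
    omega
  · exact ho

lemma av_c {K : ℕ} [NeZero K] (hKe : Even K) (r : ZMod K) (hr : IsUnit r) (n : ℕ) (a : ℝ) (hn : Nat.Coprime n K) :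
    Tendsto (av r (fun p => a * (jacobiSym p n : ℝ))) atTop (𝓝 ((K.totient : ℝ)⁻¹ * if IsSquare n then a else 0)) := by
  have ho := odd_of_cop hKe hn
  have e : av r (fun p => a * (jacobiSym p n : ℝ)) = fun N => a * av r (fun p => (jacobiSym p n : ℝ)) N := by
    funext N; exact av_mul r a _ N
  rw [e]
  split_ifs with h
  · rw [mul_comm]
    exact (av_sq K n r hr ho.pos h).const_mul a
  · have := (av_nonsq K n r hr ho hn h).const_mul a
    simpa using this

lemma av_Zy {K : ℕ} [NeZero K] (hKe : Even K) (r : ZMod K) (hr : IsUnit r) (c : ℕ → ℝ)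
    (hc0 : ∀ n, ¬ Nat.Coprime n K → c n = 0) (y : ℕ) :
    Tendsto (av r (Zy c y)) atTop (𝓝 ((K.totient : ℝ)⁻¹ * ∑ n ∈ range y, if IsSquare n then c n / n else 0)) := by
  have e : av r (Zy c y) = fun N => ∑ n ∈ range y, av r (fun p => c n / n * (jacobiSym p n : ℝ)) N := by
    funext N
    rw [← av_sum]
    congr 1; funext p
    unfold Zy
    refine sum_congr rfl fun n _ => by ring
  rw [e, mul_sum]
  refine tendsto_finsetSum _ fun n _ => ?_
  by_cases hn : Nat.Coprime n K
  · exact av_c hKe r hr n _ hn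
  · simp only [hc0 n hn, zero_div, zero_mul, ite_self, mul_zero]
    have : av r (fun _ => (0:ℝ)) = fun _ => 0 := by funext N; exact av_zero r N
    rw [this]
    exact tendsto_const_nhds

lemma av_Zy2 {K : ℕ} [NeZero K] (hKe : Even K) (r : ZMod K) (hr : IsUnit r) (c : ℕ → ℝ)
    (hc0 : ∀ n, ¬ Nat.Coprime n K → c n = 0) (y : ℕ) :
    Tendsto (av r (fun p => Zy c y p ^ 2)) atTop (𝓝 ((K.totient : ℝ)⁻¹ * ∑ x ∈ range y ×ˢ range y, GG c x)) := by
  have e : av r (fun p => Zy c y p ^ 2) = fun N => ∑ x ∈ range y ×ˢ range y,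
      av r (fun p => c x.1 / x.1 * (jacobiSym p x.1 : ℝ) * (c x.2 / x.2 * (jacobiSym p x.2 : ℝ))) N := by
    funext N
    rw [← av_sum]
    congr 1; funext p
    unfold Zy
    rw [sq, sum_mul_sum, ← sum_product']
    refine sum_congr rfl fun n _ => by ring
  rw [e, mul_sum]
  refine tendsto_finsetSum _ fun x _ => ?_
  have hz : Tendsto (av r (fun _ => (0:ℝ))) atTop (𝓝 0) := by
    have : av r (fun _ => (0:ℝ)) = fun _ => 0 := by funext N; exact av_zero r N
    rw [this]
    exact tendsto_const_nhds
  unfold GG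
  by_cases h1 : Nat.Coprime x.1 K
  · by_cases h2 : Nat.Coprime x.2 K
    · have := av_c hKe r hr (x.1 * x.2) (c x.1 * c x.2 / (x.1 * x.2)) (Nat.Coprime.mul_left h1 h2)
      refine this.congr fun N => ?_
      congr 1
      funext p
      have hn1 : NeZero x.1 := ⟨(odd_of_cop hKe h1).pos.ne'⟩
      have hn2 : NeZero x.2 := ⟨(odd_of_cop hKe h2).pos.ne'⟩
      rw [jacobiSym.mul_right]
      push_cast
      have a1 := hn1.out
      have a2 := hn2.out
      field_simp
    · simpa [hc0 _ h2] using hz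
  · simpa [hc0 _ h1] using hz

lemma ind_ge (t Y Rm η : ℝ) (ht : 0 < t) (hη : 0 < η) :
    2 * t * Y + (-η) * 1 + (-(t ^ 2 * (1 + η))) * Y ^ 2 + (-(t ^ 2 * (1 + 2 / η))) * Rm ^ 2 ≤ if 0 < Y + Rm then 1 else 0 := by
  have h1 : 2 * t * (Y + Rm) - t ^ 2 * (Y + Rm) ^ 2 ≤ if 0 < Y + Rm then (1:ℝ) else 0 := by
    split_ifs with h
    · nlinarith [sq_nonneg (t * (Y + Rm) - 1)]
    · push Not at h
      nlinarith [sq_nonneg (t * (Y + Rm))]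
  refine le_trans ?_ h1
  have h2 : t ^ 2 * (Y + Rm) ^ 2 ≤ t ^ 2 * ((1 + η) * Y ^ 2 + (1 + 1 / η) * Rm ^ 2) := by
    refine mul_le_mul_of_nonneg_left ?_ (sq_nonneg t)
    have : 0 ≤ (η * Y - Rm) ^ 2 / η := by positivity
    have e : (η * Y - Rm) ^ 2 / η = (1 + η) * Y ^ 2 + (1 + 1 / η) * Rm ^ 2 - (Y + Rm) ^ 2 := by
      field_simp; ring
    linarith
  have h3 : -(2 * t * Rm) ≤ η + t ^ 2 * (1 / η) * Rm ^ 2 := by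
    have : 0 ≤ (η + t * Rm) ^ 2 / η := by positivity
    have e : (η + t * Rm) ^ 2 / η = η + t ^ 2 * (1 / η) * Rm ^ 2 + 2 * t * Rm := by
      field_simp; ring
    linarith
  have e : t ^ 2 * (1 + 2 / η) * Rm ^ 2 = t ^ 2 * ((1 + 1 / η) * Rm ^ 2) + t ^ 2 * (1 / η) * Rm ^ 2 := by ring
  nlinarith

lemma tendsto_sq_range : Tendsto (fun y : ℕ => range y ×ˢ range y) atTop atTop := by
  refine tendsto_atTop_finset_of_monotone ?_ ?_
  · intro a b hab
    exact product_subset_product (range_mono hab) (range_mono hab)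
  · intro x
    refine ⟨x.1 + x.2 + 1, ?_⟩
    simp only [mem_product, mem_range]
    omega

theorem prob_t {K : ℕ} [NeZero K] (r : ZMod K) (hr : IsUnit r) (hKe : Even K) (c e : ℕ → ℝ) (hc : ∀ n, |c n| ≤ 1)
    (hc0 : ∀ n, ¬ Nat.Coprime n K → c n = 0) (he : ∀ n, |e n| ≤ 1)
    (hce : ∀ s a, 0 < a → c (s * a ^ 2) = c s * e a) (Z : ℕ → ℝ) (A : ℝ) (hA : 0 ≤ A)
    (hZ : ∀ p : ℕ, p.Prime → (p : ZMod K) = r → ∀ s : ℕ, p ≤ s ^ 4 → ∀ M : ℕ, 1 ≤ M →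
      |Z p - Zy c M p| ≤ A * s ^ 3 / M) (t : ℝ) (ht : 0 < t) (δ : ℝ) (hδ : 0 < δ) :
    ∀ᶠ N : ℕ in atTop, (K.totient : ℝ)⁻¹ * (2 * t * (c 1 * ∑' a : ℕ, e a / (a:ℝ) ^ 2)
        - t ^ 2 * ((∑' s, uu c s) * ((∑' a : ℕ, e a / (a:ℝ) ^ 2) * (∑' a : ℕ, e a / (a:ℝ) ^ 2)))) - δ
      ≤ av r (fun p => if 0 < Z p then 1 else 0) N := by
  set M := c 1 * ∑' a : ℕ, e a / (a:ℝ) ^ 2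
  set Q := (∑' s, uu c s) * ((∑' a : ℕ, e a / (a:ℝ) ^ 2) * (∑' a : ℕ, e a / (a:ℝ) ^ 2)) with hQ
  set f := (K.totient : ℝ)⁻¹ with hf
  have hf0 : 0 ≤ f := by positivity
  have hf1 : f ≤ 1 := by
    apply inv_le_one_of_one_le₀
    exact_mod_cast Nat.totient_pos.mpr (Nat.pos_of_ne_zero (NeZero.ne K))
  have hQ0 : 0 ≤ Q := by
    refine mul_nonneg (tsum_nonneg fun s => ?_) (mul_self_nonneg _)
    unfold uu
    split_ifs <;> positivity
  have hm := (hasSum_sq c e he hce).tendsto_sum_nat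
  have hq := (hasSum_GG c e hc he hce).comp tendsto_sq_range
  set η := δ / (8 * (1 + t ^ 2 * Q)) with hη
  have hη0 : 0 < η := by positivity
  have hη1 : η * (1 + t ^ 2 * Q) = δ / 8 := by rw [hη]; field_simp
  set ε := δ / 4 / (t ^ 2 * (1 + 2 / η)) with hεd
  have hε : 0 < ε := by positivity
  have hε1 : t ^ 2 * (1 + 2 / η) * ε = δ / 4 := by rw [hεd]; field_simp
  obtain ⟨y0, hy0⟩ := tail r hKe c hc hc0 Z A hA hZ ε hε
  have hG : Tendsto (fun y : ℕ => f * (2 * t * (∑ n ∈ range y, if IsSquare n then c n / n else 0) - η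
      - t ^ 2 * (1 + η) * ∑ x ∈ range y ×ˢ range y, GG c x)) atTop (𝓝 (f * (2 * t * M - η - t ^ 2 * (1 + η) * Q))) :=
    (((hm.const_mul _).sub_const _).sub (hq.const_mul _)).const_mul f
  have hlt : f * (2 * t * M - t ^ 2 * Q) - δ / 4 < f * (2 * t * M - η - t ^ 2 * (1 + η) * Q) := by
    have : f * (2 * t * M - η - t ^ 2 * (1 + η) * Q) = f * (2 * t * M - t ^ 2 * Q) - f * (η * (1 + t ^ 2 * Q)) := by ring
    rw [this, hη1]
    nlinarith
  obtain ⟨y, hy1, hy2⟩ := ((hG.eventually_const_lt hlt).and (eventually_ge_atTop y0)).exists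
  have hlim : Tendsto (fun N => 2 * t * av r (Zy c y) N + (-η) * av r (fun _ => 1) N + (-(t ^ 2 * (1 + η))) * av r (fun p => Zy c y p ^ 2) N) atTop
      (𝓝 (2 * t * (f * ∑ n ∈ range y, if IsSquare n then c n / n else 0) + (-η) * f + (-(t ^ 2 * (1 + η))) * (f * ∑ x ∈ range y ×ˢ range y, GG c x))) :=
    (((av_Zy hKe r hr c hc0 y).const_mul _).add ((av_one K r hr).const_mul _)).add ((av_Zy2 hKe r hr c hc0 y).const_mul _)
  have hlt2 : f * (2 * t * M - t ^ 2 * Q) - δ / 4 < 2 * t * (f * ∑ n ∈ range y, if IsSquare n then c n / n else 0) + (-η) * f + (-(t ^ 2 * (1 + η))) * (f * ∑ x ∈ range y ×ˢ range y, GG c x) := by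
    refine lt_of_lt_of_eq hy1 ?_
    ring
  filter_upwards [hlim.eventually_const_lt hlt2, hy0 y hy2] with N h1 h2
  have h3 : av r (fun p => 2 * t * Zy c y p + (-η) * 1 + (-(t ^ 2 * (1 + η))) * Zy c y p ^ 2 + (-(t ^ 2 * (1 + 2 / η))) * (Z p - Zy c y p) ^ 2) N ≤ av r (fun p => if 0 < Z p then 1 else 0) N := by
    apply av_mono
    intro p
    have := ind_ge t (Zy c y p) (Z p - Zy c y p) η ht hη0
    simpa using this
  rw [av_add, av_add, av_add, av_mul, av_mul, av_mul, av_mul] at h3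
  have h4 : t ^ 2 * (1 + 2 / η) * av r (fun p => (Z p - Zy c y p) ^ 2) N ≤ δ / 4 := by
    rw [← hε1]
    exact mul_le_mul_of_nonneg_left h2 (by positivity)
  linarith

/-- abstract probability bound -/
theorem prob {K : ℕ} [NeZero K] (r : ZMod K) (hr : IsUnit r) (hKe : Even K) (c e : ℕ → ℝ) (hc : ∀ n, |c n| ≤ 1)
    (hc0 : ∀ n, ¬ Nat.Coprime n K → c n = 0) (he : ∀ n, |e n| ≤ 1)
    (hce : ∀ s a, 0 < a → c (s * a ^ 2) = c s * e a) (Z : ℕ → ℝ) (A : ℝ) (hA : 0 ≤ A)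
    (hZ : ∀ p : ℕ, p.Prime → (p : ZMod K) = r → ∀ s : ℕ, p ≤ s ^ 4 → ∀ M : ℕ, 1 ≤ M →
      |Z p - Zy c M p| ≤ A * s ^ 3 / M) (hc1 : 0 < c 1) (he1 : e 1 = 1)
    (hU : ∑' s, uu c s ≤ 3 / 2 * c 1 ^ 2) (δ : ℝ) (hδ : 0 < δ) :
    ∀ᶠ N : ℕ in atTop, (K.totient : ℝ)⁻¹ * (2 / 3) - δ ≤ av r (fun p => if 0 < Z p then 1 else 0) N := by
  have hsum : Summable (fun a : ℕ => e a / (a:ℝ) ^ 2) := by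
    refine Summable.of_norm_bounded (g := fun a : ℕ => 1 / (a:ℝ) ^ 2) (Real.summable_one_div_nat_pow.mpr (by norm_num)) fun a => ?_
    rw [Real.norm_eq_abs, abs_div, abs_of_nonneg (by positivity : (0:ℝ) ≤ (a:ℝ) ^ 2)]
    exact div_le_div_of_nonneg_right (he a) (by positivity)
  set D := ∑' a : ℕ, e a / (a:ℝ) ^ 2 with hD
  have hDpos : 0 < D := by
    have hb := hasSum_zeta_two
    have h1 : D + (∑' a : ℕ, 1 / (a:ℝ) ^ 2) = ∑' a : ℕ, (e a / (a:ℝ) ^ 2 + 1 / (a:ℝ) ^ 2) := (hsum.tsum_add hb.summable).symm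
    have h2 : (2:ℝ) ≤ ∑' a : ℕ, (e a / (a:ℝ) ^ 2 + 1 / (a:ℝ) ^ 2) := by
      have := (hsum.add hb.summable).le_tsum 1 (fun a _ => ?_)
      · simp [he1] at this
        norm_num at this ⊢
        exact this
      · have := abs_le.mp (he a)
        rw [← add_div]
        apply div_nonneg <;> [linarith; positivity]
    rw [hb.tsum_eq] at h1
    have := Real.pi_lt_d2
    nlinarith [Real.pi_pos]
  have := prob_t r hr hKe c e hc hc0 he hce Z A hA hZ (2 / 3 / (c 1 * D)) (by positivity) δ hδ
  filter_upwards [this] with N hN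
  refine le_trans ?_ hN
  have h5 : (2 / 3 / (c 1 * D)) ^ 2 * ((∑' s, uu c s) * (D * D)) ≤ 2 / 3 := by
    have e1 : (2 / 3 / (c 1 * D)) ^ 2 * ((∑' s, uu c s) * (D * D)) = 4 / 9 * ((∑' s, uu c s) / c 1 ^ 2) := by
      field_simp; ring
    rw [e1]
    have : (∑' s, uu c s) / c 1 ^ 2 ≤ 3 / 2 := by rw [div_le_iff₀ (by positivity)]; exact hU
    linarith
  have h6 : 2 * (2 / 3 / (c 1 * D)) * (c 1 * D) = 4 / 3 := by field_simp; norm_num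
  have h7 : (0:ℝ) ≤ (K.totient : ℝ)⁻¹ := by positivity
  have : (K.totient : ℝ)⁻¹ * (2 / 3) ≤ (K.totient : ℝ)⁻¹ * (2 * (2 / 3 / (c 1 * D)) * (c 1 * D) - (2 / 3 / (c 1 * D)) ^ 2 * ((∑' s, uu c s) * (D * D))) :=
    mul_le_mul_of_nonneg_left (by linarith) h7
  linarith

end SM
end

section
namespace SM
open Filter Topology Finset LF

lemma mod4_of {K : ℕ} [NeZero K] (hK4 : 4 ∣ K) (r : ZMod K) (p : ℕ) (h : (p : ZMod K) = r) : p % 4 = r.val % 4 := by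
  rw [← h, ZMod.val_natCast, Nat.mod_mod_of_dvd p hK4]

lemma cop_of {K : ℕ} (r : ZMod K) (hr : IsUnit r) (p : ℕ) (h : (p : ZMod K) = r) : Nat.Coprime p K := by
  rw [← ZMod.isUnit_iff_coprime, h]; exact hr

lemma chi_jac (p n : ℕ) [Fact p.Prime] : chi p n = (jacobiSym n p : ℝ) := by
  unfold chi
  rw [jacobiSym.legendreSym.to_jacobiSym]

lemma chi4_1 (n : ℕ) (h : n % 4 = 1) : cR ZMod.χ₄ n = 1 := by
  unfold cR; rw [ZMod.χ₄_nat_one_mod_four h]; norm_num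

lemma chi4_3 (n : ℕ) (h : n % 4 = 3) : cR ZMod.χ₄ n = -1 := by
  unfold cR; rw [ZMod.χ₄_nat_three_mod_four h]; norm_num

/-- reciprocity sign -/
noncomputable def sg (a n : ℕ) : ℝ := if a = 1 then 1 else cR ZMod.χ₄ n

lemma sg_odd (a n : ℕ) (h : Odd n) : sg a n = 1 ∨ sg a n = -1 := by
  unfold sg
  split_ifs
  · left; rfl
  · rcases Nat.odd_mod_four_iff.mp (Nat.odd_iff.mp h) with h | h
    · left; exact chi4_1 n h
    · right; exact chi4_3 n h

lemma sg_abs (a n : ℕ) : |sg a n| ≤ 1 := by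
  unfold sg
  split_ifs
  · simp
  · unfold cR; exact_mod_cast b4 _

lemma sg_recip (p n : ℕ) [Fact p.Prime] (hp : Odd p) (hn : Odd n) : chi p n = sg (p % 4) n * (jacobiSym p n : ℝ) := by
  rw [chi_jac]
  unfold sg
  split_ifs with h
  · rw [one_mul, jacobiSym.quadratic_reciprocity_one_mod_four h hn]
  · have h3 : p % 4 = 3 := by
      rcases Nat.odd_mod_four_iff.mp (Nat.odd_iff.mp hp) with h' | h'
      · exact absurd h' h
      · exact h'
    rcases Nat.odd_mod_four_iff.mp (Nat.odd_iff.mp hn) with h' | h'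
    · rw [chi4_1 n h', one_mul, jacobiSym.quadratic_reciprocity_one_mod_four h' hp]
    · rw [chi4_3 n h', jacobiSym.quadratic_reciprocity_three_mod_four h' h3]; push_cast; ring

lemma sg_sq (a s b : ℕ) (hb : Odd b) : sg a (s * b ^ 2) = sg a s := by
  unfold sg
  split_ifs
  · rfl
  · unfold cR
    have h : (4:ℕ) ∣ b ^ 2 - 1 := by
      obtain ⟨k, rfl⟩ := hb
      exact ⟨k ^ 2 + k, by rw [Nat.sub_eq_iff_eq_add (Nat.one_le_pow _ _ (by omega))]; ring⟩
    have h2 : ((b ^ 2 : ℕ) : ZMod 4) = 1 := by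
      have : ((b ^ 2 : ℕ) : ZMod 4) = ((b ^ 2 - 1 + 1 : ℕ) : ZMod 4) := by
        rw [Nat.sub_add_cancel (Nat.one_le_pow _ _ hb.pos)]
      rw [this, Nat.cast_add, (ZMod.natCast_eq_zero_iff _ _).mpr h]; simp
    rw [Nat.cast_mul, h2, mul_one]

lemma Bbound (p s : ℕ) (hp : 1 ≤ p) (h : p ≤ s ^ 4) : √(p:ℝ) * (1 + Real.log p) + 1 ≤ 5 * (s:ℝ) ^ 3 := by
  have hs : 1 ≤ s := by
    rcases Nat.eq_zero_or_pos s with rfl | h'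
    · simp at h; omega
    · exact h'
  have hsr : (1:ℝ) ≤ s := by exact_mod_cast hs
  have hpr : (p:ℝ) ≤ (s:ℝ) ^ 4 := by exact_mod_cast h
  have hpr1 : (1:ℝ) ≤ p := by exact_mod_cast hp
  have h1 : √(p:ℝ) ≤ (s:ℝ) ^ 2 := by
    rw [Real.sqrt_le_left (by positivity)]
    calc (p:ℝ) ≤ (s:ℝ) ^ 4 := hpr
      _ = _ := by ring
  have h2 : 1 + Real.log p ≤ 4 * s := by
    have : Real.log p ≤ Real.log ((s:ℝ) ^ 4) := Real.log_le_log (by linarith) hpr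
    rw [Real.log_pow] at this
    have h3 := Real.log_le_sub_one_of_pos (show (0:ℝ) < s by linarith)
    push_cast at this
    linarith
  have h3 : 0 ≤ 1 + Real.log (p:ℝ) := by
    have := Real.log_natCast_nonneg p
    linarith
  have h4 := mul_le_mul h1 h2 h3 (by positivity)
  have h5 : (1:ℝ) ≤ (s:ℝ) ^ 3 := one_le_pow₀ hsr
  nlinarith

open Classical in
theorem link {K : ℕ} [NeZero K] (r : ZMod K) (hr : IsUnit r) (hK4 : 4 ∣ K) (f e : ℕ → ℝ) (hf : ∀ n, |f n| ≤ 1)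
    (hper : ∀ n, f (n + K) = f n)
    (hf0 : ∀ n, ¬ Nat.Coprime n K → f n = 0) (he : ∀ n, |e n| ≤ 1)
    (hfe : ∀ s a, 0 < a → f (s * a ^ 2) = f s * e a) (hf1 : 0 < f 1) (he1 : e 1 = 1)
    (hU : ∑' s, uu f s ≤ 3 / 2 * f 1 ^ 2) (P : ℕ → Prop)
    (hP : ∀ (p : ℕ) [Fact p.Prime], (p : ZMod K) = r → ∀ t, HasT (fun n => chi p n * f n) t → 0 < t → P p)
    (δ : ℝ) (hδ : 0 < δ) :
    ∀ᶠ N : ℕ in atTop, (K.totient : ℝ)⁻¹ * (2 / 3) - δ ≤ av r (fun p => if P p then 1 else 0) N := by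
  have hKe : Even K := (Nat.even_iff.mpr (by norm_num) : Even 4).trans_dvd hK4
  set a := r.val % 4 with ha
  set c : ℕ → ℝ := fun n => sg a n * f n with hcd
  have hc : ∀ n, |c n| ≤ 1 := by
    intro n
    rw [hcd, abs_mul]
    exact mul_le_one₀ (sg_abs a n) (abs_nonneg _) (hf n)
  have hc0 : ∀ n, ¬ Nat.Coprime n K → c n = 0 := fun n hn => by rw [hcd]; simp [hf0 n hn]
  have hce : ∀ s b, 0 < b → c (s * b ^ 2) = c s * e b := by
    intro s b hb
    simp only [hcd]
    rcases Nat.even_or_odd b with hbe | hbo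
    · have : f (s * b ^ 2) = 0 := by
        apply hf0
        intro hcop
        have := odd_of_cop hKe hcop
        rw [Nat.odd_mul, Nat.odd_pow_iff two_ne_zero] at this
        exact absurd hbe (Nat.not_even_iff_odd.mpr this.2)
      have h2 := hfe s b hb
      rw [this] at h2 ⊢
      rw [mul_assoc, ← h2]; ring
    · rw [sg_sq a s b hbo, hfe s b hb]; ring
  have hc1 : c 1 = f 1 := by
    rcases sg_odd a 1 odd_one with h | h
    · simp only [hcd]; rw [h, one_mul]
    · exfalso
      unfold sg at h
      split_ifs at h
      · norm_num at h
      · rw [chi4_1 1 rfl] at h; norm_num at h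
  have huu : uu c = uu f := by
    funext s
    unfold uu
    by_cases hs : Nat.Coprime s K
    · have : c s ^ 2 = f s ^ 2 := by
        simp only [hcd]
        rcases sg_odd a s (odd_of_cop hKe hs) with h | h <;> rw [h] <;> ring
      rw [this]
    · rw [hc0 s hs, hf0 s hs]
  set Z : ℕ → ℝ := fun p => if h : ∃ t, HasT (fun n => (jacobiSym n p : ℝ) * f n) t then h.choose else 0 with hZd
  have hmain : ∀ p : ℕ, p.Prime → (p : ZMod K) = r → HasT (fun n => (jacobiSym n p : ℝ) * f n) (Z p) ∧ ∀ s : ℕ, p ≤ s ^ 4 → ∀ M : ℕ, 1 ≤ M →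
      |Z p - Zy c M p| ≤ 10 * K * s ^ 3 / M := by
    intro p hp hpr
    have hfact : Fact p.Prime := ⟨hp⟩
    have hcop := cop_of r hr p hpr
    have hodd := odd_of_cop hKe hcop
    have hp2 : p ≠ 2 := by rintro rfl; exact absurd hodd (by decide)
    obtain ⟨t, ht, hb⟩ := exT _ _ (persum p hp2 K (Nat.pos_of_ne_zero (NeZero.ne K)) hcop f 1 hf hper)
    have hfun : (fun n : ℕ => (jacobiSym n p : ℝ) * f n) = fun n : ℕ => (legendreSym p n : ℝ) * f n := by
      funext n
      rw [jacobiSym.legendreSym.to_jacobiSym]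
    have hex : ∃ t, HasT (fun n => (jacobiSym n p : ℝ) * f n) t := ⟨t, by rw [hfun]; exact ht⟩
    have hZs : HasT (fun n => (jacobiSym n p : ℝ) * f n) (Z p) := by
      simp only [hZd]
      rw [dif_pos hex]
      exact hex.choose_spec
    have hZt : Z p = t := by
      rw [hfun] at hZs
      exact hZs.unique ht
    refine ⟨hZs, fun s hs M hM => ?_⟩
    have h1 := hb M hM
    have h2 : ∑ n ∈ range M, (legendreSym p n : ℝ) * f n / n = Zy c M p := by
      unfold Zy
      refine sum_congr rfl fun n _ => ?_
      by_cases hn : Nat.Coprime n K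
      · have := sg_recip p n hodd (odd_of_cop hKe hn)
        rw [mod4_of hK4 r p hpr] at this
        unfold chi at this
        rw [this]; simp only [hcd, ha]; ring
      · rw [hc0 n hn, hf0 n hn]; simp
    rw [hZt, ← h2]
    refine h1.trans ?_
    refine div_le_div_of_nonneg_right ?_ (by positivity)
    have h3 := Bbound p s hp.one_lt.le hs
    have h4 : (0:ℝ) ≤ K := by positivity
    nlinarith
  have := prob r hr hKe c e hc hc0 he hce Z (10 * K) (by positivity) (fun p hp hpr => (hmain p hp hpr).2)
    (by rw [hc1]; exact hf1) he1 (by rw [huu, hc1]; exact hU) δ hδ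
  filter_upwards [this] with N hN
  refine hN.trans ?_
  unfold av
  have hl : 0 ≤ Real.log (N:ℝ) := Real.log_natCast_nonneg N
  have : ∑ p ∈ PNT.cls r N, (if 0 < Z p then (1:ℝ) else 0) ≤ ∑ p ∈ PNT.cls r N, (if P p then (1:ℝ) else 0) := by
    refine sum_le_sum fun p hp => ?_
    simp only [PNT.cls, mem_filter] at hp
    have hfact : Fact p.Prime := ⟨hp.2.1⟩
    by_cases hz : 0 < Z p
    · have h1 := (hmain p hp.2.1 hp.2.2).1
      have : P p := hP p hp.2.2 (Z p) (h1.congr fun n => by rw [chi_jac]) hz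
      simp [hz, this]
    · simp only [hz, if_false]
      split_ifs <;> norm_num
  gcongr

lemma odd_tail (f : ℕ → ℝ) (F : ℝ) (hev : ∀ n, Even n → f n = 0) (hF : ∀ n, f n ^ 2 ≤ F) (m : ℕ) :
    ∑ n ∈ range (2 * (m + 15) + 1), f n ^ 2 / (n:ℝ) ^ 2 ≤ ∑ n ∈ range 31, f n ^ 2 / (n:ℝ) ^ 2 + F * (1 / 60 - 1 / (4 * (m + 15))) := by
  induction m with
  | zero => norm_num
  | succ m ih =>
    rw [show 2 * (m + 1 + 15) + 1 = 2 * (m + 15) + 1 + 1 + 1 by ring, sum_range_succ, sum_range_succ, hev (2 * (m + 15) + 1 + 1) ⟨m + 15 + 1, by ring⟩]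
    have hF0 : 0 ≤ F := (sq_nonneg _).trans (hF 0)
    have h1 : f (2 * (m + 15) + 1) ^ 2 / ((2 * (m + 15) + 1 : ℕ) : ℝ) ^ 2 ≤ F * (1 / (4 * ((m:ℝ) + 15)) - 1 / (4 * ((m:ℝ) + 1 + 15))) := by
      have h2 : f (2 * (m + 15) + 1) ^ 2 / ((2 * (m + 15) + 1 : ℕ) : ℝ) ^ 2 ≤ F / ((2 * (m + 15) + 1 : ℕ) : ℝ) ^ 2 :=
        div_le_div_of_nonneg_right (hF _) (by positivity)
      refine h2.trans ?_
      rw [div_eq_mul_one_div]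
      refine mul_le_mul_of_nonneg_left ?_ hF0
      push_cast
      have hm : (0:ℝ) ≤ m := by positivity
      rw [div_sub_div _ _ (by positivity) (by positivity), div_le_div_iff₀ (by positivity) (by positivity)]
      nlinarith
    push_cast at *
    have h3 : F * (1 / 60 - 1 / (4 * ((m:ℝ) + 1 + 15))) = F * (1 / 60 - 1 / (4 * ((m:ℝ) + 15))) + F * (1 / (4 * ((m:ℝ) + 15)) - 1 / (4 * ((m:ℝ) + 1 + 15))) := by ring
    rw [h3]
    simp only [ne_eq, OfNat.ofNat_ne_zero, not_false_eq_true, zero_pow, zero_div, add_zero]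
    linarith

lemma Ubound (f : ℕ → ℝ) (F : ℝ) (hev : ∀ n, Even n → f n = 0) (hF : ∀ n, f n ^ 2 ≤ F) :
    ∑' s, uu f s ≤ ∑ n ∈ range 31, f n ^ 2 / (n:ℝ) ^ 2 + F / 60 := by
  have hF0 : 0 ≤ F := (sq_nonneg _).trans (hF 0)
  have hnn : ∀ n, 0 ≤ uu f n := fun n => by
    unfold uu; split_ifs <;> positivity
  refine Real.tsum_le_of_sum_range_le hnn fun N => ?_
  have h1 : ∑ n ∈ range N, uu f n ≤ ∑ n ∈ range (2 * (N + 15) + 1), f n ^ 2 / (n:ℝ) ^ 2 := by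
    have : ∑ n ∈ range N, uu f n ≤ ∑ n ∈ range N, f n ^ 2 / (n:ℝ) ^ 2 := by
      refine sum_le_sum fun n _ => ?_
      unfold uu; split_ifs
      · rfl
      · positivity
    refine this.trans (sum_le_sum_of_subset_of_nonneg (range_mono (by omega)) fun n _ _ => by positivity)
  refine h1.trans ((odd_tail f F hev hF N).trans ?_)
  have : 0 ≤ F * (1 / (4 * ((N:ℝ) + 15))) := by positivity
  linarith

end SM
end

section
namespace SM
open Filter Topology Finset LF
open scoped Real

lemma c8if (n : ℕ) : cR ZMod.χ₈ n = if n % 2 = 0 then 0 else if n % 8 = 1 ∨ n % 8 = 7 then 1 else -1 := by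
  unfold cR
  rw [ZMod.χ₈_nat_eq_if_mod_eight]
  split_ifs <;> norm_num

lemma c8if' (n : ℕ) : cR ZMod.χ₈' n = if n % 2 = 0 then 0 else if n % 8 = 1 ∨ n % 8 = 3 then 1 else -1 := by
  unfold cR
  rw [ZMod.χ₈'_nat_eq_if_mod_eight]
  split_ifs <;> norm_num

lemma c4if (n : ℕ) : cR ZMod.χ₄ n = if n % 2 = 0 then 0 else if n % 4 = 1 then 1 else -1 := by
  unfold cR
  rw [ZMod.χ₄_nat_eq_if_mod_four]
  split_ifs <;> norm_num

/-- table modulo 24 -/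
noncomputable def tb24 (x z σ : ℝ) (n : ℕ) : ℝ :=
  if n % 2 = 0 ∨ n % 3 = 0 then 0 else if n % 8 = 1 then x else if n % 8 = 3 then z else if n % 8 = 5 then σ * z else σ * x

/-- table modulo 40 -/
noncomputable def tb40 (x z σ : ℝ) (n : ℕ) : ℝ :=
  if n % 2 = 0 ∨ n % 5 = 0 then 0 else if n % 5 = 1 then x else if n % 5 = 2 then z else if n % 5 = 3 then σ * z else σ * x

noncomputable def ep24 (n : ℕ) : ℝ := if n % 2 = 0 ∨ n % 3 = 0 then 0 else 1
noncomputable def ep40 (σ : ℝ) (n : ℕ) : ℝ := if n % 2 = 0 ∨ n % 5 = 0 then 0 else if n % 5 = 1 ∨ n % 5 = 4 then 1 else σ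

lemma tb24_mod (x z σ : ℝ) (n : ℕ) : tb24 x z σ (n % 24) = tb24 x z σ n := by
  unfold tb24
  rw [Nat.mod_mod_of_dvd n (by norm_num : 2 ∣ 24), Nat.mod_mod_of_dvd n (by norm_num : 3 ∣ 24), Nat.mod_mod_of_dvd n (by norm_num : 8 ∣ 24)]

lemma tb40_mod (x z σ : ℝ) (n : ℕ) : tb40 x z σ (n % 10) = tb40 x z σ n := by
  unfold tb40
  rw [Nat.mod_mod_of_dvd n (by norm_num : 2 ∣ 10), Nat.mod_mod_of_dvd n (by norm_num : 5 ∣ 10)]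

lemma tb24_per (x z σ : ℝ) (n : ℕ) : tb24 x z σ (n + 24) = tb24 x z σ n := by
  rw [← tb24_mod, Nat.add_mod_right, tb24_mod]

lemma tb40_per (x z σ : ℝ) (n : ℕ) : tb40 x z σ (n + 10) = tb40 x z σ n := by
  rw [← tb40_mod, Nat.add_mod_right, tb40_mod]

lemma tb40_per' (x z σ : ℝ) (n : ℕ) : tb40 x z σ (n + 40) = tb40 x z σ n := by
  rw [← tb40_mod, show n + 40 = n + 10 * 4 by ring, Nat.add_mul_mod_self_left, tb40_mod]

lemma tb24_fe (x z σ : ℝ) (s a : ℕ) : tb24 x z σ (s * a ^ 2) = tb24 x z σ s * ep24 a := by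
  unfold ep24
  split_ifs with h
  · unfold tb24
    rw [if_pos, mul_zero]
    rcases h with h | h
    · left; simp [Nat.mul_mod, Nat.pow_mod, h]
    · right; simp [Nat.mul_mod, Nat.pow_mod, h]
  · have h2 : a ^ 2 % 24 = 1 := by
      have h3 : a % 24 < 24 := Nat.mod_lt _ (by norm_num)
      rw [Nat.pow_mod]
      have h4 : a % 2 = a % 24 % 2 := (Nat.mod_mod_of_dvd a (by norm_num)).symm
      have h5 : a % 3 = a % 24 % 3 := (Nat.mod_mod_of_dvd a (by norm_num)).symm
      rw [h4, h5] at h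
      generalize a % 24 = b at *
      interval_cases b <;> simp_all
    rw [mul_one, ← tb24_mod, Nat.mul_mod, h2, mul_one, Nat.mod_mod, tb24_mod]

lemma tb40_fe (x z σ : ℝ) (hσ : σ * σ = 1) (s a : ℕ) : tb40 x z σ (s * a ^ 2) = tb40 x z σ s * ep40 σ a := by
  unfold ep40
  have h4 : a % 2 = a % 10 % 2 := (Nat.mod_mod_of_dvd a (by norm_num)).symm
  have h5 : a % 5 = a % 10 % 5 := (Nat.mod_mod_of_dvd a (by norm_num)).symm
  have h3 : a % 10 < 10 := Nat.mod_lt _ (by norm_num)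
  split_ifs with h h'
  · unfold tb40
    rw [if_pos, mul_zero]
    rcases h with h | h
    · left; simp [Nat.mul_mod, Nat.pow_mod, h]
    · right; simp [Nat.mul_mod, Nat.pow_mod, h]
  · have h2 : a ^ 2 % 10 = 1 := by
      rw [Nat.pow_mod]
      rw [h4, h5] at h
      rw [h5] at h'
      clear h4 h5
      generalize a % 10 = b at *
      interval_cases b <;> simp_all
    rw [mul_one, ← tb40_mod, Nat.mul_mod, h2, mul_one, Nat.mod_mod, tb40_mod]
  · have h2 : a ^ 2 % 10 = 9 := by
      rw [Nat.pow_mod]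
      rw [h4, h5] at h
      rw [h5] at h'
      clear h4 h5
      generalize a % 10 = b at *
      interval_cases b <;> simp_all
    rw [← tb40_mod, Nat.mul_mod, h2, ← tb40_mod x z σ s]
    have hs : s % 10 < 10 := Nat.mod_lt _ (by norm_num)
    generalize s % 10 = b at *
    interval_cases b <;> simp [tb40] <;> first | ring1 | linear_combination (-z) * hσ | linear_combination (-x) * hσ

open Classical in
theorem prob24 (r : ZMod 24) (hr : IsUnit r) (x z σ : ℝ) (hx : 0 < x) (hx1 : x ≤ 1) (hz0 : |z| ≤ 1)
    (hσ : σ * σ = 1) (hxz : z ^ 2 ≤ 6 * x ^ 2) (P : ℕ → Prop)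
    (hP : ∀ (p : ℕ) [Fact p.Prime], (p : ZMod 24) = r → ∀ t, HasT (fun n => chi p n * tb24 x z σ n) t → 0 < t → P p)
    (δ : ℝ) (hδ : 0 < δ) :
    ∀ᶠ N : ℕ in atTop, ((24:ℕ).totient : ℝ)⁻¹ * (2 / 3) - δ ≤ av r (fun p => if P p then 1 else 0) N := by
  have hxa : |x| ≤ 1 := by rwa [abs_of_pos hx]
  have hs : |σ| = 1 := by
    have : |σ| * |σ| = 1 := by rw [← abs_mul, hσ, abs_one]
    nlinarith [abs_nonneg σ]
  have hs2 : σ ^ 2 = 1 := by rw [sq, hσ]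
  have hev : ∀ n, Even n → tb24 x z σ n = 0 := fun n hn => by
    unfold tb24; rw [if_pos (Or.inl (Nat.even_iff.mp hn))]
  refine link r hr (by norm_num) (tb24 x z σ) ep24 ?_ (tb24_per x z σ) ?_ ?_ (fun s a _ => tb24_fe x z σ s a) ?_ ?_ ?_ P hP δ hδ
  · intro n; unfold tb24
    split_ifs <;> simp [abs_mul, hs, hxa, hz0]
  · intro n hn
    unfold tb24; rw [if_pos]
    by_contra h
    apply hn
    push Not at h
    rw [show 24 = 2 ^ 3 * 3 by norm_num]
    refine Nat.Coprime.mul_right (Nat.Coprime.pow_right 3 ?_) ?_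
    · rw [Nat.coprime_comm, Nat.Prime.coprime_iff_not_dvd Nat.prime_two]; omega
    · rw [Nat.coprime_comm, Nat.Prime.coprime_iff_not_dvd Nat.prime_three]; omega
  · intro n; unfold ep24; split_ifs <;> simp
  · simpa [tb24] using hx
  · simp [ep24]
  · refine (Ubound _ (6 * x ^ 2) hev ?_).trans ?_
    · intro n; unfold tb24
      split_ifs <;> (try simp only [mul_pow, hs2]) <;> nlinarith [sq_nonneg x]
    · simp only [Finset.sum_range_succ, Finset.sum_range_zero]
      simp [tb24, mul_pow, hs2]
      nlinarith [sq_nonneg x]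

open Classical in
theorem prob40 (r : ZMod 40) (hr : IsUnit r) (x z σ : ℝ) (hx : 0 < x) (hx1 : x ≤ 1) (hz0 : |z| ≤ 1)
    (hσ : σ * σ = 1) (hxz : z ^ 2 ≤ 29 / 10 * x ^ 2) (P : ℕ → Prop)
    (hP : ∀ (p : ℕ) [Fact p.Prime], (p : ZMod 40) = r → ∀ t, HasT (fun n => chi p n * tb40 x z σ n) t → 0 < t → P p)
    (δ : ℝ) (hδ : 0 < δ) :
    ∀ᶠ N : ℕ in atTop, ((40:ℕ).totient : ℝ)⁻¹ * (2 / 3) - δ ≤ av r (fun p => if P p then 1 else 0) N := by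
  have hxa : |x| ≤ 1 := by rwa [abs_of_pos hx]
  have hs : |σ| = 1 := by
    have : |σ| * |σ| = 1 := by rw [← abs_mul, hσ, abs_one]
    nlinarith [abs_nonneg σ]
  have hs2 : σ ^ 2 = 1 := by rw [sq, hσ]
  have hev : ∀ n, Even n → tb40 x z σ n = 0 := fun n hn => by
    unfold tb40; rw [if_pos (Or.inl (Nat.even_iff.mp hn))]
  refine link r hr (by norm_num) (tb40 x z σ) (ep40 σ) ?_ (tb40_per' x z σ) ?_ ?_ (fun s a _ => tb40_fe x z σ hσ s a) ?_ ?_ ?_ P hP δ hδ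
  · intro n; unfold tb40
    split_ifs <;> simp [abs_mul, hs, hxa, hz0]
  · intro n hn
    unfold tb40; rw [if_pos]
    by_contra h
    apply hn
    push Not at h
    rw [show 40 = 2 ^ 3 * 5 by norm_num]
    refine Nat.Coprime.mul_right (Nat.Coprime.pow_right 3 ?_) ?_
    · rw [Nat.coprime_comm, Nat.Prime.coprime_iff_not_dvd Nat.prime_two]; omega
    · rw [Nat.coprime_comm, Nat.Prime.coprime_iff_not_dvd Nat.prime_five]; omega
  · intro n; unfold ep40; split_ifs <;> simp [hs]
  · simpa [tb40] using hx
  · simp [ep40]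
  · refine (Ubound _ (29 / 10 * x ^ 2) hev ?_).trans ?_
    · intro n; unfold tb40
      split_ifs <;> (try simp only [mul_pow, hs2]) <;> nlinarith [sq_nonneg x]
    · simp only [Finset.sum_range_succ, Finset.sum_range_zero]
      simp [tb40, mul_pow, hs2]
      nlinarith [sq_nonneg x]

end SM
end

section
namespace SM
open Filter Topology Finset LF
open scoped Real

lemma id18c (n : ℕ) : 1 + D 4 (fun _ => 1) n - 2 * D 8 (fun _ => 1) n - √2/2 * cR ZMod.χ₈ n = CN 1 8 n := by
  have q : √2 * √2 = 2 := Real.mul_self_sqrt (by norm_num)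
  have c1 : CN 1 8 1 = 1 - √2/2 := CN1 (x := π / 4) (by push_cast; ring) (by rw [Real.cos_pi_div_four])
  have h0 := CN_zero 1 8
  have h2 : CN 1 8 2 = 1 := by
    have h := CN_rec 1 8 0
    norm_num only at h
    rw [c1, h0] at h
    grind
  have h3 : CN 1 8 3 = 1+√2/2 := by
    have h := CN_rec 1 8 1
    norm_num only at h
    rw [c1, h2] at h
    grind
  have h4 : CN 1 8 4 = 2 := by
    have h := CN_rec 1 8 2
    norm_num only at h
    rw [c1, h3, h2] at h
    grind
  have h5 : CN 1 8 5 = 1+√2/2 := by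
    have h := CN_rec 1 8 3
    norm_num only at h
    rw [c1, h4, h3] at h
    grind
  have h6 : CN 1 8 6 = 1 := by
    have h := CN_rec 1 8 4
    norm_num only at h
    rw [c1, h5, h4] at h
    grind
  have h7 : CN 1 8 7 = 1-√2/2 := by
    have h := CN_rec 1 8 5
    norm_num only at h
    rw [c1, h6, h5] at h
    grind
  refine per_ext (f := fun n => 1 + D 4 (fun _ => 1) n - 2 * D 8 (fun _ => 1) n - √2/2 * cR ZMod.χ₈ n) 8 (by norm_num)
    (fun n => by simp only [cR_per ZMod.χ₈ 1 n, D_add (k := 8) (m := 2) four_pos rfl (ψ := fun _ => 1) (fun _ => rfl) n, D_add (k := 8) (m := 1) (d := 8) (by norm_num) rfl (ψ := fun _ => 1) (fun _ => rfl) n]) (CN_per 1 8 (by norm_num)) (fun r hr => ?_) n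
  interval_cases r <;> simp only [v8_0, v8_1, v8_2, v8_3, v8_4, v8_5, v8_6, v8_7, D, h0, c1, h2, h3, h4, h5, h6, h7] <;> norm_num <;> (try simp only [v8_0, v8_1, v8_2, v8_3, v8_4, v8_5, v8_6, v8_7]) <;> (try ring)

lemma t13 (a b : ℝ) (n : ℕ) : a * (cR ZMod.χ₈' n - D 3 (cR ZMod.χ₈') n) - b * (cR ZMod.χ₄ n + D 3 (cR ZMod.χ₄) n)
    = tb24 (a - b) (a + b) (-1) n := by
  refine per_ext (f := fun n => a * (cR ZMod.χ₈' n - D 3 (cR ZMod.χ₈') n) - b * (cR ZMod.χ₄ n + D 3 (cR ZMod.χ₄) n)) 24 (by norm_num)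
    (fun n => by simp only [cR_per ZMod.χ₈' 3 n, cR_per ZMod.χ₄ 6 n, D_add (k := 24) three_pos rfl (cR_per ZMod.χ₈' 1) n, D_add (k := 24) three_pos rfl (cR_per ZMod.χ₄ 2) n]) (tb24_per _ _ _) (fun r hr => ?_) n
  interval_cases r <;> simp [tb24, D, c8if', c4if] <;> ring

lemma t11 (a b : ℝ) (n : ℕ) : a * (1 - D 2 (fun _ => 1) n - D 3 (fun _ => 1) n + D 6 (fun _ => 1) n) - b * (cR ZMod.χ₈ n + D 3 (cR ZMod.χ₈) n)
    = tb24 (a - b) (a + b) 1 n := by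
  refine per_ext (f := fun n => a * (1 - D 2 (fun _ => 1) n - D 3 (fun _ => 1) n + D 6 (fun _ => 1) n) - b * (cR ZMod.χ₈ n + D 3 (cR ZMod.χ₈) n)) 24 (by norm_num)
    (fun n => by simp only [cR_per ZMod.χ₈ 3 n, D_add (k := 24) three_pos rfl (cR_per ZMod.χ₈ 1) n,
      D_add (k := 24) (m := 12) (d := 2) (by norm_num) rfl (ψ := fun _ => 1) (fun _ => rfl) n,
      D_add (k := 24) (m := 8) (d := 3) (by norm_num) rfl (ψ := fun _ => 1) (fun _ => rfl) n,
      D_add (k := 24) (m := 4) (d := 6) (by norm_num) rfl (ψ := fun _ => 1) (fun _ => rfl) n]) (tb24_per _ _ _) (fun r hr => ?_) n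
  interval_cases r <;> simp [tb24, D, c8if] <;> ring

section
variable (p : ℕ) [Fact p.Prime]

lemma chi3 (h : p % 24 = 13 ∨ p % 24 = 11 ∨ p % 24 = 23) : chi p 3 = 1 := by
  have ho : Odd p := Nat.odd_iff.mpr (by omega)
  rw [sg_recip p 3 ho (by decide), jacobiSym.mod_left]
  unfold sg
  have h3 : cR ZMod.χ₄ 3 = -1 := chi4_3 3 rfl
  rcases h with h | h | h
  · rw [if_pos (by omega), show ((p:ℤ) % (3:ℕ)) = 1 by omega, jacobiSym.one_left]; norm_num
  · rw [if_neg (by omega), show ((p:ℤ) % (3:ℕ)) = 2 by omega, h3, show jacobiSym 2 3 = -1 by norm_num]; norm_num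
  · rw [if_neg (by omega), show ((p:ℤ) % (3:ℕ)) = 2 by omega, h3, show jacobiSym 2 3 = -1 by norm_num]; norm_num

lemma chi2 (hp2 : p ≠ 2) : chi p 2 = if p % 8 = 1 ∨ p % 8 = 7 then 1 else -1 := by
  have hpp : p.Prime := Fact.out
  have ho := hpp.eq_two_or_odd.resolve_left hp2
  unfold chi
  have := legendreSym.at_two hp2
  push_cast
  rw [this, ZMod.χ₈_nat_eq_if_mod_eight, if_neg (by omega)]
  split_ifs <;> norm_num

lemma pr13 (h : p % 24 = 13) (t : ℝ) (a b : ℝ) (ha : a = √2 / 2) (hb : b = 1 / 4)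
    (ht : HasT (fun n => chi p n * tb24 (a - b) (a + b) (-1) n) t) (h0 : 0 < t) : 0 ≤ LL p (((1:ℕ):ℝ)/(8:ℕ)) := by
  have hp2 : p ≠ 2 := by rintro rfl; omega
  have hpp : p.Prime := Fact.out
  have h2 : Nat.Coprime p 2 := (Nat.coprime_primes hpp Nat.prime_two).mpr hp2
  have h4 : Nat.Coprime p 4 := Nat.Coprime.mul_right h2 h2
  have h8 : Nat.Coprime p 8 := Nat.Coprime.mul_right h2 h4
  obtain ⟨u, hu, hU⟩ := exTc p hp2 (by norm_num) h8 ZMod.χ₈' b8'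
  obtain ⟨v, hv, hV⟩ := exTc p hp2 (by norm_num) h4 ZMod.χ₄ b4
  have c3 := chi3 p (Or.inl h)
  have c2 : chi p 2 = -1 := by rw [chi2 p hp2, if_neg (by omega)]
  have hu3 := hU.D (cm p) 3 three_pos
  have hv3 := hV.D (cm p) 3 three_pos
  have hv2 := hV.D (cm p) 2 two_pos
  have e := ht.unique ((((hU.add (hu3.mul (-1))).mul a).add ((hV.add hv3).mul (-b))).congr fun n => by rw [← t13]; ring)
  refine nonneg1 p (by omega) (by norm_num) (by norm_num) h8
    (((hU.mul (√2/2)).add hv2).congr (fun n => ?_)) ?_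
  · change _ = chi p n * SN 1 8 n
    rw [← id18]; ring
  · rw [c3] at e
    rw [c2]
    subst ha hb
    push_cast at *
    nlinarith

lemma pr11 (h : p % 24 = 11 ∨ p % 24 = 23) (t : ℝ) (a b c : ℝ) (ha : a = 1 / 2) (hb : b = c * √2)
    (hc : c = if p % 24 = 11 then 1 / 8 else 1 / 16)
    (ht : HasT (fun n => chi p n * tb24 (a - b) (a + b) 1 n) t) (h0 : 0 < t) : 0 ≤ LL p (((1:ℕ):ℝ)/(8:ℕ)) := by
  have hp2 : p ≠ 2 := by rintro rfl; omega
  have hpp : p.Prime := Fact.out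
  have h2 : Nat.Coprime p 2 := (Nat.coprime_primes hpp Nat.prime_two).mpr hp2
  have h4 : Nat.Coprime p 4 := Nat.Coprime.mul_right h2 h2
  have h8 : Nat.Coprime p 8 := Nat.Coprime.mul_right h2 h4
  obtain ⟨u, hu, hU⟩ := exTc p hp2 (by norm_num) h8 ZMod.χ₈ b8
  obtain ⟨w, hw, hW⟩ := exTone p hp2
  have c3 := chi3 p (Or.inr h)
  have c2 := chi2 p hp2
  have c6 : chi p 6 = chi p 2 := by rw [show 6 = 2 * 3 by norm_num, cm, c3, mul_one]
  have c4 : chi p 4 = 1 := by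
    rw [show 4 = 2 * 2 by norm_num, cm]
    rcases chi_sq p 2 h2 with h | h <;> rw [h] <;> norm_num
  have c8 : chi p 8 = chi p 2 := by rw [show 8 = 4 * 2 by norm_num, cm, c4, one_mul]
  have hu3 := hU.D (cm p) 3 three_pos
  have hw2 := HasT.D (ψ := fun _ => 1) (cm p) 2 two_pos hW
  have hw3 := HasT.D (ψ := fun _ => 1) (cm p) 3 three_pos hW
  have hw4 := HasT.D (ψ := fun _ => 1) (cm p) 4 four_pos hW
  have hw6 := HasT.D (ψ := fun _ => 1) (cm p) 6 (by norm_num) hW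
  have hw8 := HasT.D (ψ := fun _ => 1) (cm p) 8 (by norm_num) hW
  have e := ht.unique (((((hW.add (hw2.mul (-1))).add ((hw3.mul (-1)).add hw6)).mul a).add ((hU.add hu3).mul (-b))).congr
    fun n => by rw [← t11]; ring)
  refine nonneg3 p (by omega) (by norm_num) (by norm_num) h8
    (((hW.add hw4).add ((hw8.mul (-2)).add (hU.mul (-(√2/2))))).congr (fun n => ?_)) ?_
  · change _ = chi p n * CN 1 8 n
    rw [← id18c]; ring
  · rw [c3, c6] at e
    rw [c4, c8]
    rcases h with h | h
    · rw [if_pos h] at hc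
      rw [if_neg (by omega)] at c2
      rw [c2] at *
      subst hb ha hc
      push_cast at *
      nlinarith
    · rw [if_neg (by omega)] at hc
      rw [if_pos (by omega)] at c2
      rw [c2] at *
      subst hb ha hc
      push_cast at *
      nlinarith
end

/-- the predicate of interest -/
noncomputable def PP (α : ℝ) (p : ℕ) : Prop := ∀ h : Fact p.Prime, 0 ≤ @LL p h α

lemma modK {K : ℕ} [NeZero K] (r p : ℕ) (h : (p : ZMod K) = r) (hr : r < K) : p % K = r := by
  have := (ZMod.natCast_eq_natCast_iff' _ _ _).mp h
  rwa [Nat.mod_eq_of_lt hr] at this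

open Classical in
theorem e13 (δ : ℝ) (hδ : 0 < δ) : ∀ᶠ N : ℕ in atTop, ((24:ℕ).totient : ℝ)⁻¹ * (2 / 3) - δ ≤
    av ((13:ℕ) : ZMod 24) (fun p => if PP (((1:ℕ):ℝ)/(8:ℕ)) p then 1 else 0) N := by
  have q : √2 * √2 = 2 := Real.mul_self_sqrt (by norm_num)
  have q0 : 0 ≤ √2 := Real.sqrt_nonneg _
  have q1 : 1.41 ≤ √2 := by nlinarith
  have q2 : √2 ≤ 1.42 := by nlinarith
  refine prob24 _ (by decide) (√2/2 - 1/4) (√2/2+1/4) (-1) (by linarith) (by linarith) (by rw [abs_le]; constructor <;> linarith)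
    (by norm_num) (by nlinarith) _ ?_ δ hδ
  intro p hp hpr t ht h0 hF
  exact pr13 p (modK 13 p hpr (by norm_num)) t _ _ rfl rfl ht h0

open Classical in
theorem e11 (δ : ℝ) (hδ : 0 < δ) : ∀ᶠ N : ℕ in atTop, ((24:ℕ).totient : ℝ)⁻¹ * (2 / 3) - δ ≤
    av ((11:ℕ) : ZMod 24) (fun p => if PP (((1:ℕ):ℝ)/(8:ℕ)) p then 1 else 0) N := by
  have q : √2 * √2 = 2 := Real.mul_self_sqrt (by norm_num)
  have q0 : 0 ≤ √2 := Real.sqrt_nonneg _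
  have q1 : 1.41 ≤ √2 := by nlinarith
  have q2 : √2 ≤ 1.42 := by nlinarith
  refine prob24 _ (by decide) (1/2 - 1/8*√2) (1/2+1/8*√2) 1 (by linarith) (by linarith) (by rw [abs_le]; constructor <;> linarith)
    (by norm_num) (by nlinarith) _ ?_ δ hδ
  intro p hp hpr t ht h0 hF
  have h := modK 11 p hpr (by norm_num)
  exact pr11 p (Or.inl h) t _ _ (1/8) rfl rfl (by rw [if_pos h]) ht h0

open Classical in
theorem e23 (δ : ℝ) (hδ : 0 < δ) : ∀ᶠ N : ℕ in atTop, ((24:ℕ).totient : ℝ)⁻¹ * (2 / 3) - δ ≤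
    av ((23:ℕ) : ZMod 24) (fun p => if PP (((1:ℕ):ℝ)/(8:ℕ)) p then 1 else 0) N := by
  have q : √2 * √2 = 2 := Real.mul_self_sqrt (by norm_num)
  have q0 : 0 ≤ √2 := Real.sqrt_nonneg _
  have q1 : 1.41 ≤ √2 := by nlinarith
  have q2 : √2 ≤ 1.42 := by nlinarith
  refine prob24 _ (by decide) (1/2 - 1/16*√2) (1/2+1/16*√2) 1 (by linarith) (by linarith) (by rw [abs_le]; constructor <;> linarith)
    (by norm_num) (by nlinarith) _ ?_ δ hδ
  intro p hp hpr t ht h0 hF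
  have h := modK 23 p hpr (by norm_num)
  exact pr11 p (Or.inr h) t _ _ (1/16) rfl rfl (by rw [if_neg (by omega)]) ht h0

end SM
end

section
namespace SM
open Filter Topology Finset LF
open scoped Real

lemma exTper (p : ℕ) [Fact p.Prime] (hp : p ≠ 2) (k : ℕ) (hk : 0 < k) (hpk : Nat.Coprime p k)
    (g : ℕ → ℝ) (C : ℝ) (hg : ∀ n, |g n| ≤ C) (hper : ∀ n, g (n + k) = g n) : ∃ t, HasT (fun n => chi p n * g n) t := by
  obtain ⟨t, ht, _⟩ := exT (fun n => chi p n * g n) _ (persum p hp k hk hpk g C hg hper)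
  exact ⟨t, ht⟩

lemma SN_abs (b k n : ℕ) : |SN b k n| ≤ 1 := Real.abs_sin_le_one _
lemma CN_abs (b k n : ℕ) : |CN b k n| ≤ 2 := by
  unfold CN
  have h1 := Real.neg_one_le_cos (2 * π * n * ((b:ℝ)/k))
  have h2 := Real.cos_le_one (2 * π * n * ((b:ℝ)/k))
  rw [abs_le]; constructor <;> linarith

lemma c25 : Real.cos (2 * π / 5) = (√5 - 1) / 4 := by
  have q : √5 * √5 = 5 := Real.mul_self_sqrt (by norm_num)
  rw [show 2 * π / 5 = 2 * (π / 5) by ring, Real.cos_two_mul, Real.cos_pi_div_five]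
  nlinarith

lemma C151 : CN 1 5 1 = 1 - (√5 - 1) / 4 := CN1 (x := 2 * π / 5) (by push_cast; ring) c25

lemma S15v : SN 1 5 2 = (√5 - 1) / 2 * SN 1 5 1 ∧ SN 1 5 3 = - ((√5 - 1) / 2 * SN 1 5 1) ∧ SN 1 5 4 = - SN 1 5 1 := by
  have q : √5 * √5 = 5 := Real.mul_self_sqrt (by norm_num)
  have h0 := SN_zero 1 5
  have h2 := SN_rec 1 5 0
  have h3 := SN_rec 1 5 1
  have h4 := SN_rec 1 5 2
  norm_num only at h2 h3 h4
  rw [C151] at h2 h3 h4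
  have e2 : SN 1 5 2 = (√5 - 1) / 2 * SN 1 5 1 := by rw [h2, h0]; ring
  have e3 : SN 1 5 3 = - ((√5 - 1) / 2 * SN 1 5 1) := by
    rw [h3, e2]; linear_combination (1/4) * SN 1 5 1 * q
  refine ⟨e2, e3, ?_⟩
  rw [h4, e3, e2]; linear_combination (-1/4) * SN 1 5 1 * q

lemma C15v : CN 1 5 2 = 1 + (√5 + 1) / 4 ∧ CN 1 5 3 = 1 + (√5 + 1) / 4 ∧ CN 1 5 4 = 1 - (√5 - 1) / 4 := by
  have q : √5 * √5 = 5 := Real.mul_self_sqrt (by norm_num)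
  have h0 := CN_zero 1 5
  have h2 := CN_rec 1 5 0
  have h3 := CN_rec 1 5 1
  have h4 := CN_rec 1 5 2
  norm_num only at h2 h3 h4
  have e2 : CN 1 5 2 = 1 + (√5 + 1) / 4 := by rw [h2, h0, C151]; grind
  have e3 : CN 1 5 3 = 1 + (√5 + 1) / 4 := by rw [h3, e2, C151]; grind
  refine ⟨e2, e3, ?_⟩
  rw [h4, e3, e2, C151]; grind

lemma SN25 (n : ℕ) : SN 2 5 n = SN 1 5 (2 * n) := by unfold SN; congr 1; push_cast; ring
lemma CN25 (n : ℕ) : CN 2 5 n = CN 1 5 (2 * n) := by unfold CN; congr 2; push_cast; ring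

lemma S15pos : 0 < SN 1 5 1 := by
  rw [SN1 (b := 1) (k := 5) (x := 2 * π / 5) (by push_cast; ring) rfl]
  apply Real.sin_pos_of_pos_of_lt_pi <;> linarith [Real.pi_pos]

lemma S15if (n : ℕ) : SN 1 5 n = if n % 5 = 0 then 0 else if n % 5 = 1 then SN 1 5 1 else if n % 5 = 2 then SN 1 5 2
    else if n % 5 = 3 then - SN 1 5 2 else - SN 1 5 1 := by
  obtain ⟨e2, e3, e4⟩ := S15v
  refine per_ext (g := fun n => if n % 5 = 0 then 0 else if n % 5 = 1 then SN 1 5 1 else if n % 5 = 2 then SN 1 5 2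
    else if n % 5 = 3 then - SN 1 5 2 else - SN 1 5 1) 5 (by norm_num) (SN_per 1 5 (by norm_num)) (fun n => by simp only [Nat.add_mod_right]) (fun r hr => ?_) n
  interval_cases r <;> simp [SN_zero, e2, e3, e4]

lemma C15if (n : ℕ) : CN 1 5 n = if n % 5 = 0 then 0 else if n % 5 = 1 then CN 1 5 1 else if n % 5 = 2 then CN 1 5 2
    else if n % 5 = 3 then CN 1 5 2 else CN 1 5 1 := by
  obtain ⟨e2, e3, e4⟩ := C15v
  refine per_ext (g := fun n => if n % 5 = 0 then 0 else if n % 5 = 1 then CN 1 5 1 else if n % 5 = 2 then CN 1 5 2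
    else if n % 5 = 3 then CN 1 5 2 else CN 1 5 1) 5 (by norm_num) (CN_per 1 5 (by norm_num)) (fun n => by simp only [Nat.add_mod_right]) (fun r hr => ?_) n
  interval_cases r <;> simp [CN_zero, e2, e3, e4, C151]

lemma tS (σ : ℝ) (n : ℕ) : 1 / 4 * (SN 1 5 n - D 2 (SN 2 5) n + σ / 2 * (SN 2 5 n + D 2 (SN 1 5) n))
    = tb40 ((SN 1 5 1 + σ * SN 1 5 2 / 2) / 4) ((SN 1 5 2 - σ * SN 1 5 1 / 2) / 4) (-1) n := by
  refine per_ext (f := fun n => 1 / 4 * (SN 1 5 n - D 2 (SN 2 5) n + σ / 2 * (SN 2 5 n + D 2 (SN 1 5) n))) 10 (by norm_num)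
    (fun n => ?_) (tb40_per _ _ _) (fun r hr => ?_) n
  · have e1 : SN 1 5 (n + 10) = SN 1 5 n := by rw [S15if (n+10), S15if n, Nat.add_mod, show 10 % 5 = 0 by norm_num, add_zero, Nat.mod_mod]
    have e2 : SN 2 5 (n + 10) = SN 2 5 n := by
      rw [SN25, SN25, S15if (2*(n+10)), S15if (2*n), show 2*(n+10) = 2*n+5*4 by ring, Nat.add_mul_mod_self_left]
    simp only [e1, e2, D_add (k := 10) two_pos rfl (SN_per 1 5 (by norm_num)) n, D_add (k := 10) two_pos rfl (SN_per 2 5 (by norm_num)) n]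
  · simp only [D, SN25]
    generalize hs1 : SN 1 5 1 = s1
    generalize hs2 : SN 1 5 2 = s2
    have H := S15if
    rw [hs1, hs2] at H
    interval_cases r <;> simp [tb40, H] <;> ring

lemma tC (n : ℕ) : 1 / 4 * (CN 1 5 n - D 2 (CN 2 5) n + 1 / 2 * (CN 2 5 n - D 2 (CN 1 5) n))
    = tb40 ((CN 1 5 1 + CN 1 5 2 / 2) / 4) ((CN 1 5 2 + CN 1 5 1 / 2) / 4) 1 n := by
  refine per_ext (f := fun n => 1 / 4 * (CN 1 5 n - D 2 (CN 2 5) n + 1 / 2 * (CN 2 5 n - D 2 (CN 1 5) n))) 10 (by norm_num)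
    (fun n => ?_) (tb40_per _ _ _) (fun r hr => ?_) n
  · have e1 : CN 1 5 (n + 10) = CN 1 5 n := by rw [C15if (n+10), C15if n, Nat.add_mod, show 10 % 5 = 0 by norm_num, add_zero, Nat.mod_mod]
    have e2 : CN 2 5 (n + 10) = CN 2 5 n := by
      rw [CN25, CN25, C15if (2*(n+10)), C15if (2*n), show 2*(n+10) = 2*n+5*4 by ring, Nat.add_mul_mod_self_left]
    simp only [e1, e2, D_add (k := 10) two_pos rfl (CN_per 1 5 (by norm_num)) n, D_add (k := 10) two_pos rfl (CN_per 2 5 (by norm_num)) n]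
  · simp only [D, CN25]
    generalize hs1 : CN 1 5 1 = s1
    generalize hs2 : CN 1 5 2 = s2
    have H := C15if
    rw [hs1, hs2] at H
    interval_cases r <;> simp [tb40, H] <;> ring

section
variable (p : ℕ) [Fact p.Prime]

lemma prS (h : p % 8 = 1 ∨ p % 8 = 5) (h5 : Nat.Coprime p 5) (σ t : ℝ) (hσ : σ = if p % 8 = 1 then 1 else -1)
    (ht : HasT (fun n => chi p n * tb40 ((SN 1 5 1 + σ * SN 1 5 2 / 2) / 4) ((SN 1 5 2 - σ * SN 1 5 1 / 2) / 4) (-1) n) t)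
    (h0 : 0 < t) : 0 ≤ LL p (((1:ℕ):ℝ)/(5:ℕ)) := by
  have hp2 : p ≠ 2 := by rintro rfl; omega
  obtain ⟨u, hU⟩ := exTper p hp2 5 (by norm_num) h5 (SN 1 5) 1 (SN_abs 1 5) (SN_per 1 5 (by norm_num))
  obtain ⟨v, hV⟩ := exTper p hp2 5 (by norm_num) h5 (SN 2 5) 1 (SN_abs 2 5) (SN_per 2 5 (by norm_num))
  have hu2 := hU.D (cm p) 2 two_pos
  have hv2 := hV.D (cm p) 2 two_pos
  have c2 : chi p 2 = σ := by
    rw [chi2 p hp2, hσ]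
    rcases h with h | h
    · rw [if_pos (Or.inl h), if_pos h]
    · rw [if_neg (by omega), if_neg (by omega)]
  have hs : σ * σ = 1 := by rw [hσ]; split_ifs <;> norm_num
  have e := ht.unique ((((hU.add (hv2.mul (-1))).add ((hV.add hu2).mul (σ/2))).mul (1/4)).congr fun n => by rw [← tS]; ring)
  refine nonneg1 p (by omega) (by norm_num) (by norm_num) h5 (hU.congr (fun n => ?_)) (t := u) ?_
  · change _ = chi p n * SN 1 5 n
    rfl
  · rw [c2] at e
    push_cast at e
    have e2 : t = 5 / 16 * u := by rw [e]; linear_combination (1/16) * u * hs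
    linarith

lemma prC (h : p % 8 = 7) (h5 : Nat.Coprime p 5) (t : ℝ)
    (ht : HasT (fun n => chi p n * tb40 ((CN 1 5 1 + CN 1 5 2 / 2) / 4) ((CN 1 5 2 + CN 1 5 1 / 2) / 4) 1 n) t)
    (h0 : 0 < t) : 0 ≤ LL p (((1:ℕ):ℝ)/(5:ℕ)) := by
  have hp2 : p ≠ 2 := by rintro rfl; omega
  obtain ⟨u, hU⟩ := exTper p hp2 5 (by norm_num) h5 (CN 1 5) 2 (CN_abs 1 5) (CN_per 1 5 (by norm_num))
  obtain ⟨v, hV⟩ := exTper p hp2 5 (by norm_num) h5 (CN 2 5) 2 (CN_abs 2 5) (CN_per 2 5 (by norm_num))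
  have hu2 := hU.D (cm p) 2 two_pos
  have hv2 := hV.D (cm p) 2 two_pos
  have c2 : chi p 2 = 1 := by rw [chi2 p hp2, if_pos (Or.inr h)]
  have e := ht.unique ((((hU.add (hv2.mul (-1))).add ((hV.add (hu2.mul (-1))).mul (1/2))).mul (1/4)).congr fun n => by rw [← tC]; ring)
  refine nonneg3 p (by omega) (by norm_num) (by norm_num) h5 (hU.congr (fun n => ?_)) (t := u) ?_
  · change _ = chi p n * CN 1 5 n
    rfl
  · rw [c2] at e
    push_cast at e
    linarith
end

open Classical in
theorem e40 (r : ℕ) (hr40 : r < 40) (hr : Nat.Coprime r 40) (hr3 : r % 8 ≠ 3) (δ : ℝ) (hδ : 0 < δ) :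
    ∀ᶠ N : ℕ in atTop, ((40:ℕ).totient : ℝ)⁻¹ * (2 / 3) - δ ≤
    av (r : ZMod 40) (fun p => if PP (((1:ℕ):ℝ)/(5:ℕ)) p then 1 else 0) N := by
  have hu : IsUnit (r : ZMod 40) := (ZMod.isUnit_iff_coprime r 40).mpr hr
  have q : √5 * √5 = 5 := Real.mul_self_sqrt (by norm_num)
  have q0 : 0 ≤ √5 := Real.sqrt_nonneg _
  have q1 : 2.236 ≤ √5 := by nlinarith
  have q2 : √5 ≤ 2.237 := by nlinarith
  have hodd : r % 2 = 1 := by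
    have := Nat.Coprime.coprime_dvd_right (by norm_num : 2 ∣ 40) hr
    exact Nat.odd_iff.mp (Nat.coprime_two_right.mp this)
  have h5 : ∀ p : ℕ, (p : ZMod 40) = r → Nat.Coprime p 5 := fun p hp =>
    Nat.Coprime.coprime_dvd_right (by norm_num) (cop_of _ hu p hp)
  by_cases h7 : r % 8 = 7
  · have k1 := C151
    have k2 := C15v.1
    have l1 : CN 1 5 1 = 1 - (√5 - 1) / 4 := k1
    refine prob40 _ hu ((CN 1 5 1 + CN 1 5 2 / 2) / 4) ((CN 1 5 2 + CN 1 5 1 / 2) / 4) 1 ?_ ?_ ?_ (by norm_num) ?_ _ ?_ δ hδ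
    · rw [k1, k2]; linarith
    · rw [k1, k2]; linarith
    · rw [k1, k2, abs_le]; constructor <;> linarith
    · rw [k1, k2]; nlinarith
    · intro p hp hpr t ht h0 hF
      have h := modK r p hpr hr40
      exact prC p (by omega) (h5 p hpr) t ht h0
  · have s0 := S15pos
    have s1 : SN 1 5 1 ≤ 1 := (le_abs_self _).trans (SN_abs 1 5 1)
    have k2 := S15v.1
    set σ : ℝ := if r % 8 = 1 then 1 else -1 with hσ
    have hσ2 : σ = 1 ∨ σ = -1 := by rw [hσ]; split_ifs <;> simp
    have hs2a : 0.618 * SN 1 5 1 ≤ SN 1 5 2 := by rw [k2]; nlinarith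
    have hs2b : SN 1 5 2 ≤ 0.6185 * SN 1 5 1 := by rw [k2]; nlinarith
    refine prob40 _ hu ((SN 1 5 1 + σ * SN 1 5 2 / 2) / 4) ((SN 1 5 2 - σ * SN 1 5 1 / 2) / 4) (-1) ?_ ?_ ?_ (by norm_num) ?_ _ ?_ δ hδ
    · rcases hσ2 with h | h <;> rw [h] <;> linarith
    · rcases hσ2 with h | h <;> rw [h] <;> linarith
    · rcases hσ2 with h | h <;> rw [h, abs_le] <;> constructor <;> linarith
    · rcases hσ2 with h | h <;> rw [h] <;> nlinarith
    · intro p hp hpr t ht h0 hF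
      have h := modK r p hpr hr40
      exact prS p (by omega) (h5 p hpr) σ t (by rw [hσ]; congr 1; rw [eq_iff_iff]; omega) ht h0

end SM
end

section
namespace SM
open Filter Topology Finset LF
open scoped Real

open Classical in
theorem fin {K : ℕ} [NeZero K] (s : Finset (ZMod K)) (β : ZMod K → ℝ) (P : ℕ → Prop)
    (h : ∀ r ∈ s, ∀ δ > 0, ∀ᶠ N : ℕ in atTop, β r - δ ≤ av r (fun p => if P p then 1 else 0) N)
    (hβ : 1 / 2 ≤ ∑ r ∈ s, β r) :
    (1:ℝ)/2 ≤ Filter.liminf (fun N : ℕ => (((Finset.range (N+1)).filter (fun p => p.Prime ∧ P p)).card : ℝ) /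
      (((Finset.range (N+1)).filter Nat.Prime).card : ℝ)) Filter.atTop := by
  have key : ∀ ε : ℝ, 0 < ε → ε ≤ 1/2 → ∀ᶠ N : ℕ in atTop, 1/2 - ε ≤ (((Finset.range (N+1)).filter (fun p => p.Prime ∧ P p)).card : ℝ) /
      (((Finset.range (N+1)).filter Nat.Prime).card : ℝ) := by
    intro ε hε hε2
    have hd : 0 < ε / (4 * ((s.card : ℝ) + 1)) := by positivity
    have hA : ∀ᶠ N : ℕ in atTop, ∀ r ∈ s, β r - ε / (4 * ((s.card : ℝ) + 1)) ≤ av r (fun p => if P p then 1 else 0) N :=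
      (Finset.eventually_all s).mpr fun r hr => h r hr _ hd
    have hB1 := PNT.pi_tendsto.eventually (gt_mem_nhds (show (1:ℝ) < 1 + ε by linarith))
    have hB2 := PNT.pi_tendsto.eventually (lt_mem_nhds (show (0:ℝ) < 1 by norm_num))
    filter_upwards [hA, hB1, hB2, eventually_ge_atTop 3] with N hA hB1 hB2 hN
    have hNr : (3:ℝ) ≤ N := by exact_mod_cast hN
    have hlog : 0 < Real.log N := Real.log_pos (by linarith)
    set w := Real.log (N:ℝ) / N with hw
    have hw0 : 0 < w := by positivity
    set A : ℝ := (((Finset.range (N+1)).filter (fun p => p.Prime ∧ P p)).card : ℝ)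
    have hBe : (PNT.primesTo N).card = ((Finset.range (N+1)).filter Nat.Prime).card := by unfold PNT.primesTo; congr
    rw [mul_div_assoc, hBe, ← hw] at hB1 hB2
    set B : ℝ := (((Finset.range (N+1)).filter Nat.Prime).card : ℝ)
    have hBp : 0 < B := by
      by_contra hh
      nlinarith
    have h1 : ∑ r ∈ s, (β r - ε / (4 * ((s.card : ℝ) + 1))) ≤ A * w := by
      refine (Finset.sum_le_sum hA).trans ?_
      have : ∑ r ∈ s, av r (fun p => if P p then 1 else 0) N = (∑ r ∈ s, (((PNT.cls r N).filter P).card : ℝ)) * w := by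
        rw [Finset.sum_mul]
        refine Finset.sum_congr rfl fun r _ => ?_
        unfold av
        rw [mul_div_assoc, Finset.sum_boole]
      rw [this]
      refine mul_le_mul_of_nonneg_right ?_ hw0.le
      rw [← Nat.cast_sum, ← Finset.card_biUnion]
      · refine Nat.cast_le.mpr (Finset.card_le_card ?_)
        intro p hp
        simp only [PNT.cls, Finset.mem_biUnion, Finset.mem_filter] at hp ⊢
        obtain ⟨r, _, ⟨h1, h2, _⟩, h3⟩ := hp
        exact ⟨h1, h2, h3⟩
      · intro r _ r' _ hne
        rw [Function.onFun, Finset.disjoint_left]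
        intro p hp hp'
        simp only [PNT.cls, Finset.mem_filter] at hp hp'
        exact hne (hp.1.2.2.symm.trans hp'.1.2.2)
    rw [Finset.sum_sub_distrib, Finset.sum_const, nsmul_eq_mul] at h1
    have h2 : (s.card : ℝ) * (ε / (4 * ((s.card : ℝ) + 1))) ≤ ε / 4 := by
      rw [← mul_div_assoc, div_le_div_iff₀ (by positivity) (by norm_num)]
      nlinarith
    rw [le_div_iff₀ hBp]
    have h3 : (1/2 - ε) * (B * w) ≤ (1/2 - ε) * (1 + ε) := mul_le_mul_of_nonneg_left hB1.le (by linarith)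
    have h4 : (1/2 - ε) * B * w ≤ A * w := by nlinarith
    exact le_of_mul_le_mul_right h4 hw0
  have hle : ∀ N : ℕ, (((Finset.range (N+1)).filter (fun p => p.Prime ∧ P p)).card : ℝ) /
      (((Finset.range (N+1)).filter Nat.Prime).card : ℝ) ≤ 1 := by
    intro N
    refine div_le_one_of_le₀ ?_ (Nat.cast_nonneg _)
    refine Nat.cast_le.mpr (Finset.card_le_card ?_)
    intro p hp
    simp only [Finset.mem_filter] at hp ⊢
    exact ⟨hp.1, hp.2.1⟩
  refine le_of_forall_sub_le fun ε hε => ?_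
  have hm : min ε (1/2) ≤ ε := min_le_left _ _
  refine le_trans (by linarith : 1/2 - ε ≤ 1/2 - min ε (1/2)) ?_
  exact Filter.le_liminf_of_le (isCoboundedUnder_ge_of_le _ hle) (key _ (lt_min hε (by norm_num)) (min_le_right _ _))

open Classical in
lemma det {K : ℕ} [NeZero K] (r : ℕ) (hr : Nat.Coprime r K) (hrK : r < K) (P : ℕ → Prop)
    (h : ∀ p : ℕ, p.Prime → Nat.Coprime p K → p % K = r → P p) (δ : ℝ) (hδ : 0 < δ) :
    ∀ᶠ N : ℕ in atTop, (K.totient : ℝ)⁻¹ - δ ≤ av (r : ZMod K) (fun p => if P p then 1 else 0) N := by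
  have hu : IsUnit (r : ZMod K) := (ZMod.isUnit_iff_coprime r K).mpr hr
  have h1 := PNT.cls_tendsto (r : ZMod K) hu
  filter_upwards [h1.eventually (lt_mem_nhds (show (K.totient : ℝ)⁻¹ - δ < (K.totient : ℝ)⁻¹ by linarith))] with N hN
  refine hN.le.trans (le_of_eq ?_)
  unfold av
  rw [Finset.sum_congr rfl (g := fun _ => (1:ℝ))]
  · simp
  · intro p hp
    simp only [PNT.cls, Finset.mem_filter] at hp
    exact if_pos (h p hp.2.1 (cop_of _ hu p hp.2.2) (modK r p hp.2.2 hrK))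

end SM
end

namespace SM
open LF

lemma PP_iff (α : ℝ) (p : ℕ) (hp : p.Prime) : PP α p ↔ 0 ≤ legendreSum α p := by
  unfold PP legendreSum LL
  rw [dif_pos hp]
  exact ⟨fun h => h ⟨hp⟩, fun h _ => h⟩

theorem red (α : ℝ) (b k : ℕ) (hα : α = ((b:ℕ):ℝ)/(k:ℕ)) (K : ℕ) [NeZero K] (s : Finset ℕ) (hs : ∀ r ∈ s, r < K)
    (β : ℕ → ℝ)
    (h : ∀ r ∈ s, ∀ δ > 0, ∀ᶠ N : ℕ in Filter.atTop, β r - δ ≤ av (r : ZMod K) (fun p => if PP (((b:ℕ):ℝ)/(k:ℕ)) p then 1 else 0) N)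
    (hβ : 1 / 2 ≤ ∑ r ∈ s, β r) :
    (1:ℝ)/2 ≤ Filter.liminf (fun N : ℕ => (((Finset.range (N+1)).filter (fun p => p.Prime ∧ 0 ≤ legendreSum α p)).card : ℝ) /
      (((Finset.range (N+1)).filter Nat.Prime).card : ℝ)) Filter.atTop := by
  have hval : ∀ r ∈ s, ((r : ZMod K)).val = r := fun r hr => by
    rw [ZMod.val_natCast, Nat.mod_eq_of_lt (hs r hr)]
  have h1 := fin (K := K) (s.image (fun r : ℕ => (r : ZMod K))) (fun r => β r.val) (PP α) ?_ ?_
  · refine h1.trans (le_of_eq ?_)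
    congr 1
    funext N
    congr 2
    congr 1
    ext p
    simp only [Finset.mem_filter]
    refine and_congr_right fun _ => and_congr_right fun hp => PP_iff α p hp
  · intro r hr δ hδ
    obtain ⟨n, hn, rfl⟩ := Finset.mem_image.mp hr
    rw [hval n hn, hα]
    exact h n hn δ hδ
  · rw [Finset.sum_image]
    · rw [Finset.sum_congr rfl (g := β)]
      · exact hβ
      · intro r hr
        rw [hval r hr]
    · intro r hr r' hr' e
      rw [← hval r hr, ← hval r' hr']
      exact congrArg ZMod.val e

/-- the deterministic cases -/
theorem redd (α : ℝ) (b k : ℕ) (hα : α = ((b:ℕ):ℝ)/(k:ℕ)) (K : ℕ) [NeZero K] (s : Finset ℕ) (hs : ∀ r ∈ s, r < K)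
    (hc : ∀ r ∈ s, Nat.Coprime r K) (hcard : K.totient ≤ 2 * s.card)
    (h : ∀ (p : ℕ) [Fact p.Prime], Nat.Coprime p K → p % K ∈ s → 0 ≤ LL p (((b:ℕ):ℝ)/(k:ℕ))) :
    (1:ℝ)/2 ≤ Filter.liminf (fun N : ℕ => (((Finset.range (N+1)).filter (fun p => p.Prime ∧ 0 ≤ legendreSum α p)).card : ℝ) /
      (((Finset.range (N+1)).filter Nat.Prime).card : ℝ)) Filter.atTop := by
  refine red α b k hα K s hs (fun _ => (K.totient : ℝ)⁻¹) (fun r hr => ?_) ?_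
  · refine det r (hc r hr) (hs r hr) _ (fun p hp hpK hpr hF => ?_)
    exact @h p hF hpK (hpr ▸ hr)
  · rw [Finset.sum_const, nsmul_eq_mul]
    have h1 : (0:ℝ) < K.totient := by exact_mod_cast Nat.totient_pos.mpr (NeZero.pos K)
    have h2 : (K.totient : ℝ) ≤ 2 * s.card := by exact_mod_cast hcard
    rw [← div_eq_mul_inv, div_le_div_iff₀ (by norm_num) h1]
    linarith

theorem red18 (α : ℝ) (hα : α = ((1:ℕ):ℝ)/(8:ℕ)) :
    (1:ℝ)/2 ≤ Filter.liminf (fun N : ℕ => (((Finset.range (N+1)).filter (fun p => p.Prime ∧ 0 ≤ legendreSum α p)).card : ℝ) /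
      (((Finset.range (N+1)).filter Nat.Prime).card : ℝ)) Filter.atTop := by
  have h24 : (24:ℕ).totient = 8 := by decide
  have e : ∀ r : ℕ, r % 8 = 1 → Nat.Coprime r 24 → r < 24 → ∀ δ : ℝ, 0 < δ → ∀ᶠ N : ℕ in Filter.atTop, ((24:ℕ).totient : ℝ)⁻¹ - δ ≤
      av (r : ZMod 24) (fun p => if PP (((1:ℕ):ℝ)/(8:ℕ)) p then 1 else 0) N := by
    intro r hr hrc hr24
    refine det r hrc hr24 _ (fun p hp hpK hpr hF => ?_)
    exact case18 p (by omega)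
  refine red α 1 8 hα 24 {1, 17, 13, 11, 23} (by decide) (fun r => if r = 1 ∨ r = 17 then ((24:ℕ).totient : ℝ)⁻¹ else ((24:ℕ).totient : ℝ)⁻¹ * (2/3)) ?_ ?_
  · intro r hr δ hδ
    simp only [Finset.mem_insert, Finset.mem_singleton] at hr
    rcases hr with rfl | rfl | rfl | rfl | rfl
    · simpa using e 1 rfl (by decide) (by norm_num) δ hδ
    · simpa using e 17 rfl (by decide) (by norm_num) δ hδ
    · simpa using e13 δ hδ
    · simpa using e11 δ hδ
    · simpa using e23 δ hδ
  · rw [h24]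
    simp
    norm_num

theorem red15 (α : ℝ) (hα : α = ((1:ℕ):ℝ)/(5:ℕ)) :
    (1:ℝ)/2 ≤ Filter.liminf (fun N : ℕ => (((Finset.range (N+1)).filter (fun p => p.Prime ∧ 0 ≤ legendreSum α p)).card : ℝ) /
      (((Finset.range (N+1)).filter Nat.Prime).card : ℝ)) Filter.atTop := by
  have h40 : (40:ℕ).totient = 16 := by decide
  have hs : ∀ r ∈ ({1, 7, 9, 13, 17, 21, 23, 29, 31, 33, 37, 39} : Finset ℕ), r < 40 ∧ Nat.Coprime r 40 ∧ r % 8 ≠ 3 := by decide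
  refine red α 1 5 hα 40 {1, 7, 9, 13, 17, 21, 23, 29, 31, 33, 37, 39} (fun r hr => (hs r hr).1) (fun r => ((40:ℕ).totient : ℝ)⁻¹ * (2/3)) ?_ ?_
  · intro r hr δ hδ
    exact e40 r (hs r hr).1 (hs r hr).2.1 (hs r hr).2.2 δ hδ
  · rw [h40, Finset.sum_const, nsmul_eq_mul]
    simp
    norm_num

lemma mod4_12 (p : ℕ) (h : p % 12 ∈ ({1, 5} : Finset ℕ)) : p % 4 = 1 := by
  simp only [Finset.mem_insert, Finset.mem_singleton] at h; omega

theorem all_cases (α : ℚ) (h0 : 0 ≤ α) (h2 : α ≤ 1 / 2)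
    (hden : α.den ∈ ({1, 2, 3, 4, 5, 6, 8, 12} : Set ℕ)) :
    (1:ℝ)/2 ≤ Filter.liminf (fun N : ℕ => (((Finset.range (N+1)).filter (fun p => p.Prime ∧ 0 ≤ legendreSum (α:ℝ) p)).card : ℝ) /
      (((Finset.range (N+1)).filter Nat.Prime).card : ℝ)) Filter.atTop := by
  obtain ⟨b, hb⟩ : ∃ b : ℕ, α.num = b := ⟨α.num.toNat, (Int.toNat_of_nonneg (Rat.num_nonneg.mpr h0)).symm⟩
  have hα : α = (b:ℚ) / (α.den : ℕ) := by
    conv_lhs => rw [← Rat.num_div_den α, hb]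
    simp
  have hdp : (0:ℚ) < (α.den : ℕ) := by exact_mod_cast α.den_pos
  have hle : 2 * b ≤ α.den := by
    rw [hα, div_le_div_iff₀ hdp (by norm_num)] at h2
    have : ((2 * b : ℕ) : ℚ) ≤ (α.den : ℕ) := by push_cast; linarith
    exact_mod_cast this
  have hcop : Nat.Coprime b α.den := by
    have := α.reduced
    rw [hb] at this
    simpa using this
  have hαr : (α:ℝ) = (b:ℝ) / (α.den : ℕ) := by
    conv_lhs => rw [hα]
    push_cast
    rfl
  generalize hd : α.den = d at *
  generalize (α:ℝ) = x at *
  clear hα h0 h2 hdp hd hb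
  simp only [Set.mem_insert_iff, Set.mem_singleton_iff] at hden
  have c4 : ∀ (s : Finset ℕ), s = {1} → ∀ p, p % 4 ∈ s → p % 4 = 1 := by
    rintro s rfl p hp; simpa using hp
  have c43 : ∀ p, p % 4 ∈ ({3} : Finset ℕ) → p % 4 = 3 := by
    intro p hp; simpa using hp
  rcases hden with rfl | rfl | rfl | rfl | rfl | rfl | rfl | rfl
  · obtain rfl : b = 0 := by omega
    refine redd x 0 1 hαr 1 {0} (by decide) (by decide) (by decide) (fun p hF _ _ => ?_)
    unfold LL; simp
  · have : b ≤ 1 := by omega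
    interval_cases b
    · exact absurd hcop (by decide)
    · exact redd x 1 2 hαr 4 {1} (by decide) (by decide) (by decide) (fun p hF hc hp =>
        case12 p (c4 _ rfl p hp) (Nat.Coprime.coprime_dvd_right (by norm_num) hc))
  · have : b ≤ 1 := by omega
    interval_cases b
    · exact absurd hcop (by decide)
    · exact redd x 1 3 hαr 12 {1, 5} (by decide) (by decide) (by decide) (fun p hF hc hp =>
        case13 p (mod4_12 p hp) (Nat.Coprime.coprime_dvd_right (by norm_num) hc))
  · have : b ≤ 2 := by omega
    interval_cases b
    · exact absurd hcop (by decide)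
    · exact redd x 1 4 hαr 4 {1} (by decide) (by decide) (by decide) (fun p hF hc hp =>
        case14 p (c4 _ rfl p hp) hc)
    · exact absurd hcop (by decide)
  · have : b ≤ 2 := by omega
    interval_cases b
    · exact absurd hcop (by decide)
    · exact red15 x hαr
    · refine redd x 2 5 hαr 20 {3, 7, 11, 19} (by decide) (by decide) (by decide) (fun p hF hc hp =>
        case25 p ?_ (Nat.Coprime.coprime_dvd_right (by norm_num) hc))
      simp only [Finset.mem_insert, Finset.mem_singleton] at hp; omega
  · have : b ≤ 3 := by omega
    interval_cases b
    · exact absurd hcop (by decide)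
    · exact redd x 1 6 hαr 12 {1, 5} (by decide) (by decide) (by decide) (fun p hF hc hp =>
        case16 p (mod4_12 p hp) (Nat.Coprime.coprime_dvd_right (by norm_num) hc))
    · exact absurd hcop (by decide)
    · exact absurd hcop (by decide)
  · have : b ≤ 4 := by omega
    interval_cases b
    · exact absurd hcop (by decide)
    · exact red18 x hαr
    · exact absurd hcop (by decide)
    · exact redd x 3 8 hαr 4 {3} (by decide) (by decide) (by decide) (fun p hF hc hp =>
        case38 p (c43 p hp))
    · exact absurd hcop (by decide)
  · have : b ≤ 6 := by omega
    interval_cases b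
    · exact absurd hcop (by decide)
    · exact redd x 1 12 hαr 12 {1, 5} (by decide) (by decide) (by decide) (fun p hF hc hp =>
        case112 p (mod4_12 p hp) hc)
    · exact absurd hcop (by decide)
    · exact absurd hcop (by decide)
    · exact absurd hcop (by decide)
    · refine redd x 5 12 hαr 12 {7, 11} (by decide) (by decide) (by decide) (fun p hF hc hp =>
        case512 p ?_ hc)
      simp only [Finset.mem_insert, Finset.mem_singleton] at hp; omega
    · exact absurd hcop (by decide)

end SM

/-- For every rational `0 ≤ α ≤ 1/2` whose denominator (in lowest terms) lies
in `{1,2,3,4,5,6,8,12}`, the inequality `L(α,p) ≥ 0` holds for a set of primes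
of lower density at least `1/2`. -/
theorem stmt_2 (α : ℚ) (h0 : 0 ≤ α) (h2 : α ≤ 1 / 2)
    (hden : α.den ∈ ({1, 2, 3, 4, 5, 6, 8, 12} : Set ℕ)) :
    (1 : ℝ) / 2 ≤
      Filter.liminf (fun N : ℕ =>
        (((Finset.range (N + 1)).filter
            (fun p => p.Prime ∧ 0 ≤ legendreSum (α : ℝ) p)).card : ℝ) /
          (((Finset.range (N + 1)).filter Nat.Prime).card : ℝ))
        Filter.atTop := by
  exact SM.all_cases α h0 h2 hden
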